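/- arXiv:1509.00760 — 3 statements merged into one kernel-verified Lean document; each statement's English description precedes it below -/
import Mathlib

section
/- For every positive integer k, the graph G_k is 4-colorable, so its chromatic number is exactly 4 (given that it is not 3-colorable). -/
open SimpleGraph

/-- Vertex type of `H_k`: the `u`'s, the `v`'s and the `w`'s. -/
abbrev HVert (k : ℕ) := Fin (k+1) ⊕ Fin (k+1) ⊕ Fin k

/-- The vertex `u_i`. -/
def uVert (k : ℕ) (i : Fin (k+1)) : HVert k := Sum.inl i

/-- The vertex `v_i`. -/
def vVert (k : ℕ) (i : Fin (k+1)) : HVert k := Sum.inr (Sum.inl i)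

/-- The vertex `w_{t+1}` (indexed by `t : Fin k`). -/
def wVert (k : ℕ) (t : Fin k) : HVert k := Sum.inr (Sum.inr t)

/-- Base relation generating the edges of `H_k`:
`u_{i-1}u_i`, `v_{i-1}v_i`, and `w_i u_{i-1}, w_i u_i, w_i v_{i-1}, w_i v_i`. -/
def HRel (k : ℕ) : HVert k → HVert k → Prop
  | Sum.inl i, Sum.inl j => (i : ℕ) + 1 = j
  | Sum.inr (Sum.inl i), Sum.inr (Sum.inl j) => (i : ℕ) + 1 = j
  | Sum.inr (Sum.inr t), Sum.inl i => (i : ℕ) = t ∨ (i : ℕ) = (t : ℕ) + 1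
  | Sum.inr (Sum.inr t), Sum.inr (Sum.inl i) => (i : ℕ) = t ∨ (i : ℕ) = (t : ℕ) + 1
  | _, _ => False

/-- The graph `H_k`. -/
def Hgraph (k : ℕ) : SimpleGraph (HVert k) := SimpleGraph.fromRel (HRel k)

/-- Vertex type of `G_k`: the vertices of `H_{2k}` together with `x1, x2, x3, y1, y2`. -/
abbrev GVert (k : ℕ) := HVert (2*k) ⊕ Fin 5

def x1V (k : ℕ) : GVert k := Sum.inr 0
def x2V (k : ℕ) : GVert k := Sum.inr 1
def x3V (k : ℕ) : GVert k := Sum.inr 2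
def y1V (k : ℕ) : GVert k := Sum.inr 3
def y2V (k : ℕ) : GVert k := Sum.inr 4

/-- The vertex `u_i` inside `G_k`. -/
def Gu (k : ℕ) (i : Fin (2*k+1)) : GVert k := Sum.inl (uVert (2*k) i)

/-- The vertex `v_i` inside `G_k`. -/
def Gv (k : ℕ) (i : Fin (2*k+1)) : GVert k := Sum.inl (vVert (2*k) i)

/-- The vertex `w_{t+1}` inside `G_k`. -/
def Gw (k : ℕ) (t : Fin (2*k)) : GVert k := Sum.inl (wVert (2*k) t)

/-- Base relation generating the edges of `G_k`: the edges of `H_{2k}` together with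
`x_1 u_j` (`j` even), `y_1 v_j` (`j` odd), `x_1x_2, x_1x_3, x_1y_2, x_2y_1, x_2y_2,
x_2v_0, x_2x_3, x_3y_1, x_3v_{2k}, x_3u_{2k}, y_2w_1`. -/
def GRel (k : ℕ) : GVert k → GVert k → Prop
  | Sum.inl a, Sum.inl b => HRel (2*k) a b
  | Sum.inr i, Sum.inl (Sum.inl j) =>
      (i = 0 ∧ (j : ℕ) % 2 = 0) ∨ (i = 2 ∧ (j : ℕ) = 2*k)
  | Sum.inr i, Sum.inl (Sum.inr (Sum.inl j)) =>
      (i = 3 ∧ (j : ℕ) % 2 = 1) ∨ (i = 1 ∧ (j : ℕ) = 0) ∨ (i = 2 ∧ (j : ℕ) = 2*k)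
  | Sum.inr i, Sum.inl (Sum.inr (Sum.inr t)) => i = 4 ∧ (t : ℕ) = 0
  | Sum.inr i, Sum.inr j =>
      (i = 0 ∧ (j = 1 ∨ j = 2 ∨ j = 4)) ∨ (i = 1 ∧ (j = 3 ∨ j = 4 ∨ j = 2)) ∨ (i = 2 ∧ j = 3)
  | _, _ => False

/-- The graph `G_k`. -/
def Ggraph (k : ℕ) : SimpleGraph (GVert k) := SimpleGraph.fromRel (GRel k)

theorem fin3_cover : ∀ a b c x : Fin 3, a ≠ b → a ≠ c → b ≠ c → x = a ∨ x = b ∨ x = c := by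
  decide

/-- An explicit 4-coloring. -/
def fourCol (k : ℕ) : GVert k → Fin 4
  | Sum.inl (Sum.inl i) => if (i : ℕ) % 2 = 0 then 1 else 2
  | Sum.inl (Sum.inr (Sum.inl i)) => if (i : ℕ) % 2 = 0 then 0 else 1
  | Sum.inl (Sum.inr (Sum.inr _)) => 3
  | Sum.inr i => if i = 0 then 0 else if i = 1 then 1 else if i = 2 then 2 else
      if i = 3 then 0 else 2

theorem fourCol_rel (k : ℕ) : ∀ x y, GRel k x y → fourCol k x ≠ fourCol k y := by
  rintro ((i | i | i) | i) ((j | j | j) | j) h <;> simp only [GRel, HRel, fourCol] at h ⊢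
  all_goals first
    | exact h.elim
    | (split_ifs <;> first | decide | omega)

theorem no_three (k : ℕ) (hk : 1 ≤ k) (f : GVert k → Fin 3)
    (hf : ∀ x y, x ≠ y → GRel k x y → f x ≠ f y) : False := by
  have x12 : f (Sum.inr 0) ≠ f (Sum.inr 1) := hf _ _ (by simp) (by simp [GRel])
  have x13 : f (Sum.inr 0) ≠ f (Sum.inr 2) := hf _ _ (by simp) (by simp [GRel])
  have x23 : f (Sum.inr 1) ≠ f (Sum.inr 2) := hf _ _ (by simp) (by simp [GRel])
  have x1y2 : f (Sum.inr 0) ≠ f (Sum.inr 4) := hf _ _ (by simp) (by simp [GRel])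
  have x2y2 : f (Sum.inr 1) ≠ f (Sum.inr 4) := hf _ _ (by simp) (by simp [GRel])
  have x2y1 : f (Sum.inr 1) ≠ f (Sum.inr 3) := hf _ _ (by simp) (by simp [GRel])
  have x3y1 : f (Sum.inr 2) ≠ f (Sum.inr 3) := hf _ _ (by simp) (by simp [GRel])
  have cov := fun x => fin3_cover _ _ _ x x12 x13 x23
  -- total versions of the colorings of the three paths
  obtain ⟨u, hu⟩ : ∃ u : ℕ → Fin 3, ∀ i (h : i < 2*k+1), f (Sum.inl (Sum.inl ⟨i, h⟩)) = u i :=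
    ⟨fun i => if h : i < 2*k+1 then f (Sum.inl (Sum.inl ⟨i, h⟩)) else 0,
      fun i h => by simp [h]⟩
  obtain ⟨v, hv⟩ : ∃ v : ℕ → Fin 3, ∀ i (h : i < 2*k+1),
      f (Sum.inl (Sum.inr (Sum.inl ⟨i, h⟩))) = v i :=
    ⟨fun i => if h : i < 2*k+1 then f (Sum.inl (Sum.inr (Sum.inl ⟨i, h⟩))) else 0,
      fun i h => by simp [h]⟩
  obtain ⟨w, hw⟩ : ∃ w : ℕ → Fin 3, ∀ i (h : i < 2*k),
      f (Sum.inl (Sum.inr (Sum.inr ⟨i, h⟩))) = w i :=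
    ⟨fun i => if h : i < 2*k then f (Sum.inl (Sum.inr (Sum.inr ⟨i, h⟩))) else 0,
      fun i h => by simp [h]⟩
  have uu : ∀ i, i < 2*k → u i ≠ u (i+1) := fun i h => by
    rw [← hu i (by omega), ← hu (i+1) (by omega)]
    exact hf _ _ (by simp) (by simp [GRel, HRel])
  have vv : ∀ i, i < 2*k → v i ≠ v (i+1) := fun i h => by
    rw [← hv i (by omega), ← hv (i+1) (by omega)]
    exact hf _ _ (by simp) (by simp [GRel, HRel])
  have wu : ∀ i, i < 2*k → w i ≠ u i := fun i h => by
    rw [← hu i (by omega), ← hw i (by omega)]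
    exact hf _ _ (by simp) (by simp [GRel, HRel])
  have wu' : ∀ i, i < 2*k → w i ≠ u (i+1) := fun i h => by
    rw [← hu (i+1) (by omega), ← hw i (by omega)]
    exact hf _ _ (by simp) (by simp [GRel, HRel])
  have wv : ∀ i, i < 2*k → w i ≠ v i := fun i h => by
    rw [← hv i (by omega), ← hw i (by omega)]
    exact hf _ _ (by simp) (by simp [GRel, HRel])
  have wv' : ∀ i, i < 2*k → w i ≠ v (i+1) := fun i h => by
    rw [← hv (i+1) (by omega), ← hw i (by omega)]
    exact hf _ _ (by simp) (by simp [GRel, HRel])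
  have xu : ∀ i, i ≤ k → f (Sum.inr 0) ≠ u (2*i) := fun i h => by
    rw [← hu (2*i) (by omega)]
    exact hf _ _ (by simp) (by simp [GRel])
  have yv : ∀ i, i < k → f (Sum.inr 3) ≠ v (2*i+1) := fun i h => by
    rw [← hv (2*i+1) (by omega)]
    exact hf _ _ (by simp) (by simp [GRel])
  have xv0 : f (Sum.inr 1) ≠ v 0 := by
    rw [← hv 0 (by omega)]
    exact hf _ _ (by simp) (by simp [GRel])
  have xvk : f (Sum.inr 2) ≠ v (2*k) := by
    rw [← hv (2*k) (by omega)]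
    exact hf _ _ (by simp) (by simp [GRel])
  have xuk : f (Sum.inr 2) ≠ u (2*k) := by
    rw [← hu (2*k) (by omega)]
    exact hf _ _ (by simp) (by simp [GRel])
  have yw : f (Sum.inr 4) ≠ w 0 := by
    rw [← hw 0 (by omega)]
    exact hf _ _ (by simp) (by simp [GRel])
  generalize f (Sum.inr 0) = a at *
  generalize f (Sum.inr 1) = b at *
  generalize f (Sum.inr 2) = c at *
  generalize f (Sum.inr 3) = y at *
  generalize f (Sum.inr 4) = z at *
  have hy : y = a := by have := cov y; grind
  have hz : z = c := by have := cov z; grind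
  subst hy hz
  have inv : ∀ i, i ≤ k → (u (2*i) = z ∧ v (2*i) = z) ∨ (u (2*i) = b ∧ v (2*i) = z) ∨
      (u (2*i) = z ∧ v (2*i) = y) := by
    intro i
    induction i with
    | zero =>
      intro _
      have h1 := cov (u 0)
      have h2 := cov (v 0)
      have h3 := cov (w 0)
      have h4 := xu 0 (by omega)
      have h5 := wu 0 (by omega)
      have h6 := wv 0 (by omega)
      simp only [Nat.mul_zero] at *
      clear hf hu hv hw uu vv wu wu' wv wv' xu yv cov
      grind
    | succ i ih =>
      intro hi
      have h0 := ih (by omega)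
      have e : 2*(i+1) = 2*i+1+1 := by ring
      have c1 := cov (u (2*i+1))
      have c2 := cov (v (2*i+1))
      have c3 := cov (u (2*i+1+1))
      have c4 := cov (v (2*i+1+1))
      have c5 := cov (w (2*i))
      have c6 := cov (w (2*i+1))
      have a1 := uu (2*i) (by omega)
      have a2 := vv (2*i) (by omega)
      have a3 := wu (2*i) (by omega)
      have a4 := wu' (2*i) (by omega)
      have a5 := wv (2*i) (by omega)
      have a6 := wv' (2*i) (by omega)
      have b1 := uu (2*i+1) (by omega)
      have b2 := vv (2*i+1) (by omega)
      have b3 := wu (2*i+1) (by omega)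
      have b4 := wu' (2*i+1) (by omega)
      have b5 := wv (2*i+1) (by omega)
      have b6 := wv' (2*i+1) (by omega)
      have d1 := xu (i+1) hi
      have d2 := yv i (by omega)
      rw [e] at d1 ⊢
      clear hf hu hv hw uu vv wu wu' wv wv' xu yv cov ih e
      generalize u (2*i+1+1) = u2 at *
      generalize v (2*i+1+1) = v2 at *
      generalize u (2*i+1) = u1 at *
      generalize v (2*i+1) = v1 at *
      generalize w (2*i+1) = w1 at *
      generalize u (2*i) = u0 at *
      generalize v (2*i) = v0 at *
      generalize w (2*i) = w0 at *
      grind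
  have := inv k le_rfl
  grind

/-- for every positive `k`, `G_k` is 4-colorable, and its chromatic number
is exactly 4. -/
theorem Gk_four_colorable (k : ℕ) (hk : 1 ≤ k) :
    (∃ c : GVert k → Fin 4, ∀ x y, (Ggraph k).Adj x y → c x ≠ c y) ∧
    (Ggraph k).chromaticNumber = 4 := by
  have hc : ∀ x y, (Ggraph k).Adj x y → fourCol k x ≠ fourCol k y := by
    intro x y h
    rw [Ggraph, SimpleGraph.fromRel_adj] at h
    rcases h.2 with h | h
    · exact fourCol_rel k x y h
    · exact (fourCol_rel k y x h).symm
  refine ⟨⟨fourCol k, hc⟩, ?_⟩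
  have h4 : (Ggraph k).Colorable 4 := ⟨SimpleGraph.Coloring.mk (fourCol k) (fun {x y} h => hc x y h)⟩
  have h3 : ¬ (Ggraph k).Colorable 3 := by
    rintro ⟨C⟩
    exact no_three k hk C fun x y hne h =>
      C.valid ((SimpleGraph.fromRel_adj _ _ _).2 ⟨hne, Or.inl h⟩)
  refine le_antisymm h4.chromaticNumber_le ?_
  by_contra hlt
  push Not at hlt
  apply h3
  rw [← SimpleGraph.chromaticNumber_le_iff_colorable]
  exact ENat.lt_natCast_add_one_iff.1 (by exact_mod_cast hlt)
end

section
/- For every positive integer k, there exists a simple planar graph with exactly 6k + 7 vertices and 14k + 12 edges which is 4-critical (not 3-colorable, but every proper edge-deleted subgraph is 3-colorable). -/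
open SimpleGraph

/-- `Hm` is a minor of `G`: disjoint nonempty connected branch sets joined by edges. -/
def IsMinor {α β : Type*} (Hm : SimpleGraph α) (G : SimpleGraph β) : Prop :=
  ∃ φ : α → Set β,
    (∀ a, (φ a).Nonempty) ∧
    (∀ a, (G.induce (φ a)).Connected) ∧
    (Pairwise fun a b => Disjoint (φ a) (φ b)) ∧
    (∀ a b, Hm.Adj a b → ∃ x ∈ φ a, ∃ y ∈ φ b, G.Adj x y)

/-- Planarity via Wagner's theorem: no `K_5` and no `K_{3,3}` minor. -/
def IsPlanar {β : Type*} (G : SimpleGraph β) : Prop :=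
  ¬ IsMinor (completeGraph (Fin 5)) G ∧
  ¬ IsMinor (completeBipartiteGraph (Fin 3) (Fin 3)) G

namespace FC

/-- incidence of the edge `e` (with endpoints `s e`, `t e`) and the vertex `v`, mod 2 -/
def inc (s t : ℕ → ℕ) (e v : ℕ) : ZMod 2 :=
  (if s e = v then 1 else 0) + (if t e = v then 1 else 0)

/-- `z` is an element of the cycle space -/
def Ev (M : ℕ) (s t : ℕ → ℕ) (z : ℕ → ZMod 2) : Prop :=
  ∀ v, ∑ e ∈ Finset.range M, z e * inc s t e v = 0

/-- The edges in `S` carry a Mac Lane 2-basis (with all faces, `o` being the outer one),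
and all edges of `L` are on the outer face. -/
def State (M : ℕ) (s t : ℕ → ℕ) (S L : ℕ → Prop) : Prop :=
  ∃ (ι : Type) (_ : Fintype ι) (_ : DecidableEq ι) (o : ι) (B : ι → ℕ → ZMod 2),
    (∀ i e, B i e ≠ 0 → S e) ∧ (∀ i, Ev M s t (B i)) ∧
    (∀ e, ∃ l r, ∀ i, B i e = (if i = l then 1 else 0) + (if i = r then 1 else 0)) ∧
    (∀ e, L e → B o e = 1) ∧
    (∀ z : ℕ → ZMod 2, (∀ e, z e ≠ 0 → S e) → Ev M s t z →
      ∃ g : ι → ZMod 2, ∀ e, z e = ∑ i, g i * B i e)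

theorem two_eq : (2 : ZMod 2) = 0 := rfl

theorem add_self2 (a : ZMod 2) : a + a = 0 := by revert a; decide

theorem state_empty (M : ℕ) (s t : ℕ → ℕ) : State M s t (fun _ => False) (fun _ => False) := by
  refine ⟨Unit, inferInstance, inferInstance, (), fun _ _ => 0, ?_, ?_, ?_, ?_, ?_⟩
  · intro i e h; exact h rfl
  · intro i v; simp
  · intro e; exact ⟨(), (), fun i => by simp; decide⟩
  · intro e h; exact h.elim
  · intro z hz _
    refine ⟨fun _ => 0, fun e => ?_⟩
    by_contra h
    exact hz e (by simpa using h)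

theorem state_congr {M M' : ℕ} {s t s' t' : ℕ → ℕ} {S L : ℕ → Prop}
    (h : ∀ e, S e → e < M ∧ e < M' ∧ s' e = s e ∧ t' e = t e)
    (H : State M s t S L) : State M' s' t' S L := by
  have key : ∀ z : ℕ → ZMod 2, (∀ e, z e ≠ 0 → S e) → ∀ v,
      ∑ e ∈ Finset.range M, z e * inc s t e v = ∑ e ∈ Finset.range M', z e * inc s' t' e v := by
    intro z hz v
    have e1 : ∀ e, z e * inc s t e v = z e * inc s' t' e v := by
      intro e
      by_cases hze : z e = 0
      · simp [hze]
      · obtain ⟨_, _, h3, h4⟩ := h e (hz e hze)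
        simp [inc, h3, h4]
    simp_rw [e1]
    have sub : ∀ N, (∀ e, z e ≠ 0 → e < N) → ∑ e ∈ Finset.range N, z e * inc s' t' e v
        = ∑ e ∈ Finset.range (M + M'), z e * inc s' t' e v ∨ M + M' < N := by
      intro N hN
      by_cases hlt : M + M' < N
      · exact Or.inr hlt
      · left
        apply Finset.sum_subset
        · intro x hx; simp at hx ⊢; omega
        · intro x _ hx
          have : z x = 0 := by
            by_contra hh
            exact hx (by simpa using hN x hh)
          simp [this]
    rcases sub M (fun e he => (h e (hz e he)).1) with h1 | h1
    · rcases sub M' (fun e he => (h e (hz e he)).2.1) with h2 | h2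
      · rw [h1, h2]
      · omega
    · omega
  obtain ⟨ι, f1, f2, o, B, h1, h2, h3, h4, h5⟩ := H
  refine ⟨ι, f1, f2, o, B, h1, ?_, h3, h4, ?_⟩
  · intro i v; rw [← key _ (h1 i)]; exact h2 i v
  · intro z hz hev
    exact h5 z hz (fun v => by rw [key z hz]; exact hev v)

theorem sum_list_inc (M : ℕ) (s t : ℕ → ℕ) (C : List ℕ) (hn : C.Nodup) (hM : ∀ e ∈ C, e < M) (v : ℕ) :
    ∑ e ∈ Finset.range M, (if e ∈ C then (1 : ZMod 2) else 0) * inc s t e v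
      = (C.map (fun e => inc s t e v)).sum := by
  have : (C.map (fun e => inc s t e v)).sum = ∑ e ∈ C.toFinset, inc s t e v := by
    rw [List.sum_toFinset _ hn]
  rw [this]
  simp_rw [ite_mul, one_mul, zero_mul]
  rw [← Finset.sum_filter]
  congr 1
  ext e
  simp
  exact hM e

theorem ear {M : ℕ} {s t : ℕ → ℕ} {S L : ℕ → Prop} (S' L' : ℕ → Prop) (P Q : List ℕ)
    (H : State M s t S L)
    (hne : P ≠ []) (hn : (P ++ Q).Nodup) (hPS : ∀ p ∈ P, ¬ S p) (hM : ∀ e ∈ P ++ Q, e < M)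
    (hQ : ∀ q ∈ Q, L q)
    (hev : ∀ v, ((P ++ Q).map (fun e => inc s t e v)).sum = 0)
    (hS' : ∀ e, S' e ↔ S e ∨ e ∈ P)
    (hL' : ∀ e, L' e → e ∈ P ∨ (L e ∧ e ∉ Q))
    (hP : ∀ z : ℕ → ZMod 2, (∀ e, z e ≠ 0 → S' e) → Ev M s t z → ∀ p ∈ P, ∀ p' ∈ P, z p = z p') :
    State M s t S' L' := by
  classical
  obtain ⟨ι, f1, f2, o, B, h1, h2, h3, h4, h5⟩ := H
  have hLS : ∀ e, L e → S e := fun e he => h1 o e (by rw [h4 e he]; decide)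
  set C := P ++ Q with hC
  let f : ℕ → ZMod 2 := fun e => if e ∈ C then 1 else 0
  have hf : Ev M s t f := fun v => by
    rw [← hev v]; exact sum_list_inc M s t C hn hM v
  have fS : ∀ e, f e ≠ 0 → S' e := by
    intro e he
    have : e ∈ C := by by_contra hh; exact he (by simp [f, hh])
    rw [hS']
    rcases List.mem_append.1 this with h | h
    · exact Or.inr h
    · exact Or.inl (hLS e (hQ e h))
  have B0 : ∀ p ∈ P, ∀ i, B i p = 0 := by
    intro p hp i; by_contra hh; exact hPS p hp (h1 i p hh)
  refine ⟨Option ι, inferInstance, inferInstance, some o,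
    fun i => i.elim f (fun i e => B i e + if i = o then f e else 0), ?_, ?_, ?_, ?_, ?_⟩
  · intro i e hi
    cases i with
    | none => exact fS e hi
    | some i =>
      simp only [Option.elim] at hi
      by_cases hb : B i e = 0
      · apply fS
        intro h0
        apply hi
        simp [hb, h0]
      · exact (hS' e).2 (Or.inl (h1 i e hb))
  · intro i
    cases i with
    | none => exact hf
    | some i =>
      intro v
      simp only [Option.elim]
      by_cases hi : i = o
      · simp only [hi, if_true, add_mul, Finset.sum_add_distrib]
        rw [h2 o v, hf v, add_zero]
      · simp only [hi, if_false, add_zero]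
        exact h2 i v
  · intro e
    by_cases heP : e ∈ P
    · refine ⟨none, some o, fun i => ?_⟩
      have : f e = 1 := by simp [f, hC, heP]
      cases i with
      | none => simp [this]
      | some i => simp [this, B0 e heP i]
    · by_cases heQ : e ∈ Q
      · have hfe : f e = 1 := by simp [f, hC, heQ]
        obtain ⟨l, r, hlr⟩ := h3 e
        have ho := hlr o
        rw [h4 e (hQ e heQ)] at ho
        by_cases hl : o = l
        · refine ⟨none, some r, fun i => ?_⟩
          cases i with
          | none => simp [hfe]
          | some i =>
            subst hl
            simp only [Option.elim, hlr i, hfe, Option.some.injEq, reduceCtorEq, if_false, zero_add]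
            split_ifs <;> decide
        · by_cases hr : o = r
          · refine ⟨none, some l, fun i => ?_⟩
            cases i with
            | none => simp [hfe]
            | some i =>
              subst hr
              simp only [Option.elim, hlr i, hfe, Option.some.injEq, reduceCtorEq, if_false, zero_add]
              split_ifs <;> decide
          · simp [hl, hr] at ho
      · have hfe : f e = 0 := by simp [f, hC, heP, heQ]
        obtain ⟨l, r, hlr⟩ := h3 e
        refine ⟨some l, some r, fun i => ?_⟩
        cases i with
        | none => simp [hfe]
        | some i => simp [hfe, hlr i]
  · intro e he
    simp only [Option.elim, if_true]
    rcases hL' e he with h | ⟨h, h'⟩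
    · have : f e = 1 := by simp [f, hC, h]
      rw [B0 e h, this]; decide
    · have hp : e ∉ P := fun hp => hPS e hp (hLS e h)
      have : f e = 0 := by simp [f, hC, hp, h']
      rw [h4 e h, this]; decide
  · intro z hz hev
    obtain ⟨p0, hp0⟩ := List.exists_mem_of_ne_nil P hne
    obtain ⟨g, hg⟩ := h5 (fun e => z e + z p0 * f e) (by
      intro e he
      by_contra hSe
      apply he
      by_cases heP : e ∈ P
      · have : f e = 1 := by simp [f, hC, heP]
        rw [this, mul_one, hP z hz hev e heP p0 hp0]
        exact add_self2 _
      · have hz0 : z e = 0 := by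
          by_contra hh
          rcases (hS' e).1 (hz e hh) with h | h
          · exact hSe h
          · exact heP h
        have hf0 : f e = 0 := by
          have : e ∉ Q := fun h => hSe (hLS e (hQ e h))
          simp [f, hC, heP, this]
        simp [hz0, hf0]) (by
      intro v
      have a1 := hev v
      have a2 := hf v
      simp only [add_mul, Finset.sum_add_distrib, mul_assoc]
      rw [a1, ← Finset.mul_sum, a2]; simp)
    refine ⟨fun i => i.elim (z p0 + g o) g, fun e => ?_⟩
    rw [Fintype.sum_option]
    simp only [Option.elim, mul_add, Finset.sum_add_distrib, mul_ite, mul_zero, Finset.sum_ite_eq',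
      Finset.mem_univ, if_true]
    rw [← hg e]
    have a1 := add_self2 (z p0 * f e)
    have a2 := add_self2 (g o * f e)
    linear_combination -a1 - a2

theorem pair_eq {M : ℕ} {s t : ℕ → ℕ} {S' : ℕ → Prop} {z : ℕ → ZMod 2} (hz : ∀ e, z e ≠ 0 → S' e)
    (hev : Ev M s t z) (w p p' : ℕ) (hp : p < M) (hp' : p' < M) (hne : p ≠ p')
    (h1 : inc s t p w = 1) (h2 : inc s t p' w = 1)
    (h3 : ∀ e, S' e → e ≠ p → e ≠ p' → s e ≠ w ∧ t e ≠ w) : z p = z p' := by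
  have := hev w
  have e1 : ∑ e ∈ Finset.range M, z e * inc s t e w = ∑ e ∈ ({p, p'} : Finset ℕ), z e * inc s t e w := by
    symm
    apply Finset.sum_subset
    · intro x hx; simp at hx ⊢; omega
    · intro x _ hx
      by_cases h0 : z x = 0
      · simp [h0]
      · simp at hx
        obtain ⟨a, b⟩ := h3 x (hz x h0) hx.1 hx.2
        simp [inc, a, b]
  rw [e1, Finset.sum_pair hne, h1, h2, mul_one, mul_one] at this
  have h := add_self2 (z p')
  linear_combination this - h

theorem sum_zero_of_mem (s t : ℕ → ℕ) (C : List ℕ)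
    (h : ∀ v ∈ C.map s ++ C.map t, (C.map (fun e => inc s t e v)).sum = 0) (v : ℕ) :
    (C.map (fun e => inc s t e v)).sum = 0 := by
  by_cases hv : v ∈ C.map s ++ C.map t
  · exact h v hv
  · apply List.sum_eq_zero
    intro x hx
    obtain ⟨e, he, rfl⟩ := List.mem_map.1 hx
    simp only [List.mem_append, List.mem_map, not_or, not_exists, not_and] at hv
    simp [inc, hv.1 e he, hv.2 e he]

end FC

namespace FC

section core
open Classical

/-- incidence, general version -/
noncomputable def ginc {E V : Type*} (s t : E → V) (e : E) (v : V) : ZMod 2 :=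
  (if s e = v then 1 else 0) + (if t e = v then 1 else 0)

theorem sum_pi_ginc {E V α : Type*} [Fintype V] (s t : E → V) (π : V → Option α) (x : α) (e : E) :
    ∑ v, (if π v = some x then (1 : ZMod 2) else 0) * ginc s t e v
      = (if π (s e) = some x then 1 else 0) + (if π (t e) = some x then 1 else 0) := by
  simp only [ginc, mul_add, Finset.sum_add_distrib, mul_ite, mul_one, mul_zero]
  simp

theorem dual {E V ι α η : Type} [Fintype E] [Fintype V] [Fintype ι] [Fintype α] [Fintype η]
    (s t : E → V) (B : ι → E → ZMod 2) (l r : E → ι)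
    (hB : ∀ i v, ∑ e, B i e * ginc s t e v = 0)
    (hlr : ∀ e i, B i e = (if i = l e then 1 else 0) + (if i = r e then 1 else 0))
    (hspan : ∀ z : E → ZMod 2, (∀ v, ∑ e, z e * ginc s t e v = 0) →
      ∃ g : ι → ZMod 2, ∀ e, z e = ∑ i, g i * B i e)
    (π : V → Option α) (a b : η → α) (hab : ∀ h, a h ≠ b h)
    (hsimple : ∀ h h', (a h = a h' ∧ b h = b h') ∨ (a h = b h' ∧ b h = a h') → h = h')
    (ρ : η → E)
    (hρ : ∀ h, (π (s (ρ h)) = some (a h) ∧ π (t (ρ h)) = some (b h)) ∨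
      (π (s (ρ h)) = some (b h) ∧ π (t (ρ h)) = some (a h)))
    (root : α → V)
    (conn : ∀ x v, π v = some x → ∃ c : E → ZMod 2,
      (∀ e, c e ≠ 0 → ∃ x, π (s e) = some x ∧ π (t e) = some x) ∧
      ∀ u, ∑ e, c e * ginc s t e u = (if v = u then 1 else 0) + (if root x = u then 1 else 0)) :
    ∃ (F : Type) (_ : Fintype F) (Lh Rh : η → F),
      (∀ g : F → ZMod 2, ∀ x, ∑ h, (g (Lh h) + g (Rh h)) * ginc a b h x = 0) ∧
      (∀ y : η → ZMod 2, (∀ x, ∑ h, y h * ginc a b h x = 0) →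
        ∃ g : F → ZMod 2, ∀ h, y h = g (Lh h) + g (Rh h)) := by
  have hinj : Function.Injective ρ := by
    intro h h' hh
    apply hsimple
    have h1 := hρ h
    have h2 := hρ h'
    rw [hh] at h1
    rcases h1 with ⟨p1, p2⟩ | ⟨p1, p2⟩ <;> rcases h2 with ⟨q1, q2⟩ | ⟨q1, q2⟩ <;>
      rw [p1] at q1 <;> rw [p2] at q2 <;> simp only [Option.some.injEq] at q1 q2 <;> tauto
  have hincH : ∀ h x, (if π (s (ρ h)) = some x then (1 : ZMod 2) else 0)
      + (if π (t (ρ h)) = some x then 1 else 0) = ginc a b h x := by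
    intro h x
    rcases hρ h with ⟨p1, p2⟩ | ⟨p1, p2⟩
    · simp only [p1, p2, ginc, Option.some.injEq]
    · simp only [p1, p2, ginc, Option.some.injEq]; rw [add_comm]
  let inner : E → Prop := fun e => ∃ x, π (s e) = some x ∧ π (t e) = some x
  have hρinner : ∀ h, ¬ inner (ρ h) := by
    rintro h ⟨x, h1, h2⟩
    apply hab h
    rcases hρ h with ⟨p1, p2⟩ | ⟨p1, p2⟩ <;> rw [p1] at h1 <;> rw [p2] at h2 <;>
      simp only [Option.some.injEq] at h1 h2 <;> simp [h1, h2]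
  let N : E → Prop := fun e => ¬ inner e ∧ ∀ h, e ≠ ρ h
  let Rl : ι → ι → Prop := fun i j => ∃ e, N e ∧ i = l e ∧ j = r e
  have hsumB : ∀ (g : ι → ZMod 2) e, ∑ i, g i * B i e = g (l e) + g (r e) := by
    intro g e
    simp only [hlr, mul_add, Finset.sum_add_distrib, mul_ite, mul_one, mul_zero]
    simp
  refine ⟨Quot Rl, Fintype.ofFinite _, fun h => Quot.mk _ (l (ρ h)), fun h => Quot.mk _ (r (ρ h)),
    ?_, ?_⟩
  · intro g x
    let z : E → ZMod 2 := fun e => ∑ i, g (Quot.mk _ i) * B i e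
    have hz : ∀ e, z e = g (Quot.mk _ (l e)) + g (Quot.mk _ (r e)) := fun e =>
      hsumB (fun i => g (Quot.mk _ i)) e
    have hzN : ∀ e, N e → z e = 0 := by
      intro e he
      rw [hz]
      have : Quot.mk Rl (l e) = Quot.mk Rl (r e) := Quot.sound ⟨e, he, rfl, rfl⟩
      rw [this, add_self2]
    have hzev : ∀ v, ∑ e, z e * ginc s t e v = 0 := by
      intro v
      simp only [z, Finset.sum_mul, mul_assoc]
      rw [Finset.sum_comm]
      apply Finset.sum_eq_zero
      intro i _
      rw [← Finset.mul_sum, hB, mul_zero]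
    have h1 : ∑ e, z e * ((if π (s e) = some x then (1 : ZMod 2) else 0)
        + (if π (t e) = some x then 1 else 0)) = 0 := by
      have : ∑ v, (if π v = some x then (1 : ZMod 2) else 0) * ∑ e, z e * ginc s t e v = 0 := by
        simp [hzev]
      simp_rw [← sum_pi_ginc s t π x, Finset.mul_sum]
      simp_rw [Finset.mul_sum] at this
      rw [Finset.sum_comm]
      refine Eq.trans ?_ this
      refine Finset.sum_congr rfl fun v _ => Finset.sum_congr rfl fun e _ => ?_
      ring
    rw [← h1]
    refine Fintype.sum_of_injective ρ hinj _ _ ?_ ?_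
    · intro e he
      by_cases hi : inner e
      · obtain ⟨y, h2, h3⟩ := hi
        rw [h2, h3, add_self2, mul_zero]
      · rw [hzN e ⟨hi, fun h hh => he ⟨h, hh.symm⟩⟩, zero_mul]
    · intro h
      rw [hincH, hz]
  · intro y hy
    let z0 : E → ZMod 2 := fun e => ∑ h, y h * (if e = ρ h then 1 else 0)
    let d : V → ZMod 2 := fun v => ∑ e, z0 e * ginc s t e v
    have hd : ∀ v, d v = ∑ h, y h * ginc s t (ρ h) v := by
      intro v
      simp only [d, z0, Finset.sum_mul, mul_assoc]
      rw [Finset.sum_comm]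
      refine Finset.sum_congr rfl fun h _ => ?_
      rw [← Finset.mul_sum]
      simp
    have hdnone : ∀ v, π v = none → d v = 0 := by
      intro v hv
      rw [hd]
      apply Finset.sum_eq_zero
      intro h _
      have h1 : s (ρ h) ≠ v := by
        rintro rfl; rcases hρ h with ⟨p, q⟩ | ⟨p, q⟩ <;> simp [hv] at p
      have h2 : t (ρ h) ≠ v := by
        rintro rfl; rcases hρ h with ⟨p, q⟩ | ⟨p, q⟩ <;> simp [hv] at q
      simp [ginc, h1, h2]
    have hdsum : ∀ x, ∑ v, (if π v = some x then (1 : ZMod 2) else 0) * d v = 0 := by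
      intro x
      simp_rw [hd, Finset.mul_sum]
      rw [Finset.sum_comm]
      refine Eq.trans ?_ (hy x)
      refine Finset.sum_congr rfl fun h _ => ?_
      rw [← hincH, ← sum_pi_ginc s t π x, Finset.mul_sum]
      refine Finset.sum_congr rfl fun v _ => ?_
      ring
    have hch : ∀ v, ∃ c : E → ZMod 2, (∀ e, c e ≠ 0 → inner e) ∧
        ∀ u, d v * ∑ e, c e * ginc s t e u = d v * (if v = u then 1 else 0)
          + ∑ x, (if π v = some x then (1 : ZMod 2) else 0) * d v * (if root x = u then 1 else 0) := by
      intro v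
      rcases hv : π v with _ | x
      · exact ⟨fun _ => 0, fun e h => (h rfl).elim, fun u => by simp [hdnone v hv]⟩
      · obtain ⟨c, h1, h2⟩ := conn x v hv
        refine ⟨c, h1, fun u => ?_⟩
        rw [h2, mul_add]
        congr 1
        rw [Finset.sum_eq_single x]
        · simp
        · intro x' _ hx'
          simp [Ne.symm hx']
        · simp
    choose ch hch1 hch2 using hch
    let z : E → ZMod 2 := fun e => z0 e + ∑ v, d v * ch v e
    have hzev : ∀ u, ∑ e, z e * ginc s t e u = 0 := by
      intro u
      simp only [z, add_mul, Finset.sum_add_distrib, Finset.sum_mul]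
      rw [Finset.sum_comm (s := Finset.univ (α := E))]
      simp_rw [mul_assoc, ← Finset.mul_sum, hch2, Finset.sum_add_distrib]
      rw [Finset.sum_comm (s := Finset.univ (α := V))]
      simp_rw [← Finset.sum_mul, hdsum]
      simp only [mul_ite, mul_one, mul_zero, ite_self, Finset.sum_const_zero, add_zero,
        Finset.sum_ite_eq', Finset.mem_univ, if_true]
      exact add_self2 _
    have hzin : ∀ e, ¬ inner e → z e = z0 e := by
      intro e he
      simp only [z]
      rw [Finset.sum_eq_zero, add_zero]
      intro v _
      have : ch v e = 0 := by
        by_contra hh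
        exact he (hch1 v e hh)
      rw [this, mul_zero]
    have hzN : ∀ e, N e → z e = 0 := by
      intro e he
      rw [hzin e he.1]
      apply Finset.sum_eq_zero
      intro h _
      simp [he.2 h]
    have hzρ : ∀ h, z (ρ h) = y h := by
      intro h
      rw [hzin _ (hρinner h)]
      simp only [z0, hinj.eq_iff]
      simp
    obtain ⟨g, hg⟩ := hspan z hzev
    have hg' : ∀ e, z e = g (l e) + g (r e) := fun e => by rw [hg, hsumB]
    refine ⟨Quot.lift g ?_, fun h => ?_⟩
    · rintro i j ⟨e, he, rfl, rfl⟩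
      have h1 := hg' e
      rw [hzN e he] at h1
      have h2 := add_self2 (g (r e))
      linear_combination -h1 - h2
    · rw [← hzρ h]; exact hg' _

end core
end FC

namespace FC

section nodual
open Classical

theorem zmod2_ne {a : ZMod 2} (h : a ≠ 0) : a = 1 := by
  revert a; decide

theorem nodual {α η F : Type} [Fintype η] [Fintype F] (a b : η → α) (w m : ℕ)
    (girth : ∀ y : η → ZMod 2, (∀ x, ∑ h, y h * ginc a b h x = 0) → (∃ h, y h = 1) →
      w ≤ (Finset.univ.filter (fun h => y h = 1)).card)
    (cyc : (Fin m → ZMod 2) → η → ZMod 2) (hcyc : ∀ x v, ∑ h, cyc x h * ginc a b h v = 0)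
    (hinj : Function.Injective cyc) (hcov : ∀ h, ∃ x, cyc x h ≠ 0) (h0 : η)
    (hnum : 2 * Fintype.card η < w * (m + 1))
    (Lh Rh : η → F)
    (c1 : ∀ g : F → ZMod 2, ∀ x, ∑ h, (g (Lh h) + g (Rh h)) * ginc a b h x = 0)
    (c2 : ∀ y : η → ZMod 2, (∀ x, ∑ h, y h * ginc a b h x = 0) →
        ∃ g : F → ZMod 2, ∀ h, y h = g (Lh h) + g (Rh h)) : False := by
  have hLR : ∀ h, Lh h ≠ Rh h := by
    intro h heq
    obtain ⟨x, hx⟩ := hcov h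
    obtain ⟨g, hg⟩ := c2 (cyc x) (hcyc x)
    apply hx
    rw [hg, heq, add_self2]
  let F' : Finset F := Finset.univ.image Lh ∪ Finset.univ.image Rh
  have hL : ∀ h, Lh h ∈ F' := fun h => by simp [F']
  have hR : ∀ h, Rh h ∈ F' := fun h => by simp [F']
  let z : F → η → ZMod 2 := fun f h => (if Lh h = f then 1 else 0) + (if Rh h = f then 1 else 0)
  have hz : ∀ f ∈ F', w ≤ (Finset.univ.filter (fun h => z f h = 1)).card := by
    intro f hf
    apply girth
    · exact c1 (fun f' => if f' = f then 1 else 0)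
    · simp only [F', Finset.mem_union, Finset.mem_image, Finset.mem_univ, true_and] at hf
      rcases hf with ⟨h, rfl⟩ | ⟨h, rfl⟩
      · exact ⟨h, by simp [z, (hLR h).symm]⟩
      · exact ⟨h, by simp [z, hLR h]⟩
  have hcard : F'.card * w ≤ 2 * Fintype.card η := by
    calc F'.card * w ≤ ∑ f ∈ F', (Finset.univ.filter (fun h => z f h = 1)).card := by
          rw [← smul_eq_mul]; exact Finset.card_nsmul_le_sum _ _ _ hz
      _ = ∑ h : η, (F'.filter (fun f => z f h = 1)).card := by
          simp_rw [Finset.card_filter]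
          exact Finset.sum_comm
      _ ≤ ∑ h : η, 2 := by
          apply Finset.sum_le_sum
          intro h _
          refine (Finset.card_le_card (t := {Lh h, Rh h}) ?_).trans Finset.card_le_two
          intro f hf
          simp only [Finset.mem_filter] at hf
          by_contra hh
          simp only [Finset.mem_insert, Finset.mem_singleton, not_or] at hh
          have := hf.2
          simp [z, Ne.symm hh.1, Ne.symm hh.2] at this
      _ = 2 * Fintype.card η := by simp [mul_comm]
  have hle : F'.card ≤ m := by
    by_contra hh
    have : m + 1 ≤ F'.card := by omega
    have := Nat.mul_le_mul_right w this
    rw [mul_comm] at this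
    omega
  let f0 := Lh h0
  have hex : ∀ x, ∃ g : F → ZMod 2, g f0 = 0 ∧ ∀ h, cyc x h = g (Lh h) + g (Rh h) := by
    intro x
    obtain ⟨g, hg⟩ := c2 (cyc x) (hcyc x)
    refine ⟨fun f => g f + g f0, add_self2 _, fun h => ?_⟩
    rw [hg]
    have := add_self2 (g f0)
    linear_combination -this
  choose g hg1 hg2 using hex
  let Φ : (Fin m → ZMod 2) → (↥(F'.erase f0) → ZMod 2) := fun x f => g x f
  have hΦ : Function.Injective Φ := by
    intro x x' hxx
    have key : ∀ f ∈ F', g x f = g x' f := by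
      intro f hf
      by_cases h : f = f0
      · rw [h, hg1, hg1]
      · exact congrFun hxx ⟨f, Finset.mem_erase.2 ⟨h, hf⟩⟩
    apply hinj
    funext h
    rw [hg2, hg2, key _ (hL h), key _ (hR h)]
  have h1 := Fintype.card_le_of_injective Φ hΦ
  simp only [Fintype.card_fun, ZMod.card, Fintype.card_fin, Fintype.card_coe] at h1
  have h2 := (Nat.pow_le_pow_iff_right (by norm_num : 1 < 2)).1 h1
  rw [Finset.card_erase_of_mem (hL h0)] at h2
  have : 0 < F'.card := Finset.card_pos.2 ⟨_, hL h0⟩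
  omega

end nodual

def a5 : Fin 10 → Fin 5 := ![0,0,0,0,1,1,1,2,2,3]
def b5 : Fin 10 → Fin 5 := ![1,2,3,4,2,3,4,3,4,4]

theorem girth5 : ∀ y4 y5 y6 y7 y8 y9 : ZMod 2,
    ¬ (y4 = 0 ∧ y5 = 0 ∧ y6 = 0 ∧ y7 = 0 ∧ y8 = 0 ∧ y9 = 0) →
    3 ≤ (y4 + y5 + y6).val + ((y4 + y7 + y8).val + ((y5 + y7 + y9).val + ((y6 + y8 + y9).val
      + (y4.val + (y5.val + (y6.val + (y7.val + (y8.val + y9.val)))))))) := by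
  decide +kernel

theorem girth33 : ∀ y0 y1 y3 y4 : ZMod 2,
    ¬ (y0 = 0 ∧ y1 = 0 ∧ y3 = 0 ∧ y4 = 0) →
    4 ≤ y0.val + (y1.val + ((y0 + y1).val + (y3.val + (y4.val + ((y3 + y4).val + ((y0 + y3).val
      + ((y1 + y4).val + (y0 + y3 + (y1 + y4)).val))))))) := by
  decide +kernel

theorem val_ite (y : ZMod 2) : (if y = 1 then 1 else 0) = y.val := by
  revert y; decide

theorem solve2 {a b : ZMod 2} (h : a + b = 0) : a = b := by
  have := add_self2 b
  linear_combination h - this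

theorem solve3 : ∀ {a b c : ZMod 2}, a + (b + c) = 0 → c = a + b := by decide

theorem nodual5 {F : Type} [Fintype F] (Lh Rh : Fin 10 → F)
    (c1 : ∀ g : F → ZMod 2, ∀ x, ∑ h, (g (Lh h) + g (Rh h)) * ginc a5 b5 h x = 0)
    (c2 : ∀ y : Fin 10 → ZMod 2, (∀ x, ∑ h, y h * ginc a5 b5 h x = 0) →
        ∃ g : F → ZMod 2, ∀ h, y h = g (Lh h) + g (Rh h)) : False := by
  refine nodual a5 b5 3 6 ?_
    (fun x => ![x 0 + x 1 + x 2, x 0 + x 3 + x 4, x 1 + x 3 + x 5, x 2 + x 4 + x 5,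
      x 0, x 1, x 2, x 3, x 4, x 5]) ?_ ?_ ?_ 0 (by simp) Lh Rh c1 c2
  · intro y hy ⟨h, hh⟩
    have e1 := hy 1
    have e2 := hy 2
    have e3 := hy 3
    have e4 := hy 4
    simp [Fin.sum_univ_succ, ginc, a5, b5] at e1 e2 e3 e4
    replace e1 := solve2 e1
    replace e2 := solve2 e2
    replace e3 := solve2 e3
    replace e4 := solve2 e4
    have key := girth5 (y 4) (y 5) (y 6) (y 7) (y 8) (y 9) (by
      rintro ⟨h4, h5, h6, h7, h8, h9⟩
      simp only [h4, h5, h6, h7, h8, h9, add_zero] at e1 e2 e3 e4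
      have : y h = 0 := by fin_cases h <;> assumption
      rw [this] at hh
      exact absurd hh (by decide))
    rw [Finset.card_filter]
    simp only [Fin.sum_univ_succ, Finset.univ_eq_empty, Finset.sum_empty, val_ite]
    rw [add_assoc] at key
    simp only [add_assoc] at key
    rw [← e1, ← e2, ← e3, ← e4] at key
    exact key
  · intro x v
    fin_cases v <;> simp [Fin.sum_univ_succ, ginc, a5, b5] <;> ring_nf <;> simp [two_eq]
  · intro x x' hx
    have hx := fun i => congrFun hx i
    funext i
    fin_cases i
    · exact hx 4
    · exact hx 5
    · exact hx 6
    · exact hx 7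
    · exact hx 8
    · exact hx 9
  · decide

def a33 : Fin 9 → Fin 3 ⊕ Fin 3 :=
  ![.inl 0, .inl 0, .inl 0, .inl 1, .inl 1, .inl 1, .inl 2, .inl 2, .inl 2]
def b33 : Fin 9 → Fin 3 ⊕ Fin 3 :=
  ![.inr 0, .inr 1, .inr 2, .inr 0, .inr 1, .inr 2, .inr 0, .inr 1, .inr 2]

theorem nodual33 {F : Type} [Fintype F] (Lh Rh : Fin 9 → F)
    (c1 : ∀ g : F → ZMod 2, ∀ x, ∑ h, (g (Lh h) + g (Rh h)) * ginc a33 b33 h x = 0)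
    (c2 : ∀ y : Fin 9 → ZMod 2, (∀ x, ∑ h, y h * ginc a33 b33 h x = 0) →
        ∃ g : F → ZMod 2, ∀ h, y h = g (Lh h) + g (Rh h)) : False := by
  refine nodual a33 b33 4 4 ?_
    (fun x => ![x 0, x 1, x 0 + x 1, x 2, x 3, x 2 + x 3, x 0 + x 2, x 1 + x 3,
      x 0 + x 2 + (x 1 + x 3)]) ?_ ?_ ?_ 0 (by simp) Lh Rh c1 c2
  · intro y hy ⟨h, hh⟩
    have e1 := hy (.inl 0)
    have e2 := hy (.inl 1)
    have e3 := hy (.inr 0)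
    have e4 := hy (.inr 1)
    have e5 := hy (.inl 2)
    simp [Fin.sum_univ_succ, ginc, a33, b33] at e1 e2 e3 e4 e5
    have f2 : y 2 = y 0 + y 1 := solve3 e1
    have f5 : y 5 = y 3 + y 4 := solve3 e2
    have f6 : y 6 = y 0 + y 3 := solve3 e3
    have f7 : y 7 = y 1 + y 4 := solve3 e4
    have f8 : y 8 = y 6 + y 7 := solve3 e5
    rw [f6, f7] at f8
    have key := girth33 (y 0) (y 1) (y 3) (y 4) (by
      rintro ⟨h4, h5, h6, h7⟩
      simp only [h4, h5, h6, h7, add_zero] at f2 f5 f6 f7 f8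
      have : y h = 0 := by fin_cases h <;> assumption
      rw [this] at hh
      exact absurd hh (by decide))
    rw [Finset.card_filter]
    simp only [Fin.sum_univ_succ, Finset.univ_eq_empty, Finset.sum_empty, val_ite]
    rw [← f8, ← f2, ← f5, ← f6, ← f7] at key
    exact key
  · intro x v
    fin_cases v <;> simp [Fin.sum_univ_succ, ginc, a33, b33] <;> ring_nf <;> simp [two_eq]
  · intro x x' hx
    have hx := fun i => congrFun hx i
    funext i
    fin_cases i
    · exact hx 0
    · exact hx 1
    · exact hx 3
    · exact hx 4
  · decide

end FC

namespace FC

/-- the graph with edges `s e to t e`, `e < M` -/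
def gr (n M : ℕ) (s t : ℕ → ℕ) : SimpleGraph (Fin n) where
  Adj x y := x ≠ y ∧ ∃ e, e < M ∧ ((s e = x ∧ t e = y) ∨ (s e = y ∧ t e = x))
  symm := ⟨by
    rintro x y ⟨h, e, he, h'⟩
    exact ⟨h.symm, e, he, h'.symm⟩⟩
  loopless := ⟨fun x h => h.1 rfl⟩

section
open Classical

theorem chain {n M : ℕ} {s t : ℕ → ℕ} (s' t' : Fin M → Fin n) (hs : ∀ e, (s' e : ℕ) = s e)
    (ht : ∀ e, (t' e : ℕ) = t e) (A : Set (Fin n)) (x y : A)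
    (h : ((gr n M s t).induce A).Reachable x y) :
    ∃ c : Fin M → ZMod 2, (∀ e, c e ≠ 0 → s' e ∈ A ∧ t' e ∈ A) ∧
      ∀ u, ∑ e, c e * ginc s' t' e u = (if (y : Fin n) = u then 1 else 0)
        + (if (x : Fin n) = u then 1 else 0) := by
  obtain ⟨p⟩ := h
  induction p with
  | nil => exact ⟨fun _ => 0, fun e h => (h rfl).elim, fun u => by simp [add_self2]⟩
  | @cons x w y hadj p ih =>
    obtain ⟨c, hc1, hc2⟩ := ih
    have hadj' : (gr n M s t).Adj (x : Fin n) (w : Fin n) := hadj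
    obtain ⟨hne, e0, he0, hst⟩ := hadj'
    have hends : (s' ⟨e0, he0⟩ = x ∧ t' ⟨e0, he0⟩ = w) ∨ (s' ⟨e0, he0⟩ = w ∧ t' ⟨e0, he0⟩ = x) := by
      simp only [Fin.ext_iff, hs, ht]; exact hst
    refine ⟨fun e => c e + if e = ⟨e0, he0⟩ then 1 else 0, ?_, ?_⟩
    · intro e he
      by_cases h0 : c e = 0
      · have : e = ⟨e0, he0⟩ := by
          by_contra hh
          simp [h0, hh] at he
        subst this
        rcases hends with ⟨h1, h2⟩ | ⟨h1, h2⟩ <;> rw [h1, h2]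
        · exact ⟨x.2, w.2⟩
        · exact ⟨w.2, x.2⟩
      · exact hc1 e h0
    · intro u
      simp only [add_mul, Finset.sum_add_distrib, hc2, ite_mul, one_mul, zero_mul,
        Finset.sum_ite_eq', Finset.mem_univ, if_true]
      have key := add_self2 (if (w : Fin n) = u then (1 : ZMod 2) else 0)
      rcases hends with ⟨h1, h2⟩ | ⟨h1, h2⟩ <;> simp only [ginc, h1, h2] <;> linear_combination key

theorem minor_dual {n M : ℕ} {s t : ℕ → ℕ} (hb : ∀ e, e < M → s e < n ∧ t e < n) {L : ℕ → Prop}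
    (H : State M s t (fun e => e < M) L) {α η : Type} [Fintype α] [Fintype η]
    (Hm : SimpleGraph α) (a b : η → α) (hadj : ∀ h, Hm.Adj (a h) (b h))
    (hsimple : ∀ h h', (a h = a h' ∧ b h = b h') ∨ (a h = b h' ∧ b h = a h') → h = h')
    (hm : IsMinor Hm (gr n M s t)) :
    ∃ (F : Type) (_ : Fintype F) (Lh Rh : η → F),
      (∀ g : F → ZMod 2, ∀ x, ∑ h, (g (Lh h) + g (Rh h)) * ginc a b h x = 0) ∧
      (∀ y : η → ZMod 2, (∀ x, ∑ h, y h * ginc a b h x = 0) →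
        ∃ g : F → ZMod 2, ∀ h, y h = g (Lh h) + g (Rh h)) := by
  obtain ⟨φ, hne, hconn, hdisj, hedge⟩ := hm
  obtain ⟨ι, f1, f2, o, B, h1, h2, h3, h4, h5⟩ := H
  choose l r hlr using h3
  let s' : Fin M → Fin n := fun e => ⟨s e, (hb e e.2).1⟩
  let t' : Fin M → Fin n := fun e => ⟨t e, (hb e e.2).2⟩
  have hginc : ∀ (e : Fin M) (v : Fin n), ginc s' t' e v = inc s t e v := by
    intro e v
    simp only [ginc, inc, s', t', Fin.ext_iff]
  let π : Fin n → Option α := fun v => if h : ∃ x, v ∈ φ x then some h.choose else none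
  have hπ : ∀ v x, π v = some x ↔ v ∈ φ x := by
    intro v x
    constructor
    · intro h
      by_cases hh : ∃ x, v ∈ φ x
      · simp only [π, hh, dif_pos, Option.some.injEq] at h
        rw [← h]; exact hh.choose_spec
      · simp [π, hh] at h
    · intro h
      have hh : ∃ x, v ∈ φ x := ⟨x, h⟩
      simp only [π, hh, dif_pos, Option.some.injEq]
      by_contra hx
      exact Set.disjoint_left.1 (hdisj hx) hh.choose_spec h
  have hrep : ∀ h, ∃ e : Fin M, (s' e ∈ φ (a h) ∧ t' e ∈ φ (b h)) ∨ (s' e ∈ φ (b h) ∧ t' e ∈ φ (a h)) := by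
    intro h
    obtain ⟨x, hx, y, hy, _, e, he, hst⟩ := hedge _ _ (hadj h)
    refine ⟨⟨e, he⟩, ?_⟩
    rcases hst with ⟨p, q⟩ | ⟨p, q⟩
    · left
      have e1 : s' ⟨e, he⟩ = x := Fin.ext p
      have e2 : t' ⟨e, he⟩ = y := Fin.ext q
      rw [e1, e2]; exact ⟨hx, hy⟩
    · right
      have e1 : s' ⟨e, he⟩ = y := Fin.ext p
      have e2 : t' ⟨e, he⟩ = x := Fin.ext q
      rw [e1, e2]; exact ⟨hy, hx⟩
  choose ρ hρ using hrep
  choose root hroot using hne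
  refine dual s' t' (fun i e => B i e) (fun e => l e) (fun e => r e) ?_ ?_ ?_ π a b
    (fun h => (hadj h).ne) hsimple ρ ?_ root ?_
  · intro i v
    have := h2 i v
    rw [Finset.sum_range] at this
    simp only [hginc]
    exact this
  · intro e i
    rw [hlr]
    congr
  · intro z hz
    let z' : ℕ → ZMod 2 := fun e => if h : e < M then z ⟨e, h⟩ else 0
    have hz' : ∀ e : Fin M, z' e = z e := fun e => by simp [z']
    obtain ⟨g, hg⟩ := h5 z' (fun e he => by
      by_contra hh
      exact he (by simp [z', hh])) (by
      intro v
      rw [Finset.sum_range]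
      by_cases hv : v < n
      · rw [← hz ⟨v, hv⟩]
        exact Finset.sum_congr rfl fun e _ => by rw [hginc, hz']
      · apply Finset.sum_eq_zero
        intro e _
        have := hb e e.2
        have e1 : s e ≠ v := by omega
        have e2 : t e ≠ v := by omega
        simp [inc, e1, e2])
    exact ⟨g, fun e => by rw [← hz', hg]⟩
  · intro h
    simp only [hπ]
    exact hρ h
  · intro x v hv
    obtain ⟨c, hc1, hc2⟩ := chain (s := s) (t := t) s' t' (fun _ => rfl) (fun _ => rfl) (φ x)
      ⟨root x, hroot x⟩ ⟨v, (hπ v x).1 hv⟩ ((hconn x).preconnected _ _)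
    refine ⟨c, fun e he => ⟨x, ?_⟩, fun u => by rw [hc2 u]; congr⟩
    rw [hπ, hπ]; exact hc1 e he

end

theorem planar {n M : ℕ} {s t : ℕ → ℕ} (hb : ∀ e, e < M → s e < n ∧ t e < n) {L : ℕ → Prop}
    (H : State M s t (fun e => e < M) L) : IsPlanar (gr n M s t) := by
  constructor
  · intro hm
    obtain ⟨F, _, Lh, Rh, c1, c2⟩ := minor_dual hb H _ a5 b5 (by
      intro h; rw [completeGraph_eq_top, top_adj]; revert h; decide) (by decide) hm
    exact nodual5 Lh Rh c1 c2
  · intro hm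
    obtain ⟨F, _, Lh, Rh, c1, c2⟩ := minor_dual hb H _ a33 b33 (by
      intro h; rw [completeBipartiteGraph_adj]; revert h; decide) (by decide) hm
    exact nodual33 Lh Rh c1 c2

/-- everything from indexed data -/
theorem wrap {n M : ℕ} {s t : ℕ → ℕ} (hb : ∀ e, e < M → s e < n ∧ t e < n)
    (hst : ∀ e, e < M → s e ≠ t e) {L : ℕ → Prop}
    (H : State M s t (fun e => e < M) L)
    (hnc : ¬ ∃ c : ℕ → Fin 3, ∀ e, e < M → c (s e) ≠ c (t e))
    (hcr : ∀ e0, e0 < M → ∃ c : ℕ → Fin 3, ∀ e, e < M → e ≠ e0 → c (s e) ≠ c (t e)) :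
    ∃ (V : Type) (_ : Fintype V) (G : SimpleGraph V),
      IsPlanar G ∧
      Fintype.card V = n ∧
      G.edgeSet.ncard = M ∧
      (¬ ∃ c : V → Fin 3, ∀ x y, G.Adj x y → c x ≠ c y) ∧
      (∀ e ∈ G.edgeSet,
        ∃ c : V → Fin 3, ∀ x y, (G.deleteEdges {e}).Adj x y → c x ≠ c y) := by
  let f : Fin M → Sym2 (Fin n) := fun e => s(⟨s e, (hb e e.2).1⟩, ⟨t e, (hb e e.2).2⟩)
  have hf : Set.range f = (gr n M s t).edgeSet := by
    ext p
    induction p with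
    | _ x y =>
      simp only [Set.mem_range, mem_edgeSet, f, Sym2.eq_iff, Fin.ext_iff]
      constructor
      · rintro ⟨e, he⟩
        refine ⟨?_, e, e.2, he⟩
        have := hst e e.2
        rintro rfl
        omega
      · rintro ⟨_, e, he, h⟩
        exact ⟨⟨e, he⟩, h⟩
  have hinj : Function.Injective f := by
    intro e e' hee
    by_contra hne
    obtain ⟨c, hc⟩ := hcr e e.2
    apply hnc
    refine ⟨c, fun e1 he1 => ?_⟩
    by_cases h : e1 = e
    · subst h
      have h2 := hc e' e'.2 (fun h => hne (Fin.ext h.symm))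
      simp only [f, Sym2.eq_iff, Fin.mk.injEq] at hee
      rcases hee with ⟨p, q⟩ | ⟨p, q⟩
      · rw [p, q]; exact h2
      · rw [p, q]; exact h2.symm
    · exact hc e1 he1 h
  refine ⟨Fin n, inferInstance, gr n M s t, planar hb H, by simp, ?_, ?_, ?_⟩
  · rw [← hf, ← Set.image_univ, Set.ncard_image_of_injective _ hinj]
    simp [Set.ncard_univ]
  · rintro ⟨c, hc⟩
    apply hnc
    refine ⟨fun x => if h : x < n then c ⟨x, h⟩ else 0, fun e he => ?_⟩
    obtain ⟨h1, h2⟩ := hb e he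
    simp only [h1, h2, dif_pos]
    exact hc _ _ ⟨fun h => hst e he (by simpa using h), e, he, Or.inl ⟨rfl, rfl⟩⟩
  · intro p hp
    rw [← hf] at hp
    obtain ⟨e0, rfl⟩ := hp
    obtain ⟨c, hc⟩ := hcr e0 e0.2
    refine ⟨fun x => c x, fun x y hxy => ?_⟩
    rw [deleteEdges_adj] at hxy
    obtain ⟨⟨_, e, he, h⟩, hne⟩ := hxy
    have hee : e ≠ e0 := by
      rintro rfl
      apply hne
      simp only [Set.mem_singleton_iff, f, Sym2.eq_iff, Fin.ext_iff]
      rcases h with ⟨p, q⟩ | ⟨p, q⟩ <;> simp [p, q]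
    have := hc e he hee
    rcases h with ⟨p, q⟩ | ⟨p, q⟩
    · rw [p, q] at this; exact this
    · rw [p, q] at this; exact this.symm

end FC

namespace FC

theorem state_mono {M : ℕ} {s t : ℕ → ℕ} {S L S' L' : ℕ → Prop} (hS : ∀ e, S e ↔ S' e)
    (hL : ∀ e, L' e → L e) (H : State M s t S L) : State M s t S' L' := by
  obtain ⟨ι, f1, f2, o, B, h1, h2, h3, h4, h5⟩ := H
  exact ⟨ι, f1, f2, o, B, fun i e h => (hS e).1 (h1 i e h), h2, h3, fun e h => h4 e (hL e h),
    fun z hz => h5 z (fun e h => (hS e).2 (hz e h))⟩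

/-- a local ear may be glued on: `A` bounds the new local edges, `m` all local edges, and
`N` is a lower bound for the new local vertices -/
def earOk (A m N : ℕ) (s t : ℕ → ℕ) (S L P Q ws : List ℕ) : Prop :=
  P ≠ [] ∧ (P ++ Q).Nodup ∧ (∀ p ∈ P, p ∉ S ∧ p < A) ∧ (∀ e ∈ P ++ Q, e < m) ∧
  (∀ q ∈ Q, q ∈ L) ∧
  (∀ v ∈ (P ++ Q).map s ++ (P ++ Q).map t, ((P ++ Q).map (fun e => inc s t e v)).sum = 0) ∧
  ∀ p ∈ P, p = P.headD 0 ∨ ∃ w ∈ ws, N ≤ w ∧ inc s t p w = 1 ∧ inc s t (P.headD 0) w = 1 ∧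
    ∀ e ∈ P ++ S, e ≠ p → e ≠ P.headD 0 → s e ≠ w ∧ t e ≠ w

instance (A m N : ℕ) (s t : ℕ → ℕ) (S L P Q ws : List ℕ) :
    Decidable (earOk A m N s t S L P Q ws) := by
  unfold earOk; infer_instance

def runE (A m N : ℕ) (s t : ℕ → ℕ) :
    List (List ℕ × List ℕ × List ℕ) → List ℕ → List ℕ → Option (List ℕ × List ℕ)
  | [], S, L => some (S, L)
  | (P, Q, ws) :: r, S, L =>
    if earOk A m N s t S L P Q ws then
      runE A m N s t r (P ++ S) (P ++ L.filter (fun e => decide (e ∉ Q)))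
    else none

section
variable {M B A m N off : ℕ} {s t ls lt φ : ℕ → ℕ}

theorem ear_local
    (hs : ∀ a, a < m → s (φ a) = ls a + off ∧ t (φ a) = lt a + off)
    (hφ : ∀ a b, a < m → b < m → φ a = φ b → a = b)
    (hM : ∀ a, a < m → φ a < M) (hA : ∀ a, a < A → B ≤ φ a)
    (hB : ∀ e, e < B → s e < N + off ∧ t e < N + off)
    {S L P Q ws : List ℕ} (hSm : ∀ a ∈ S, a < m) (hLm : ∀ a ∈ L, a < m)
    (ok : earOk A m N ls lt S L P Q ws)
    (H : State M s t (fun e => e < B ∨ ∃ a ∈ S, e = φ a) (fun e => ∃ a ∈ L, e = φ a)) :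
    State M s t (fun e => e < B ∨ ∃ a ∈ P ++ S, e = φ a)
      (fun e => ∃ a ∈ P ++ L.filter (fun e => decide (e ∉ Q)), e = φ a) := by
  obtain ⟨hne, hn, hPS, hm, hQ, hev, hP⟩ := ok
  have hPm : ∀ p ∈ P, p < m := fun p hp => hm p (by simp [hp])
  have hQm : ∀ p ∈ Q, p < m := fun p hp => hm p (by simp [hp])
  have hinc : ∀ a, a < m → ∀ v, inc s t (φ a) (v + off) = inc ls lt a v := by
    intro a ha v
    simp [inc, (hs a ha).1, (hs a ha).2]
  refine ear _ _ (P.map φ) (Q.map φ) H (by simpa using hne) ?_ ?_ ?_ ?_ ?_ ?_ ?_ ?_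
  · rw [← List.map_append]
    exact List.Nodup.map_on (fun x hx y hy h => hφ x y (hm x hx) (hm y hy) h) hn
  · intro p hp
    obtain ⟨a, ha, rfl⟩ := List.mem_map.1 hp
    rintro (h | ⟨b, hb, h⟩)
    · have := hA a (hPS a ha).2; omega
    · have := hφ a b (hPm a ha) (hSm b hb) h
      subst this; exact (hPS a ha).1 hb
  · intro e he
    rw [← List.map_append] at he
    obtain ⟨a, ha, rfl⟩ := List.mem_map.1 he
    exact hM a (hm a ha)
  · intro q hq
    obtain ⟨a, ha, rfl⟩ := List.mem_map.1 hq
    exact ⟨a, hQ a ha, rfl⟩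
  · rw [← List.map_append]
    apply sum_zero_of_mem
    intro v hv
    have : ∃ v', v = v' + off := by
      rcases List.mem_append.1 hv with h | h <;>
      · obtain ⟨e, he, rfl⟩ := List.mem_map.1 h
        obtain ⟨a, ha, rfl⟩ := List.mem_map.1 he
        first
          | exact ⟨_, (hs a (hm a ha)).1⟩
          | exact ⟨_, (hs a (hm a ha)).2⟩
    obtain ⟨v', rfl⟩ := this
    have := sum_zero_of_mem ls lt (P ++ Q) hev v'
    rw [← this, List.map_map]
    congr 1
    apply List.map_congr_left
    intro a ha
    exact hinc a (hm a ha) v'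
  · intro e
    simp only [List.mem_append, List.mem_map]
    constructor
    · rintro (h | ⟨a, h | h, rfl⟩)
      · exact Or.inl (Or.inl h)
      · exact Or.inr ⟨a, h, rfl⟩
      · exact Or.inl (Or.inr ⟨a, h, rfl⟩)
    · rintro ((h | ⟨a, h, rfl⟩) | ⟨a, h, rfl⟩)
      · exact Or.inl h
      · exact Or.inr ⟨a, Or.inr h, rfl⟩
      · exact Or.inr ⟨a, Or.inl h, rfl⟩
  · rintro e ⟨a, ha, rfl⟩
    rcases List.mem_append.1 ha with h | h
    · exact Or.inl (List.mem_map.2 ⟨a, h, rfl⟩)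
    · have h := List.mem_filter.1 h
      refine Or.inr ⟨⟨a, h.1, rfl⟩, ?_⟩
      intro hq
      obtain ⟨b, hb, e⟩ := List.mem_map.1 hq
      have := hφ b a (hQm b hb) (hLm a h.1) e
      subst this
      simp [hb] at h
  · intro z hz hevz
    have key : ∀ p ∈ P, z (φ p) = z (φ (P.headD 0)) := by
      intro p hp
      have hhd : P.headD 0 ∈ P := by
        cases P with
        | nil => exact absurd rfl hne
        | cons a l => simp
      rcases hP p hp with h | ⟨w, hw, hNw, i1, i2, h3⟩
      · rw [h]
      · by_cases hpe : p = P.headD 0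
        · rw [← hpe]
        refine pair_eq hz hevz (w + off) _ _ (hM _ (hPm p hp)) (hM _ (hPm _ hhd)) ?_ ?_ ?_ ?_
        · intro h; exact hpe (hφ _ _ (hPm p hp) (hPm _ hhd) h)
        · rw [hinc _ (hPm p hp)]; exact i1
        · rw [hinc _ (hPm _ hhd)]; exact i2
        · rintro e (h | ⟨a, ha, rfl⟩) n1 n2
          · have := hB e h; omega
          · have ham : a < m := by
              rcases List.mem_append.1 ha with h | h
              · exact hPm a h
              · exact hSm a h
            have := h3 a ha (fun h => n1 (by rw [h])) (fun h => n2 (by rw [h]))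
            rw [(hs a ham).1, (hs a ham).2]
            omega
    intro p hp p' hp'
    obtain ⟨a, ha, rfl⟩ := List.mem_map.1 hp
    obtain ⟨b, hb, rfl⟩ := List.mem_map.1 hp'
    rw [key a ha, key b hb]

theorem run_sound
    (hs : ∀ a, a < m → s (φ a) = ls a + off ∧ t (φ a) = lt a + off)
    (hφ : ∀ a b, a < m → b < m → φ a = φ b → a = b)
    (hM : ∀ a, a < m → φ a < M) (hA : ∀ a, a < A → B ≤ φ a)
    (hB : ∀ e, e < B → s e < N + off ∧ t e < N + off) :
    ∀ (ears : List (List ℕ × List ℕ × List ℕ)) (S L S' L' : List ℕ)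
    (_ : ∀ a ∈ S, a < m) (_ : ∀ a ∈ L, a < m)
    (_ : runE A m N ls lt ears S L = some (S', L'))
    (_ : State M s t (fun e => e < B ∨ ∃ a ∈ S, e = φ a) (fun e => ∃ a ∈ L, e = φ a)),
    State M s t (fun e => e < B ∨ ∃ a ∈ S', e = φ a) (fun e => ∃ a ∈ L', e = φ a)
  | [], S, L, S', L', _, _, h, H => by
    simp only [runE, Option.some.injEq, Prod.mk.injEq] at h
    obtain ⟨rfl, rfl⟩ := h
    exact H
  | (P, Q, ws) :: r, S, L, S', L', h1, h2, h, H => by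
    rw [runE] at h
    split_ifs at h with ok
    have hPm : ∀ p ∈ P, p < m := fun p hp => ok.2.2.2.1 p (by simp [hp])
    refine run_sound hs hφ hM hA hB r _ _ S' L' ?_ ?_ h (ear_local hs hφ hM hA hB h1 h2 ok H)
    · intro a ha
      rcases List.mem_append.1 ha with h | h
      · exact hPm a h
      · exact h1 a h
    · intro a ha
      rcases List.mem_append.1 ha with h | h
      · exact hPm a h
      · exact h2 a (List.mem_filter.1 h).1
end

/-! ### colourings -/

def chk : List (List ℕ) → (List (Fin 3) → Bool) → List (Fin 3) → Bool
  | [], fin, acc => fin acc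
  | ns :: r, fin, acc =>
    [0, 1, 2].all fun x => (ns.any fun n => acc.getD n 0 == x) || chk r fin (acc ++ [x])

def okOrd (es : List (ℕ × ℕ)) : List ℕ → List ℕ → List (List ℕ) → Bool
  | _, [], [] => true
  | pre, v :: vs, ns :: r =>
    (ns.all fun n => decide (n < pre.length) &&
      (es.contains (pre.getD n 0, v) || es.contains (v, pre.getD n 0))) && okOrd es (pre ++ [v]) vs r
  | _, _, _ => false

theorem chk_sound (es : List (ℕ × ℕ)) (c : ℕ → Fin 3) (hc : ∀ p ∈ es, c p.1 ≠ c p.2)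
    (fin : List (Fin 3) → Bool) :
    ∀ (pre vs : List ℕ) (nb : List (List ℕ)), okOrd es pre vs nb = true →
      chk nb fin (pre.map c) = true → fin ((pre ++ vs).map c) = true
  | pre, [], [], _, h => by simpa [chk] using h
  | pre, v :: vs, ns :: r, ho, h => by
    rw [okOrd, Bool.and_eq_true] at ho
    have := chk_sound es c hc fin (pre ++ [v]) vs r ho.2
    rw [List.append_assoc] at this
    apply this
    rw [chk] at h
    have hx := List.all_eq_true.1 h (c v) (by
      generalize c v = x; revert x; decide)
    rw [Bool.or_eq_true] at hx
    rcases hx with hx | hx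
    · exfalso
      obtain ⟨n, hn, hx⟩ := List.any_eq_true.1 hx
      have := List.all_eq_true.1 ho.1 n hn
      simp only [Bool.and_eq_true, Bool.or_eq_true, decide_eq_true_eq, List.contains_iff_mem] at this
      have e : (pre.map c).getD n 0 = c (pre.getD n 0) := by
        simp [List.getD_eq_getElem?_getD, this.1]
      rw [e] at hx
      have hx := eq_of_beq hx
      rcases this.2 with h | h
      · exact hc _ h hx
      · exact hc _ h hx.symm
    · simpa using hx

end FC

namespace FC

def bsL : List ℕ := [0, 0, 4, 4, 0, 4, 6, 4, 10, 10, 12, 1, 1, 2, 2, 2, 2, 5, 6, 7, 8, 10, 11, 11]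
def btL : List ℕ := [1, 7, 5, 7, 4, 8, 5, 6, 2, 3, 1, 3, 7, 3, 5, 7, 9, 9, 10, 8, 9, 12, 12, 0]
def lsL : List ℕ := [0, 13, 12, 14, 14, 14, 15, 15, 12, 15, 18, 16, 17, 17]
def ltL : List ℕ := [13, 4, 14, 11, 13, 15, 13, 16, 16, 18, 4, 18, 18, 6]
def gsL : List ℕ := [0, 0, 0, 1, 1, 1, 2, 2, 2, 2, 2, 3, 3, 4, 4, 5, 5, 5, 5, 5, 6, 7, 7, 8, 9, 11]
def gtL : List ℕ := [5, 6, 12, 4, 8, 9, 3, 4, 6, 11, 12, 4, 7, 9, 10, 6, 8, 9, 10, 11, 10, 9, 11, 10, 11, 12]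
def hexL : List ℕ := [11, 0, 4, 6, 10, 12]
def hexL2 : List ℕ := [17, 6, 10, 12, 16, 18]
def capEars : List (List ℕ × List ℕ × List ℕ) :=
  [([4, 3, 1], [], [0, 4, 7]),
  ([0, 12], [1], [1]),
  ([22, 23, 10], [0], [11, 12]),
  ([19, 5], [3], [8]),
  ([17, 2, 20], [5], [5, 9]),
  ([7, 6], [2], [6]),
  ([8, 18, 14], [6], [10, 2]),
  ([13, 9], [8], [3]),
  ([16], [14, 17], []),
  ([15], [19, 20, 16], []),
  ([11], [13, 15, 12], []),
  ([21], [10, 11, 9], [])]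
def gEars : List (List ℕ × List ℕ × List ℕ) :=
  [([17, 24, 19], [], [5, 9, 11]),
  ([2, 25, 0], [19], [12, 0]),
  ([15, 1], [0], [6]),
  ([10, 9], [25], [2]),
  ([8], [1, 10, 2], []),
  ([14, 20, 7], [8], [10, 4]),
  ([4, 23, 3], [14], [8, 1]),
  ([6, 11], [7], [3]),
  ([21, 22], [24], [7]),
  ([12], [22, 9, 6], []),
  ([13], [11, 21, 12], []),
  ([5], [3, 13], []),
  ([16], [5, 17, 4], []),
  ([18], [16, 23], [])]
def xpat : List (List (Fin 3)) :=
  [[0, 1, 0, 1, 0, 1],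
  [0, 1, 0, 1, 0, 2],
  [0, 1, 0, 2, 1, 2],
  [0, 1, 2, 1, 2, 1]]
def ypat : List (List (Fin 3)) :=
  [[0, 0, 1, 2, 0, 2],
  [0, 1, 1, 0, 2, 1],
  [0, 1, 2, 0, 0, 1],
  [0, 1, 2, 0, 1, 0],
  [0, 1, 2, 0, 1, 1],
  [0, 1, 2, 0, 1, 2],
  [0, 1, 2, 1, 0, 1],
  [0, 1, 2, 1, 0, 2],
  [0, 1, 2, 2, 0, 1]]
def outD : List (List (Fin 3)) :=
  [[1, 0, 0, 0, 0, 0, 2, 0, 0, 0, 1, 0, 2, 2, 1, 0, 1, 1, 2],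
  [1, 0, 0, 0, 2, 0, 1, 0, 0, 0, 2, 0, 1, 0, 2, 1, 2, 2, 0],
  [1, 0, 0, 0, 0, 0, 1, 0, 0, 0, 0, 0, 2, 2, 1, 0, 1, 0, 2],
  [1, 0, 0, 0, 0, 0, 2, 0, 0, 0, 1, 0, 2, 2, 1, 0, 1, 0, 2]]
def inD : List (List (Fin 3)) :=
  [[0, 0, 0, 0, 1, 0, 2, 0, 0, 0, 0, 0, 2, 2, 1, 0, 1, 1, 2],
  [1, 0, 0, 0, 1, 0, 0, 0, 0, 0, 2, 0, 1, 0, 2, 1, 0, 1, 2],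
  [1, 0, 0, 0, 2, 0, 0, 0, 0, 0, 0, 0, 1, 0, 2, 1, 2, 1, 0],
  [1, 0, 0, 0, 2, 0, 0, 0, 0, 0, 1, 0, 0, 0, 2, 1, 2, 2, 0],
  [1, 0, 0, 0, 2, 0, 0, 0, 0, 0, 1, 0, 1, 0, 2, 1, 2, 2, 0],
  [1, 0, 0, 0, 2, 0, 0, 0, 0, 0, 1, 0, 2, 0, 1, 2, 0, 2, 1],
  [1, 0, 0, 0, 2, 0, 1, 0, 0, 0, 0, 0, 1, 0, 2, 1, 2, 2, 0],
  [1, 0, 0, 0, 2, 0, 1, 0, 0, 0, 0, 0, 2, 0, 1, 2, 1, 2, 0],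
  [1, 0, 0, 0, 2, 0, 2, 0, 0, 0, 0, 0, 1, 0, 2, 1, 2, 1, 0],
  [1, 0, 0, 0, 0, 0, 2, 0, 0, 0, 0, 0, 2, 2, 1, 0, 1, 1, 2]]
def layD : List (List (Fin 3)) :=
  [[1, 0, 0, 0, 0, 0, 1, 0, 0, 0, 0, 0, 1, 1, 2, 0, 2, 2, 1],
  [1, 0, 0, 0, 0, 0, 2, 0, 0, 0, 1, 0, 2, 0, 1, 2, 0, 0, 1],
  [1, 0, 0, 0, 0, 0, 1, 0, 0, 0, 0, 0, 1, 2, 1, 0, 2, 2, 1],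
  [1, 0, 0, 0, 0, 0, 2, 0, 0, 0, 1, 0, 2, 2, 0, 1, 0, 0, 2],
  [1, 0, 0, 0, 0, 0, 1, 0, 0, 0, 0, 0, 1, 2, 2, 0, 2, 2, 1],
  [1, 0, 0, 0, 0, 0, 2, 0, 0, 0, 1, 0, 2, 2, 1, 1, 0, 0, 2],
  [1, 0, 0, 0, 0, 0, 2, 0, 0, 0, 1, 0, 2, 2, 1, 2, 0, 0, 1],
  [1, 0, 0, 0, 0, 0, 2, 0, 0, 0, 1, 0, 2, 2, 1, 0, 0, 0, 2],
  [1, 0, 0, 0, 0, 0, 1, 0, 0, 0, 0, 0, 2, 2, 1, 0, 2, 2, 1],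
  [1, 0, 0, 0, 2, 0, 1, 0, 0, 0, 2, 0, 1, 0, 2, 1, 0, 0, 1],
  [1, 0, 0, 0, 2, 0, 1, 0, 0, 0, 2, 0, 1, 0, 2, 1, 0, 0, 2],
  [1, 0, 0, 0, 0, 0, 1, 0, 0, 0, 0, 0, 2, 2, 1, 0, 1, 2, 1],
  [1, 0, 0, 0, 0, 0, 1, 0, 0, 0, 0, 0, 2, 2, 1, 0, 1, 2, 2],
  [1, 0, 0, 0, 0, 0, 1, 0, 0, 0, 0, 0, 2, 2, 1, 0, 1, 1, 2]]
def capD : List (List (Fin 3)) :=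
  [[0, 0, 0, 1, 1, 2, 0, 2, 0, 1, 2, 2, 1],
  [0, 1, 1, 0, 1, 2, 0, 0, 2, 0, 2, 2, 0],
  [0, 1, 0, 2, 1, 1, 2, 2, 0, 2, 1, 1, 2],
  [0, 1, 0, 2, 2, 1, 0, 2, 0, 2, 1, 1, 0],
  [0, 1, 0, 2, 0, 1, 2, 2, 1, 2, 1, 2, 0],
  [0, 1, 1, 0, 1, 2, 0, 2, 1, 0, 2, 2, 0],
  [0, 1, 1, 0, 1, 0, 0, 2, 0, 2, 2, 2, 0],
  [0, 1, 1, 0, 1, 0, 1, 2, 0, 2, 2, 2, 0],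
  [0, 1, 1, 0, 1, 0, 2, 2, 0, 2, 1, 1, 2],
  [0, 1, 0, 2, 1, 2, 0, 2, 0, 1, 2, 2, 0],
  [0, 1, 1, 2, 1, 0, 2, 2, 0, 2, 0, 2, 1],
  [0, 1, 0, 1, 1, 2, 0, 2, 0, 1, 2, 2, 0],
  [0, 1, 0, 2, 2, 1, 0, 1, 0, 2, 1, 1, 0],
  [0, 1, 0, 0, 1, 2, 0, 2, 0, 1, 2, 2, 0],
  [0, 1, 0, 2, 1, 0, 2, 2, 0, 1, 1, 1, 2],
  [0, 1, 2, 0, 1, 0, 2, 2, 0, 1, 1, 1, 2],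
  [0, 1, 1, 0, 1, 2, 0, 2, 0, 1, 2, 2, 0],
  [0, 1, 1, 0, 1, 2, 0, 2, 0, 2, 2, 2, 0],
  [0, 1, 1, 0, 1, 0, 2, 2, 0, 2, 2, 2, 0],
  [0, 1, 1, 0, 1, 2, 0, 2, 2, 0, 2, 2, 0],
  [0, 1, 1, 0, 1, 2, 0, 2, 0, 0, 2, 2, 0],
  [0, 1, 1, 2, 1, 0, 2, 2, 0, 2, 0, 2, 0],
  [0, 1, 1, 2, 1, 0, 2, 2, 0, 2, 0, 2, 2],
  [0, 1, 1, 2, 1, 0, 2, 2, 0, 2, 0, 0, 2]]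
def cap0D : List (List (Fin 3)) :=
  [[0, 1, 0, 2, 1, 2, 0, 2, 0, 1, 1, 1, 0],
  [0, 1, 0, 2, 1, 2, 0, 2, 0, 1, 1, 1, 2],
  [0, 1, 1, 2, 1, 0, 2, 2, 0, 2, 0, 1, 2],
  [0, 1, 0, 2, 1, 2, 0, 2, 0, 1, 1, 2, 0]]
def gD : List (List (Fin 3)) :=
  [[0, 0, 0, 1, 2, 0, 2, 0, 2, 1, 1, 2, 1],
  [0, 1, 1, 2, 0, 1, 0, 1, 0, 2, 2, 0, 2],
  [0, 1, 1, 0, 2, 1, 2, 1, 2, 0, 0, 2, 0],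
  [0, 1, 0, 2, 1, 1, 2, 1, 2, 0, 0, 2, 1],
  [0, 1, 0, 1, 2, 2, 1, 2, 1, 0, 0, 1, 2],
  [0, 0, 0, 1, 2, 2, 1, 2, 1, 0, 0, 1, 2],
  [0, 1, 0, 0, 2, 1, 2, 1, 2, 0, 0, 2, 1],
  [0, 0, 1, 0, 1, 1, 2, 1, 2, 2, 0, 0, 2],
  [0, 0, 1, 0, 2, 2, 1, 2, 1, 1, 0, 0, 2],
  [0, 0, 0, 1, 2, 2, 1, 2, 1, 1, 0, 0, 1],
  [0, 1, 1, 0, 2, 1, 2, 1, 2, 0, 0, 2, 1],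
  [0, 1, 0, 2, 2, 1, 2, 1, 2, 0, 0, 2, 1],
  [0, 1, 0, 1, 2, 1, 2, 1, 2, 0, 0, 2, 1],
  [0, 0, 1, 0, 2, 1, 2, 1, 2, 2, 0, 0, 2],
  [0, 1, 1, 2, 0, 1, 2, 1, 2, 2, 0, 0, 2],
  [0, 0, 1, 0, 2, 2, 2, 2, 1, 1, 0, 0, 2],
  [0, 1, 0, 1, 2, 2, 1, 2, 2, 0, 0, 1, 2],
  [0, 0, 0, 1, 2, 1, 2, 0, 2, 1, 0, 2, 1],
  [0, 1, 1, 2, 0, 1, 2, 1, 0, 2, 1, 0, 2],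
  [0, 0, 0, 1, 2, 2, 1, 0, 1, 1, 0, 2, 1],
  [0, 1, 0, 1, 2, 2, 1, 2, 0, 0, 1, 1, 2],
  [0, 1, 0, 1, 2, 1, 2, 0, 2, 0, 0, 2, 1],
  [0, 1, 0, 1, 2, 1, 2, 2, 2, 0, 0, 2, 1],
  [0, 1, 0, 1, 2, 2, 1, 2, 0, 0, 0, 1, 2],
  [0, 0, 0, 1, 2, 2, 1, 0, 1, 1, 0, 1, 2],
  [0, 1, 1, 0, 2, 1, 2, 1, 2, 0, 0, 2, 2]]
def gOrd : List ℕ := [5, 0, 6, 10, 8, 1, 4, 9, 2, 11, 12, 3, 7]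
def gNb : List (List ℕ) := [[], [0], [0, 1], [0, 2], [0, 3], [4], [3, 5], [0, 5, 6], [2, 6], [0, 7, 8], [1, 8, 9], [6, 8], [7, 9, 11]]
def capOrd : List ℕ := [4, 0, 7, 1, 8, 2, 3, 5, 9, 6, 10, 12, 11]
def capNb : List (List ℕ) := [[], [0], [0, 1], [1, 2], [0, 2], [2], [3, 5], [0, 5], [4, 5, 7], [0, 7], [5, 6, 9], [3, 10], [1, 11]]
def layOrd : List ℕ := [11, 0, 4, 6, 10, 12, 13, 14, 15, 16, 17, 18]
def layNb : List (List ℕ) := [[1, 2], [0, 5, 6], [6, 7], [5, 8], [3], [2, 8, 9, 10]]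

def hexE : List ℕ := [23, 4, 7, 18, 21, 22]
def hexS : List ℕ := [11, 0, 4, 6, 10, 11]
def hexT : List ℕ := [0, 4, 6, 10, 12, 12]
def layEars : List (List ℕ × List ℕ × List ℕ) :=
  [([0, 1], [15], [13]),
  ([2, 3], [19], [14]),
  ([4], [3, 14, 0], []),
  ([5, 6], [4], [15]),
  ([7, 8], [2, 5], [16]),
  ([9, 10], [6, 1], [18]),
  ([11], [7, 9], []),
  ([12, 13], [10, 16], [17])]
def finEars : List (List ℕ × List ℕ × List ℕ) :=
  [([0], [2, 3], []), ([1], [4, 5], [])]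

/-- read a list as a function -/
def rd (l : List ℕ) (a : ℕ) : ℕ := l.getD a 0
def rc (l : List (Fin 3)) (a : ℕ) : Fin 3 := l.getD a 0

theorem lay_run : ∃ S' L', runE 14 20 13 (rd (lsL ++ hexS)) (rd (ltL ++ hexT)) layEars
    [14, 15, 16, 17, 18, 19] [14, 15, 16, 17, 18, 19] = some (S', L') ∧
    (∀ a, a < 14 → a ∈ S') ∧ (∀ a ∈ S', a < 20) ∧ ∀ a ∈ [8, 11, 12, 13, 17, 18], a ∈ L' := by
  refine ⟨_, _, rfl, ?_, ?_, ?_⟩ <;> decide +kernel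

theorem fin_run : ∃ S' L', runE 2 8 13 (rd ([4, 4] ++ hexS)) (rd ([11, 10] ++ hexT)) finEars
    [2, 3, 4, 5, 6, 7] [2, 3, 4, 5, 6, 7] = some (S', L') ∧
    (∀ a, a < 2 → a ∈ S') ∧ (∀ a ∈ S', a < 8) := by
  refine ⟨_, _, rfl, ?_, ?_⟩ <;> decide +kernel

theorem cap_run : ∃ S' L', runE 24 24 0 (rd bsL) (rd btL) capEars [] [] = some (S', L') ∧
    (∀ a, a < 24 → a ∈ S') ∧ (∀ a ∈ S', a < 24) ∧ ∀ a ∈ hexE, a ∈ L' := by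
  refine ⟨_, _, rfl, ?_, ?_, ?_⟩ <;> decide +kernel

theorem g_run : ∃ S' L', runE 26 26 0 (rd gsL) (rd gtL) gEars [] [] = some (S', L') ∧
    (∀ a, a < 26 → a ∈ S') ∧ (∀ a ∈ S', a < 26) := by
  refine ⟨_, _, rfl, ?_, ?_⟩ <;> decide +kernel

theorem run_closed {m : ℕ} {s t : ℕ → ℕ} {ears} {S' L' : List ℕ}
    (h : runE m m 0 s t ears [] [] = some (S', L')) (h1 : ∀ a, a < m → a ∈ S')
    (h2 : ∀ a ∈ S', a < m) : State m s t (fun e => e < m) (fun e => e ∈ L') := by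
  have := run_sound (M := m) (B := 0) (off := 0) (φ := fun a => a) (s := s) (t := t)
    (fun a _ => ⟨rfl, rfl⟩)
    (fun a b _ _ h => h) (fun a h => h) (fun a _ => Nat.zero_le _)
    (fun e h => absurd h (Nat.not_lt_zero e)) ears [] [] S' L' (by simp) (by simp) h
    (state_mono (by simp) (by simp) (state_empty m s t))
  refine state_mono ?_ ?_ this
  · intro e
    constructor
    · rintro (h | ⟨a, h, rfl⟩)
      · omega
      · exact h2 _ h
    · intro h; exact Or.inr ⟨e, h1 e h, rfl⟩
  · intro e h; exact ⟨e, h, rfl⟩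

theorem g_state : ∃ L, State 26 (rd gsL) (rd gtL) (fun e => e < 26) L := by
  obtain ⟨S', L', h, h1, h2⟩ := g_run
  exact ⟨_, run_closed h h1 h2⟩

theorem cap_state : State 24 (rd bsL) (rd btL) (fun e => e < 24) (fun e => e ∈ hexE) := by
  obtain ⟨S', L', h, h1, h2, h3⟩ := cap_run
  exact state_mono (fun _ => Iff.rfl) h3 (run_closed h h1 h2)

theorem g_nc : ¬ ∃ c : ℕ → Fin 3, ∀ e, e < 26 → c (rd gsL e) ≠ c (rd gtL e) := by
  rintro ⟨c, hc⟩
  have := chk_sound (List.zip gsL gtL) c (by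
    have : List.zip gsL gtL = (List.range 26).map (fun e => (rd gsL e, rd gtL e)) := by
      decide +kernel
    rw [this]
    intro p hp
    obtain ⟨e, he, rfl⟩ := List.mem_map.1 hp
    exact hc e (List.mem_range.1 he)) (fun _ => false) [] gOrd gNb (by decide +kernel)
    (by rw [List.map_nil]; decide +kernel)
  simp at this

theorem g_cr : ∀ e0, e0 < 26 → ∃ c : ℕ → Fin 3, ∀ e, e < 26 → e ≠ e0 →
    c (rd gsL e) ≠ c (rd gtL e) := by
  intro e0 h0
  refine ⟨rc (gD.getD e0 []), ?_⟩
  revert e0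
  decide +kernel

theorem case_one : ∃ (V : Type) (_ : Fintype V) (G : SimpleGraph V),
      IsPlanar G ∧
      Fintype.card V = 13 ∧
      G.edgeSet.ncard = 26 ∧
      (¬ ∃ c : V → Fin 3, ∀ x y, G.Adj x y → c x ≠ c y) ∧
      (∀ e ∈ G.edgeSet,
        ∃ c : V → Fin 3, ∀ x y, (G.deleteEdges {e}).Adj x y → c x ≠ c y) := by
  obtain ⟨L, H⟩ := g_state
  exact wrap (by decide +kernel) (by decide +kernel) H g_nc g_cr

/-- the colour permutations -/
def perms : List (List (Fin 3)) := [[0, 1, 2], [0, 2, 1], [1, 0, 2], [1, 2, 0], [2, 0, 1], [2, 1, 0]]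

/-- a colour permutation as a function -/
def pc (σ : List (Fin 3)) (x : Fin 3) : Fin 3 := σ.getD x.val 0

def allP (l : List (List (Fin 3))) : List (List (Fin 3)) :=
  perms.flatMap fun σ => l.map fun p => p.map (pc σ)

theorem mem_allP {l : List (List (Fin 3))} {p : List (Fin 3)} :
    p ∈ allP l ↔ ∃ σ ∈ perms, ∃ q ∈ l, q.map (pc σ) = p := by
  simp [allP]

theorem perms_inj : ∀ σ ∈ perms, ∀ a b, pc σ a = pc σ b → a = b := by decide +kernel

theorem cap_pat (c : ℕ → Fin 3) (hc : ∀ e, e < 24 → c (rd bsL e) ≠ c (rd btL e)) :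
    hexL.map c ∈ allP xpat := by
  have := chk_sound (List.zip bsL btL) c (by
    have : List.zip bsL btL = (List.range 24).map (fun e => (rd bsL e, rd btL e)) := by
      decide +kernel
    rw [this]
    intro p hp
    obtain ⟨e, he, rfl⟩ := List.mem_map.1 hp
    exact hc e (List.mem_range.1 he))
    (fun l => decide ([12, 1, 0, 9, 10, 11].map (rc l) ∈ allP xpat)) [] capOrd capNb
    (by decide +kernel) (by rw [List.map_nil]; decide +kernel)
  exact of_decide_eq_true this

theorem lay_pat (c : ℕ → Fin 3) (hc : ∀ e, e < 14 → c (rd lsL e) ≠ c (rd ltL e))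
    (h : hexL.map c ∈ allP xpat) :
    hexL2.map c ∈ allP xpat := by
  have key : ∀ p ∈ allP xpat,
    chk layNb (fun l => decide ([10, 3, 4, 5, 9, 11].map (rc l) ∈ allP xpat)) p = true := by
    decide +kernel
  have := chk_sound (List.zip lsL ltL) c (by
    have : List.zip lsL ltL = (List.range 14).map (fun e => (rd lsL e, rd ltL e)) := by
      decide +kernel
    rw [this]
    intro p hp
    obtain ⟨e, he, rfl⟩ := List.mem_map.1 hp
    exact hc e (List.mem_range.1 he))
    (fun l => decide ([10, 3, 4, 5, 9, 11].map (rc l) ∈ allP xpat)) hexL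
    [13, 14, 15, 16, 17, 18] layNb
    (by decide +kernel) (key _ h)
  exact of_decide_eq_true this

end FC

namespace FC

/-- first endpoints of the edges of the family -/
def fs (K e : ℕ) : ℕ :=
  if e < 24 then rd bsL e else
    if e < 24 + 14 * K then rd lsL ((e - 24) % 14) + 6 * ((e - 24) / 14) else 4 + 6 * K

/-- second endpoints of the edges of the family -/
def ft (K e : ℕ) : ℕ :=
  if e < 24 then rd btL e else
    if e < 24 + 14 * K then rd ltL ((e - 24) % 14) + 6 * ((e - 24) / 14) else
      (if e = 24 + 14 * K then 11 else 10) + 6 * K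

theorem f_cap (K e : ℕ) (h : e < 24) : fs K e = rd bsL e ∧ ft K e = rd btL e := by
  simp [fs, ft, h]

theorem f_lay (K j a : ℕ) (hj : j < K) (ha : a < 14) :
    fs K (24 + 14 * j + a) = rd lsL a + 6 * j ∧ ft K (24 + 14 * j + a) = rd ltL a + 6 * j := by
  have h1 : ¬ 24 + 14 * j + a < 24 := by omega
  have h2 : 24 + 14 * j + a < 24 + 14 * K := by omega
  have h3 : (24 + 14 * j + a - 24) % 14 = a := by omega
  have h4 : (24 + 14 * j + a - 24) / 14 = j := by omega
  simp only [fs, ft, h1, h2, h3, h4, if_true, if_false, and_self]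

theorem f_fin (K a : ℕ) (ha : a < 2) :
    fs K (24 + 14 * K + a) = rd [4, 4] a + 6 * K ∧ ft K (24 + 14 * K + a) = rd [11, 10] a + 6 * K := by
  have h1 : ¬ 24 + 14 * K + a < 24 := by omega
  have h2 : ¬ 24 + 14 * K + a < 24 + 14 * K := by omega
  simp only [fs, ft, h1, h2, if_false]
  interval_cases a <;> simp [rd]

theorem f_hex (K j : ℕ) (hj : j ≤ K) (i : ℕ) (hi : i < 6) :
    fs K (rd hexE i + 14 * j) = rd hexS i + 6 * j ∧ ft K (rd hexE i + 14 * j) = rd hexT i + 6 * j := by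
  induction j generalizing i with
  | zero =>
    have : ∀ i, i < 6 → rd hexE i < 24 ∧ rd bsL (rd hexE i) = rd hexS i ∧
      rd btL (rd hexE i) = rd hexT i := by decide
    obtain ⟨h1, h2, h3⟩ := this i hi
    have := f_cap K _ h1
    simp only [Nat.mul_zero, Nat.add_zero]
    rw [this.1, this.2, h2, h3]; exact ⟨rfl, rfl⟩
  | succ j ih =>
    have ih := ih (by omega)
    have hl := fun a => f_lay K j a hj
    have : i = 0 ∨ i = 1 ∨ i = 2 ∨ i = 3 ∨ i = 4 ∨ i = 5 := by omega
    rcases this with rfl | rfl | rfl | rfl | rfl | rfl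
    · have := hl 13 (by omega)
      simp only [rd, hexE, hexS, hexT, lsL, ltL, List.getD_cons_succ, List.getD_cons_zero] at this ⊢
      rw [show 23 + 14 * (j + 1) = 24 + 14 * j + 13 by omega, this.1, this.2]; omega
    · have := ih 3 (by omega)
      simp only [rd, hexE, hexS, hexT, List.getD_cons_succ, List.getD_cons_zero] at this ⊢
      rw [show 4 + 14 * (j + 1) = 18 + 14 * j by omega, this.1, this.2]; omega
    · have := ih 4 (by omega)
      simp only [rd, hexE, hexS, hexT, List.getD_cons_succ, List.getD_cons_zero] at this ⊢
      rw [show 7 + 14 * (j + 1) = 21 + 14 * j by omega, this.1, this.2]; omega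
    · have := hl 8 (by omega)
      simp only [rd, hexE, hexS, hexT, lsL, ltL, List.getD_cons_succ, List.getD_cons_zero] at this ⊢
      rw [show 18 + 14 * (j + 1) = 24 + 14 * j + 8 by omega, this.1, this.2]; omega
    · have := hl 11 (by omega)
      simp only [rd, hexE, hexS, hexT, lsL, ltL, List.getD_cons_succ, List.getD_cons_zero] at this ⊢
      rw [show 21 + 14 * (j + 1) = 24 + 14 * j + 11 by omega, this.1, this.2]; omega
    · have := hl 12 (by omega)
      simp only [rd, hexE, hexS, hexT, lsL, ltL, List.getD_cons_succ, List.getD_cons_zero] at this ⊢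
      rw [show 22 + 14 * (j + 1) = 24 + 14 * j + 12 by omega, this.1, this.2]; omega

/-- which kind of edge is `e`? -/
theorem edge_cases (K e : ℕ) (h : e < 26 + 14 * K) :
    e < 24 ∨ (∃ j a, j < K ∧ a < 14 ∧ e = 24 + 14 * j + a) ∨ ∃ a, a < 2 ∧ e = 24 + 14 * K + a := by
  by_cases h1 : e < 24
  · exact Or.inl h1
  by_cases h2 : e < 24 + 14 * K
  · exact Or.inr (Or.inl ⟨(e - 24) / 14, (e - 24) % 14, by omega, by omega, by omega⟩)
  · exact Or.inr (Or.inr ⟨e - (24 + 14 * K), by omega, by omega⟩)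

theorem f_lt (K i e : ℕ) (hi : i ≤ K) (he : e < 24 + 14 * i) :
    fs K e < 13 + 6 * i ∧ ft K e < 13 + 6 * i := by
  rcases edge_cases K e (by omega) with h | ⟨j, a, hj, ha, rfl⟩ | ⟨a, ha, rfl⟩
  · have : ∀ e, e < 24 → rd bsL e < 13 ∧ rd btL e < 13 := by decide
    have := this e h
    rw [(f_cap K e h).1, (f_cap K e h).2]; omega
  · have : ∀ a, a < 14 → rd lsL a < 19 ∧ rd ltL a < 19 := by decide
    have := this a ha
    rw [(f_lay K j a hj ha).1, (f_lay K j a hj ha).2]; omega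
  · omega

theorem f_bound (K e : ℕ) (he : e < 26 + 14 * K) : fs K e < 6 * K + 13 ∧ ft K e < 6 * K + 13 := by
  by_cases h : e < 24 + 14 * K
  · have := f_lt K K e le_rfl h; omega
  · obtain ⟨a, ha, rfl⟩ : ∃ a, a < 2 ∧ e = 24 + 14 * K + a :=
      ⟨e - (24 + 14 * K), by omega, by omega⟩
    have : ∀ a, a < 2 → rd [4, 4] a < 13 ∧ rd [11, 10] a < 13 := by decide
    have := this a ha
    rw [(f_fin K a ha).1, (f_fin K a ha).2]; omega

theorem f_ne (K e : ℕ) (he : e < 26 + 14 * K) : fs K e ≠ ft K e := by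
  rcases edge_cases K e he with h | ⟨j, a, hj, ha, rfl⟩ | ⟨a, ha, rfl⟩
  · have : ∀ e, e < 24 → rd bsL e ≠ rd btL e := by decide
    have := this e h
    rw [(f_cap K e h).1, (f_cap K e h).2]; exact this
  · have : ∀ a, a < 14 → rd lsL a ≠ rd ltL a := by decide
    have := this a ha
    rw [(f_lay K j a hj ha).1, (f_lay K j a hj ha).2]; omega
  · have : ∀ a, a < 2 → rd [4, 4] a ≠ rd [11, 10] a := by decide
    have := this a ha
    rw [(f_fin K a ha).1, (f_fin K a ha).2]; omega

/-- vertices on the hexagon or beyond it -/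
def Hx (y : ℕ) : Prop := y ∈ hexL ∨ 13 ≤ y

instance (y : ℕ) : Decidable (Hx y) := by unfold Hx; infer_instance

theorem Hx_add (y m : ℕ) (h : Hx y) : Hx (y + 6 * m) := by
  induction m with
  | zero => exact h
  | succ m ih =>
    simp only [Hx, hexL, List.mem_cons, List.not_mem_nil, or_false] at ih ⊢
    omega

theorem f_ge (K i e : ℕ) (hi : i ≤ K) (he : 24 + 14 * i ≤ e) (he' : e < 26 + 14 * K) :
    (∃ y, Hx y ∧ fs K e = y + 6 * i) ∧ ∃ y, Hx y ∧ ft K e = y + 6 * i := by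
  rcases edge_cases K e he' with h | ⟨j, a, hj, ha, rfl⟩ | ⟨a, ha, rfl⟩
  · omega
  · obtain ⟨m, rfl⟩ : ∃ m, j = i + m := ⟨j - i, by omega⟩
    have : ∀ a, a < 14 → Hx (rd lsL a) ∧ Hx (rd ltL a) := by decide
    have := this a ha
    rw [(f_lay K _ a hj ha).1, (f_lay K _ a hj ha).2]
    exact ⟨⟨_, Hx_add _ m this.1, by omega⟩, ⟨_, Hx_add _ m this.2, by omega⟩⟩
  · obtain ⟨m, rfl⟩ : ∃ m, K = i + m := ⟨K - i, by omega⟩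
    have : ∀ a, a < 2 → Hx (rd [4, 4] a) ∧ Hx (rd [11, 10] a) := by decide
    have := this a ha
    rw [(f_fin _ a ha).1, (f_fin _ a ha).2]
    exact ⟨⟨_, Hx_add _ m this.1, by omega⟩, ⟨_, Hx_add _ m this.2, by omega⟩⟩

/-! ### planarity state -/

/-- the local numbering of the edges: `w` new ones, then the six of the hexagon -/
def loc (w j a : ℕ) : ℕ := if a < w then 24 + 14 * j + a else rd hexE (a - w) + 14 * j

theorem loc_new {w j a : ℕ} (h : a < w) : loc w j a = 24 + 14 * j + a := by simp [loc, h]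
theorem loc_hex {w j i : ℕ} : loc w j (w + i) = rd hexE i + 14 * j := by simp [loc]

theorem loc_inj (w j a b : ℕ) (ha : a < w + 6) (hb : b < w + 6) (h : loc w j a = loc w j b) :
    a = b := by
  have h1 : ∀ i, i < 6 → rd hexE i < 24 := by decide
  have h2 : ∀ i, i < 6 → ∀ i', i' < 6 → rd hexE i = rd hexE i' → i = i' := by decide
  unfold loc at h
  split_ifs at h with c1 c2 c2
  · omega
  · have := h1 (b - w) (by omega); omega
  · have := h1 (a - w) (by omega); omega
  · have := h2 (a - w) (by omega) (b - w) (by omega) (by omega); omega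

theorem step_state {K j w : ℕ} {as at' : List ℕ} (hj : j ≤ K)
    (hw : ∀ a, a < w → fs K (24 + 14 * j + a) = rd (as ++ hexS) a + 6 * j ∧
      ft K (24 + 14 * j + a) = rd (at' ++ hexT) a + 6 * j)
    (hls : as.length = w) (hlt : at'.length = w) (hw2 : 14 * j + w ≤ 14 * K + 2)
    {ears} {S' L' L0 : List ℕ} (hL0 : L0 = (List.range 6).map (fun i => w + i))
    (hr : runE w (w + 6) 13 (rd (as ++ hexS)) (rd (at' ++ hexT)) ears L0 L0 = some (S', L'))
    (h1 : ∀ a, a < w → a ∈ S') (h2 : ∀ a ∈ S', a < w + 6)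
    (H : State (26 + 14 * K) (fs K) (ft K) (fun e => e < 24 + 14 * j)
      (fun e => ∃ i, i < 6 ∧ e = rd hexE i + 14 * j)) :
    State (26 + 14 * K) (fs K) (ft K) (fun e => e < 24 + 14 * j + w)
      (fun e => ∃ a ∈ L', e = loc w j a) := by
  have hE : ∀ i, i < 6 → rd hexE i < 24 := by decide
  have hL0m : ∀ a ∈ L0, a < w + 6 ∧ w ≤ a := by
    intro a ha
    rw [hL0] at ha
    obtain ⟨i, hi, rfl⟩ := List.mem_map.1 ha
    have := List.mem_range.1 hi
    omega
  have := run_sound (M := 26 + 14 * K) (B := 24 + 14 * j) (A := w) (m := w + 6) (N := 13)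
    (off := 6 * j) (φ := loc w j) (s := fs K) (t := ft K) ?_ (loc_inj w j) ?_ ?_ ?_ ears L0 L0 S' L'
    (fun a ha => (hL0m a ha).1) (fun a ha => (hL0m a ha).1) hr ?_
  · refine state_mono ?_ (fun _ h => h) this
    intro e
    constructor
    · rintro (h | ⟨a, ha, rfl⟩)
      · omega
      · have := h2 a ha
        unfold loc
        split_ifs with c
        · omega
        · have := hE (a - w) (by omega); omega
    · intro h
      by_cases hc : e < 24 + 14 * j
      · exact Or.inl hc
      · refine Or.inr ⟨e - (24 + 14 * j), h1 _ (by omega), ?_⟩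
        rw [loc_new (by omega)]; omega
  · intro a ha
    by_cases hc : a < w
    · rw [loc_new hc]; exact hw a hc
    · obtain ⟨i, rfl⟩ : ∃ i, a = w + i := ⟨a - w, by omega⟩
      rw [loc_hex]
      have := f_hex K j hj i (by omega)
      have e1 : rd (as ++ hexS) (w + i) = rd hexS i := by
        simp [rd, List.getD_eq_getElem?_getD, ← hls, List.getElem?_append_right]
      have e2 : rd (at' ++ hexT) (w + i) = rd hexT i := by
        simp [rd, List.getD_eq_getElem?_getD, ← hlt, List.getElem?_append_right]
      rw [e1, e2]; exact this
  · intro a ha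
    unfold loc
    split_ifs with c
    · omega
    · have := hE (a - w) (by omega); omega
  · intro a ha
    rw [loc_new ha]; omega
  · intro e he
    exact f_lt K j e hj he
  · refine state_mono ?_ ?_ H
    · intro e
      constructor
      · exact Or.inl
      · rintro (h | ⟨a, ha, rfl⟩)
        · exact h
        · have := hL0m a ha
          unfold loc
          rw [if_neg (by omega)]
          have := hE (a - w) (by omega); omega
    · rintro e ⟨a, ha, rfl⟩
      have := hL0m a ha
      refine ⟨a - w, by omega, ?_⟩
      unfold loc
      rw [if_neg (by omega)]

theorem fam_state (K j : ℕ) (hj : j ≤ K) :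
    State (26 + 14 * K) (fs K) (ft K) (fun e => e < 24 + 14 * j)
      (fun e => ∃ i, i < 6 ∧ e = rd hexE i + 14 * j) := by
  induction j with
  | zero =>
    have h := state_congr (M' := 26 + 14 * K) (s' := fs K) (t' := ft K) (fun e he =>
      ⟨he, by omega, (f_cap K e he).1, (f_cap K e he).2⟩) cap_state
    refine state_mono (fun e => by simp) ?_ h
    rintro e ⟨i, hi, rfl⟩
    have : ∀ i, i < 6 → rd hexE i ∈ hexE := by decide
    simpa using this i hi
  | succ j ih =>
    obtain ⟨S', L', hr, h1, h2, h3⟩ := lay_run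
    have hh : ∀ a, a < 14 → rd (lsL ++ hexS) a = rd lsL a ∧ rd (ltL ++ hexT) a = rd ltL a := by
      decide
    have := step_state (K := K) (j := j) (w := 14) (as := lsL) (at' := ltL) (by omega)
      (fun a ha => by rw [(hh a ha).1, (hh a ha).2]; exact f_lay K j a hj ha) rfl rfl (by omega)
      (by decide) hr h1 h2 (ih (by omega))
    refine state_mono (fun e => by constructor <;> (intro h; omega)) ?_ this
    rintro e ⟨i, hi, rfl⟩
    have key : ∀ i, i < 6 → ∃ a ∈ [8, 11, 12, 13, 17, 18],
      rd hexE i + 14 = (if a < 14 then 24 + a else rd hexE (a - 14)) := by decide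
    obtain ⟨a, ha, e⟩ := key i hi
    refine ⟨a, h3 a ha, ?_⟩
    unfold loc
    split_ifs at e ⊢ <;> omega

theorem fam_planar (K : ℕ) : ∃ L, State (26 + 14 * K) (fs K) (ft K) (fun e => e < 26 + 14 * K) L := by
  obtain ⟨S', L', hr, h1, h2⟩ := fin_run
  have hh : ∀ a, a < 2 → rd ([4, 4] ++ hexS) a = rd [4, 4] a ∧
    rd ([11, 10] ++ hexT) a = rd [11, 10] a := by decide
  have := step_state (K := K) (j := K) (w := 2) (as := [4, 4]) (at' := [11, 10]) (by omega)
      (fun a ha => by rw [(hh a ha).1, (hh a ha).2]; exact f_fin K a ha) rfl rfl (by omega)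
      (by decide) hr h1 h2 (fam_state K K le_rfl)
  exact ⟨_, state_mono (fun e => by constructor <;> (intro h; omega)) (fun _ h => h) this⟩

/-! ### no 3-colouring -/

theorem fam_pat (K : ℕ) (c : ℕ → Fin 3) (hc : ∀ e, e < 26 + 14 * K → c (fs K e) ≠ c (ft K e))
    (j : ℕ) (hj : j ≤ K) : hexL.map (fun x => c (x + 6 * j)) ∈ allP xpat := by
  induction j with
  | zero =>
    apply cap_pat
    intro e he
    have := hc e (by omega)
    rw [(f_cap K e he).1, (f_cap K e he).2] at this
    simpa using this
  | succ j ih =>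
    have := lay_pat (fun x => c (x + 6 * j)) (by
      intro a ha
      have := hc (24 + 14 * j + a) (by omega)
      rw [(f_lay K j a hj ha).1, (f_lay K j a hj ha).2] at this
      exact this) (ih (by omega))
    convert this using 1
    simp only [hexL, hexL2, List.map_cons, List.map_nil]
    have e : ∀ x, x + 6 * (j + 1) = (x + 6) + 6 * j := by intro x; omega
    simp only [e, Nat.reduceAdd]

theorem fam_nc (K : ℕ) :
    ¬ ∃ c : ℕ → Fin 3, ∀ e, e < 26 + 14 * K → c (fs K e) ≠ c (ft K e) := by
  rintro ⟨c, hc⟩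
  have h := fam_pat K c hc K le_rfl
  have key : ∀ p ∈ allP xpat, rc p 2 = rc p 0 ∨ rc p 2 = rc p 4 := by decide +kernel
  have h0 := hc (24 + 14 * K + 0) (by omega)
  have h1 := hc (24 + 14 * K + 1) (by omega)
  rw [(f_fin K 0 (by omega)).1, (f_fin K 0 (by omega)).2] at h0
  rw [(f_fin K 1 (by omega)).1, (f_fin K 1 (by omega)).2] at h1
  rcases key _ h with h | h
  · exact h0 h
  · exact h1 h

end FC

namespace FC

/-- some map is proper on the edges in `D` and shows the pattern `p` on the `i`-th hexagon -/
def Col (K : ℕ) (D : ℕ → Prop) (i : ℕ) (p : List (Fin 3)) : Prop :=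
  ∃ c : ℕ → Fin 3, (∀ e, D e → c (fs K e) ≠ c (ft K e)) ∧ hexL.map (fun x => c (x + 6 * i)) = p

theorem map_shift (c : ℕ → Fin 3) (j : ℕ) :
    hexL.map (fun x => c (x + 6 * (j + 1))) = hexL2.map (fun x => c (x + 6 * j)) := by
  simp only [hexL, hexL2, List.map_cons, List.map_nil]
  have e : ∀ x, x + 6 * (j + 1) = (x + 6) + 6 * j := by intro x; omega
  simp only [e, Nat.reduceAdd]

theorem col_perm {K : ℕ} {D : ℕ → Prop} {i : ℕ} {p q : List (Fin 3)} (h : Col K D i p)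
    (hq : q ∈ allP [p]) : Col K D i q := by
  obtain ⟨σ, hσ, q', hq', rfl⟩ := mem_allP.1 hq
  obtain rfl : q' = p := by simpa using hq'
  obtain ⟨c, h1, h2⟩ := h
  refine ⟨fun x => pc σ (c x), fun e he h => h1 e he (perms_inj σ hσ _ _ h), ?_⟩
  rw [← h2, List.map_map]; rfl

theorem glue {i : ℕ} {c1 c2 : ℕ → Fin 3}
    (h : hexL.map (fun x => c1 (x + 6 * i)) = hexL.map (fun x => c2 (x + 6 * i))) :
    ∃ c : ℕ → Fin 3, (∀ x, x < 13 + 6 * i → c x = c1 x) ∧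
      ∀ y, Hx y → c (y + 6 * i) = c2 (y + 6 * i) := by
  refine ⟨fun x => if x < 13 + 6 * i then c1 x else c2 x, fun x hx => if_pos hx, ?_⟩
  rintro y (hy | hy)
  · have h' := List.map_inj_left.1 h y hy
    simp only
    split_ifs
    · exact h'
    · rfl
  · simp only
    rw [if_neg (by omega)]

theorem glue_edges {K i : ℕ} (hi : i ≤ K) {c c1 c2 : ℕ → Fin 3} {D1 D2 : ℕ → Prop}
    (g1 : ∀ x, x < 13 + 6 * i → c x = c1 x) (g2 : ∀ y, Hx y → c (y + 6 * i) = c2 (y + 6 * i))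
    (d1 : ∀ e, D1 e → e < 24 + 14 * i) (d2 : ∀ e, D2 e → 24 + 14 * i ≤ e ∧ e < 26 + 14 * K)
    (p1 : ∀ e, D1 e → c1 (fs K e) ≠ c1 (ft K e)) (p2 : ∀ e, D2 e → c2 (fs K e) ≠ c2 (ft K e))
    (e : ℕ) (he : D1 e ∨ D2 e) : c (fs K e) ≠ c (ft K e) := by
  rcases he with he | he
  · have := f_lt K i e hi (d1 e he)
    rw [g1 _ this.1, g1 _ this.2]; exact p1 e he
  · obtain ⟨⟨y, hy, e1⟩, y', hy', e2⟩ := f_ge K i e hi (d2 e he).1 (d2 e he).2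
    have := p2 e he
    rw [e1, e2] at this ⊢
    rw [g2 y hy, g2 y' hy']; exact this

theorem hexL_lt : ∀ x ∈ hexL, x < 13 := by decide
theorem hexL2_Hx : ∀ x ∈ hexL2, Hx x := by decide

/-- a table colouring of a layer -/
theorem lay_col {K j : ℕ} (hj : j < K) (d : List (Fin 3)) (B : ℕ → Prop)
    (hd : ∀ a, a < 14 → B a → rc d (rd lsL a) ≠ rc d (rd ltL a)) :
    ∃ c : ℕ → Fin 3, (∀ e, (24 + 14 * j ≤ e ∧ e < 24 + 14 * (j + 1) ∧ B (e - (24 + 14 * j))) →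
        c (fs K e) ≠ c (ft K e)) ∧
      hexL.map (fun x => c (x + 6 * j)) = hexL.map (rc d) ∧
      hexL.map (fun x => c (x + 6 * (j + 1))) = hexL2.map (rc d) := by
  refine ⟨fun x => rc d (x - 6 * j), ?_, ?_, ?_⟩
  · rintro e ⟨h1, h2, h3⟩
    obtain ⟨a, rfl⟩ : ∃ a, e = 24 + 14 * j + a := ⟨e - (24 + 14 * j), by omega⟩
    have ha : a < 14 := by omega
    rw [(f_lay K j a hj ha).1, (f_lay K j a hj ha).2]
    simp only [Nat.add_sub_cancel]
    apply hd a ha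
    rwa [Nat.add_sub_cancel_left] at h3
  · simp only [Nat.add_sub_cancel]
  · refine (map_shift (fun x => rc d (x - 6 * j)) j).trans ?_
    simp only [Nat.add_sub_cancel]

/-- extend an outer colouring by a layer -/
theorem add_out {K j : ℕ} (hj : j < K) (d p : List (Fin 3)) (B : ℕ → Prop)
    (hd : ∀ a, a < 14 → B a → rc d (rd lsL a) ≠ rc d (rd ltL a))
    (hp : p = hexL.map (rc d)) (h : Col K (fun e => e < 24 + 14 * j) j p) :
    Col K (fun e => e < 24 + 14 * j ∨
      (24 + 14 * j ≤ e ∧ e < 24 + 14 * (j + 1) ∧ B (e - (24 + 14 * j)))) (j + 1)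
      (hexL2.map (rc d)) := by
  obtain ⟨c1, p1, q1⟩ := h
  obtain ⟨c2, p2, q2, q3⟩ := lay_col hj d B hd
  obtain ⟨c, g1, g2⟩ := glue (i := j) (c1 := c1) (c2 := c2) (by rw [q1, q2, hp])
  refine ⟨c, glue_edges (le_of_lt hj) g1 g2 (fun e h => h) (fun e h => ⟨h.1, by omega⟩) p1 p2, ?_⟩
  rw [← q3, map_shift, map_shift]
  exact List.map_congr_left fun x hx => g2 x (hexL2_Hx x hx)

/-- extend an inner colouring by a layer -/
theorem add_in {K j : ℕ} (hj : j < K) (d p : List (Fin 3))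
    (hd : ∀ a, a < 14 → True → rc d (rd lsL a) ≠ rc d (rd ltL a))
    (hp : p = hexL2.map (rc d))
    (h : Col K (fun e => 24 + 14 * (j + 1) ≤ e ∧ e < 26 + 14 * K) (j + 1) p) :
    Col K (fun e => 24 + 14 * j ≤ e ∧ e < 26 + 14 * K) j (hexL.map (rc d)) := by
  obtain ⟨c2, p2, q2⟩ := h
  obtain ⟨c1, p1, q1, q3⟩ := lay_col hj d (fun _ => True) hd
  obtain ⟨c, g1, g2⟩ := glue (i := j + 1) (c1 := c1) (c2 := c2) (by rw [q3, q2, hp])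
  refine ⟨c, fun e he => glue_edges hj g1 g2 (fun e h => h.2.1) (fun e h => h) p1 p2 e ?_, ?_⟩
  · by_cases h : e < 24 + 14 * (j + 1)
    · exact Or.inl ⟨he.1, h, trivial⟩
    · exact Or.inr ⟨by omega, he.2⟩
  · rw [← q1]
    apply List.map_congr_left
    intro x hx
    have := hexL_lt x hx
    exact g1 _ (by omega)

theorem out_col (K i : ℕ) (hi : i ≤ K) : ∀ q ∈ allP xpat, Col K (fun e => e < 24 + 14 * i) i q := by
  induction i with
  | zero =>
    have key : ∀ q ∈ allP xpat, ∃ d ∈ cap0D, (∀ e, e < 24 → rc d (rd bsL e) ≠ rc d (rd btL e)) ∧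
      q ∈ allP [hexL.map (rc d)] := by decide +kernel
    intro q hq
    obtain ⟨d, _, hd, h⟩ := key q hq
    refine col_perm ⟨rc d, ?_, rfl⟩ h
    intro e he
    rw [(f_cap K e he).1, (f_cap K e he).2]
    exact hd e he
  | succ i ih =>
    have key : ∀ q ∈ allP xpat, ∃ d ∈ outD,
      (∀ a, a < 14 → True → rc d (rd lsL a) ≠ rc d (rd ltL a)) ∧
      hexL.map (rc d) ∈ allP xpat ∧ q ∈ allP [hexL2.map (rc d)] := by decide +kernel
    intro q hq
    obtain ⟨d, _, hd, h1, h2⟩ := key q hq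
    refine col_perm ?_ h2
    obtain ⟨c, p1, p2⟩ := add_out (j := i) hi d _ (fun _ => True) hd rfl (ih (by omega) _ h1)
    refine ⟨c, fun e he => p1 e ?_, p2⟩
    by_cases h : e < 24 + 14 * i
    · exact Or.inl h
    · exact Or.inr ⟨by omega, he, trivial⟩

/-- the additional pattern -/
def zpat : List (List (Fin 3)) := [0, 1, 0, 2, 0, 2] :: ypat

theorem in_step : ∀ p ∈ allP zpat, ∃ d ∈ inD,
    (∀ a, a < 14 → True → rc d (rd lsL a) ≠ rc d (rd ltL a)) ∧
    p ∈ allP [hexL.map (rc d)] ∧ hexL2.map (rc d) ∈ allP ypat := by decide +kernel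

/-- colour just a hexagon -/
def fc (p : List (Fin 3)) (y : ℕ) : Fin 3 := rc p (hexL.idxOf y)

theorem fin_col (K : ℕ) (p : List (Fin 3)) (B : ℕ → Prop) (hp : hexL.map (fc p) = p)
    (hB : ∀ a, a < 2 → B a → fc p (rd [4, 4] a) ≠ fc p (rd [11, 10] a)) :
    Col K (fun e => 24 + 14 * K ≤ e ∧ e < 26 + 14 * K ∧ B (e - (24 + 14 * K))) K p := by
  refine ⟨fun x => fc p (x - 6 * K), ?_, ?_⟩
  · rintro e ⟨h1, h2, h3⟩
    obtain ⟨a, rfl⟩ : ∃ a, e = 24 + 14 * K + a := ⟨e - (24 + 14 * K), by omega⟩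
    have ha : a < 2 := by omega
    rw [(f_fin K a ha).1, (f_fin K a ha).2]
    simp only [Nat.add_sub_cancel]
    apply hB a ha
    rwa [Nat.add_sub_cancel_left] at h3
  · simp only [Nat.add_sub_cancel]; exact hp

theorem in_col (K m : ℕ) : ∀ i, i + m = K → ∀ p ∈ allP ypat,
    Col K (fun e => 24 + 14 * i ≤ e ∧ e < 26 + 14 * K) i p := by
  induction m with
  | zero =>
    intro i hi p hp
    obtain rfl : i = K := by omega
    have key : ∀ p ∈ allP ypat, hexL.map (fc p) = p ∧
      ∀ a, a < 2 → True → fc p (rd [4, 4] a) ≠ fc p (rd [11, 10] a) := by decide +kernel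
    obtain ⟨h1, h2⟩ := key p hp
    obtain ⟨c, p1, p2⟩ := fin_col i p (fun _ => True) h1 h2
    exact ⟨c, fun e he => p1 e ⟨he.1, he.2, trivial⟩, p2⟩
  | succ m ih =>
    intro i hi p hp
    have hp' : p ∈ allP zpat := by
      obtain ⟨σ, h1, q, h2, h3⟩ := mem_allP.1 hp
      exact mem_allP.2 ⟨σ, h1, q, List.mem_cons_of_mem _ h2, h3⟩
    obtain ⟨d, _, hd, h1, h2⟩ := in_step p hp'
    exact col_perm (add_in (by omega) d _ hd rfl (ih (i + 1) (by omega) _ h2)) h1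

theorem fam_cr (K : ℕ) (hK : 1 ≤ K) : ∀ e0, e0 < 26 + 14 * K → ∃ c : ℕ → Fin 3,
    ∀ e, e < 26 + 14 * K → e ≠ e0 → c (fs K e) ≠ c (ft K e) := by
  intro e0 h0
  rcases edge_cases K e0 h0 with h | ⟨j, a, hj, ha, rfl⟩ | ⟨a, ha, rfl⟩
  · have key : ∀ e0, e0 < 24 → (∀ e, e < 24 → e ≠ e0 →
        rc (capD.getD e0 []) (rd bsL e) ≠ rc (capD.getD e0 []) (rd btL e)) ∧
        hexL.map (rc (capD.getD e0 [])) ∈ allP zpat := by decide +kernel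
    obtain ⟨k1, k2⟩ := key e0 h
    obtain ⟨d, _, hd, h1, h2⟩ := in_step _ k2
    obtain ⟨c2, p2, q2⟩ := col_perm
      (add_in (j := 0) (by omega) d _ hd rfl (in_col K (K - 1) (0 + 1) (by omega) _ h2)) h1
    obtain ⟨c, g1, g2⟩ := glue (i := 0) (c1 := rc (capD.getD e0 [])) (c2 := c2) (by
      rw [q2]; rfl)
    refine ⟨c, fun e he hne => glue_edges (i := 0) (D1 := fun e => e < 24 ∧ e ≠ e0)
      (Nat.zero_le K) g1 g2 (fun e h => h.1) (fun e h => h) ?_ p2 e ?_⟩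
    · intro e h
      rw [(f_cap K e h.1).1, (f_cap K e h.1).2]
      exact k1 e h.1 h.2
    · by_cases h : e < 24
      · exact Or.inl ⟨h, hne⟩
      · exact Or.inr ⟨by omega, he⟩
  · have key : ∀ a, a < 14 → (∀ b, b < 14 → b ≠ a →
        rc (layD.getD a []) (rd lsL b) ≠ rc (layD.getD a []) (rd ltL b)) ∧
        hexL.map (rc (layD.getD a [])) ∈ allP xpat ∧
        hexL2.map (rc (layD.getD a [])) ∈ allP ypat := by decide +kernel
    obtain ⟨k1, k2, k3⟩ := key a ha
    obtain ⟨c1, p1, q1⟩ := add_out hj _ _ (fun b => b ≠ a) k1 rfl (out_col K j (by omega) _ k2)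
    obtain ⟨c2, p2, q2⟩ := in_col K (K - (j + 1)) (j + 1) (by omega) _ k3
    obtain ⟨c, g1, g2⟩ := glue (i := j + 1) (c1 := c1) (c2 := c2) (by rw [q1, q2])
    refine ⟨c, fun e he hne => glue_edges hj g1 g2 ?_ (fun e h => h) p1 p2 e ?_⟩
    · intro e h; omega
    · by_cases h : e < 24 + 14 * (j + 1)
      · refine Or.inl ?_
        by_cases h' : e < 24 + 14 * j
        · exact Or.inl h'
        · exact Or.inr ⟨by omega, h, by omega⟩
      · exact Or.inr ⟨by omega, he⟩
  · have key : ∀ a, a < 2 → ∃ p ∈ allP xpat, hexL.map (fc p) = p ∧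
      ∀ b, b < 2 → b ≠ a → fc p (rd [4, 4] b) ≠ fc p (rd [11, 10] b) := by decide +kernel
    obtain ⟨p, hp, h1, h2⟩ := key a ha
    obtain ⟨c2, p2, q2⟩ := fin_col K p (fun b => b ≠ a) h1 h2
    obtain ⟨c1, p1, q1⟩ := out_col K K le_rfl p hp
    obtain ⟨c, g1, g2⟩ := glue (i := K) (c1 := c1) (c2 := c2) (by rw [q1, q2])
    refine ⟨c, fun e he hne => glue_edges le_rfl g1 g2 (fun e h => h) (fun e h => ⟨h.1, h.2.1⟩)
      p1 p2 e ?_⟩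
    by_cases h : e < 24 + 14 * K
    · exact Or.inl h
    · exact Or.inr ⟨by omega, he, by omega⟩

theorem case_more (K : ℕ) (hK : 1 ≤ K) : ∃ (V : Type) (_ : Fintype V) (G : SimpleGraph V),
      IsPlanar G ∧
      Fintype.card V = 6 * K + 13 ∧
      G.edgeSet.ncard = 26 + 14 * K ∧
      (¬ ∃ c : V → Fin 3, ∀ x y, G.Adj x y → c x ≠ c y) ∧
      (∀ e ∈ G.edgeSet,
        ∃ c : V → Fin 3, ∀ x y, (G.deleteEdges {e}).Adj x y → c x ≠ c y) := by
  obtain ⟨L, H⟩ := fam_planar K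
  exact wrap (f_bound K) (f_ne K) H (fam_nc K) (fam_cr K hK)

end FC

/-- for every positive `k` there is a planar 4-critical graph with
`6k+7` vertices and `14k+12` edges. -/
theorem exists_four_critical_planar (k : ℕ) (hk : 1 ≤ k) :
    ∃ (V : Type) (_ : Fintype V) (G : SimpleGraph V),
      IsPlanar G ∧
      Fintype.card V = 6 * k + 7 ∧
      G.edgeSet.ncard = 14 * k + 12 ∧
      (¬ ∃ c : V → Fin 3, ∀ x y, G.Adj x y → c x ≠ c y) ∧
      (∀ e ∈ G.edgeSet,
        ∃ c : V → Fin 3, ∀ x y, (G.deleteEdges {e}).Adj x y → c x ≠ c y) := by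
  obtain rfl | ⟨K, hK, rfl⟩ : k = 1 ∨ ∃ K, 1 ≤ K ∧ k = K + 1 := by
    by_cases h : k = 1
    · exact Or.inl h
    · exact Or.inr ⟨k - 1, by omega, by omega⟩
  · exact FC.case_one
  · have h1 : 6 * (K + 1) + 7 = 6 * K + 13 := by omega
    have h2 : 14 * (K + 1) + 12 = 26 + 14 * K := by omega
    rw [h1, h2]
    exact FC.case_more K hK
end

section
/- For every ε > 0 there exists a 4-critical planar graph G with |E(G)| / |V(G)| > 7/3 − ε; consequently, the supremum of edge densities |E(G)|/|V(G)| over all 4-critical planar graphs is at least 7/3. -/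
open SimpleGraph

namespace FourCrit

/-! ### A mod 2 certificate of planarity -/

section cert
variable {V : Type*} {G : SimpleGraph V}

/-- Sum of `x` along a walk. -/
def wsum (x : V → V → V → ZMod 2) : ∀ {a b : V}, G.Walk a b → V → ZMod 2
  | _, _, .nil, _ => 0
  | a, _, .cons (v := b) _ w, v => x a b v + wsum x w v

/-- The certificate: the van Kampen obstruction vanishes. -/
def Cert (G : SimpleGraph V) (L : V → V → ZMod 2) (x : V → V → V → ZMod 2) : Prop :=
  ∀ a b c d, G.Adj a b → G.Adj c d → a ≠ c → a ≠ d → b ≠ c → b ≠ d →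
    x a b c + x a b d + x c d a + x c d b = L a c + L a d + L b c + L b d

theorem two0 : (2 : ZMod 2) = 0 := by decide

theorem edge_walk {L : V → V → ZMod 2} {x : V → V → V → ZMod 2} (h : Cert G L x) {a b : V}
    (hab : G.Adj a b) : ∀ {q q' : V} (Q : G.Walk q q'), (∀ v ∈ Q.support, a ≠ v ∧ b ≠ v) →
    x a b q + x a b q' + wsum x Q a + wsum x Q b = L a q + L a q' + L b q + L b q'
  | _, _, .nil, _ => by
      simp only [wsum]
      linear_combination (x a b _ - L a _ - L b _) * two0
  | q, q', .cons (v := r) e w, hQ => by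
      have ih := edge_walk h hab w (fun v hv => hQ v (by simp [hv]))
      have h1 := hQ q (by simp)
      have h2 := hQ r (by simp)
      have := h a b q r hab e h1.1 h2.1 h1.2 h2.2
      simp only [wsum]
      linear_combination ih + this - (x a b r - L a r - L b r) * two0

theorem walk_walk {L : V → V → ZMod 2} {x : V → V → V → ZMod 2} (h : Cert G L x)
    {q q' : V} (Q : G.Walk q q') : ∀ {p p' : V} (P : G.Walk p p'),
    (∀ u ∈ P.support, ∀ v ∈ Q.support, u ≠ v) →
    wsum x P q + wsum x P q' + wsum x Q p + wsum x Q p' = L p q + L p q' + L p' q + L p' q'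
  | _, _, .nil, _ => by
      simp only [wsum]
      linear_combination (wsum x Q _ - L _ q - L _ q') * two0
  | p, p', .cons (v := r) e w, hP => by
      have ih := walk_walk h Q w (fun v hv => hP v (by simp [hv]))
      have := edge_walk h e Q (fun v hv => ⟨hP p (by simp) v hv, hP r (by simp) v hv⟩)
      simp only [wsum]
      linear_combination ih + this - (wsum x Q r - L r q - L r q') * two0

theorem exists_walk_in {S : Set V} (hS : (G.induce S).Connected) {a b : V} (ha : a ∈ S)
    (hb : b ∈ S) : ∃ w : G.Walk a b, ∀ v ∈ w.support, v ∈ S := by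
  obtain ⟨w⟩ := hS.preconnected ⟨a, ha⟩ ⟨b, hb⟩
  have key : ∀ v ∈ (w.map (SimpleGraph.Embedding.induce S).toHom).support, v ∈ S := by
    intro v hv
    rw [SimpleGraph.Walk.support_map] at hv
    obtain ⟨y, _, rfl⟩ := List.mem_map.1 hv
    exact y.2
  exact ⟨w.map (SimpleGraph.Embedding.induce S).toHom, key⟩

theorem minor_cert {α : Type*} {H : SimpleGraph α} {L : V → V → ZMod 2}
    {x : V → V → V → ZMod 2} (hL : ∀ a b, a ≠ b → L a b + L b a = 1) (h : Cert G L x)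
    (hm : IsMinor H G) : ∃ (L' : α → α → ZMod 2) (x' : α → α → α → ZMod 2),
      (∀ a b, a ≠ b → L' a b + L' b a = 1) ∧ Cert H L' x' := by
  obtain ⟨φ, hne, hc, hd, ha⟩ := hm
  choose r hr using hne
  have hw : ∀ a b, H.Adj a b → ∃ w : G.Walk (r a) (r b), ∀ v ∈ w.support, v ∈ φ a ∨ v ∈ φ b := by
    intro a b hab
    obtain ⟨p, hp, q, hq, hpq⟩ := ha a b hab
    obtain ⟨w1, h1⟩ := exists_walk_in (hc a) (hr a) hp
    obtain ⟨w2, h2⟩ := exists_walk_in (hc b) hq (hr b)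
    refine ⟨w1.append (.cons hpq w2), ?_⟩
    intro v hv
    rw [SimpleGraph.Walk.mem_support_append_iff] at hv
    rcases hv with hv | hv
    · exact Or.inl (h1 v hv)
    · rw [SimpleGraph.Walk.support_cons, List.mem_cons] at hv
      rcases hv with rfl | hv
      · exact Or.inl hp
      · exact Or.inr (h2 v hv)
  have hdis : ∀ a b, a ≠ b → ∀ u ∈ φ a, ∀ v ∈ φ b, u ≠ v := by
    intro a b hab u hu v hv huv
    subst huv
    exact Set.disjoint_left.1 (hd hab) hu hv
  choose w hw using hw
  classical
  refine ⟨fun a b => L (r a) (r b),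
    fun a b c => if hab : H.Adj a b then wsum x (w a b hab) (r c) else 0, ?_, ?_⟩
  · intro a b hab
    exact hL _ _ (hdis a b hab _ (hr a) _ (hr b))
  · intro a b c d hab hcd hac had hbc hbd
    simp only [hab, hcd, dif_pos]
    apply walk_walk h
    intro u hu v hv
    rcases hw a b hab u hu with hu | hu <;> rcases hw c d hcd v hv with hv | hv
    · exact hdis a c hac u hu v hv
    · exact hdis a d had u hu v hv
    · exact hdis b c hbc u hu v hv
    · exact hdis b d hbd u hu v hv

theorem no_cert_K5 (L : Fin 5 → Fin 5 → ZMod 2) (x : Fin 5 → Fin 5 → Fin 5 → ZMod 2)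
    (hL : ∀ a b, a ≠ b → L a b + L b a = 1) (h : Cert (completeGraph (Fin 5)) L x) : False := by
  have E : ∀ a b c d : Fin 5, a ≠ b → c ≠ d → a ≠ c → a ≠ d → b ≠ c → b ≠ d →
      x a b c + x a b d + x c d a + x c d b = L a c + L a d + L b c + L b d := by
    intro a b c d h1 h2 h3 h4 h5 h6
    exact h a b c d h1 h2 h3 h4 h5 h6
  have key : (1 : ZMod 2) = 0 := by linear_combination (E 0 1 2 3 (by decide) (by decide)
      (by decide) (by decide) (by decide) (by decide) + E 0 1 2 4 (by decide) (by decide) (by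
      decide) (by decide) (by decide) (by decide) + E 0 1 3 4 (by decide) (by decide) (by
      decide) (by decide) (by decide) (by decide) + E 0 2 1 3 (by decide) (by decide) (by
      decide) (by decide) (by decide) (by decide) + E 0 2 1 4 (by decide) (by decide) (by
      decide) (by decide) (by decide) (by decide) + E 0 2 3 4 (by decide) (by decide) (by
      decide) (by decide) (by decide) (by decide) + E 0 3 1 2 (by decide) (by decide) (by
      decide) (by decide) (by decide) (by decide) + E 0 3 1 4 (by decide) (by decide) (by
      decide) (by decide) (by decide) (by decide) + E 0 3 2 4 (by decide) (by decide) (by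
      decide) (by decide) (by decide) (by decide) + E 0 4 1 2 (by decide) (by decide) (by
      decide) (by decide) (by decide) (by decide) + E 0 4 1 3 (by decide) (by decide) (by
      decide) (by decide) (by decide) (by decide) + E 0 4 2 3 (by decide) (by decide) (by
      decide) (by decide) (by decide) (by decide) + E 1 2 3 4 (by decide) (by decide) (by
      decide) (by decide) (by decide) (by decide) + E 1 3 2 4 (by decide) (by decide) (by
      decide) (by decide) (by decide) (by decide) + E 1 4 2 3 (by decide) (by decide) (by
      decide) (by decide) (by decide) (by decide)) + (2 * hL 2 1 (by decide) + 2 * hL 3 1 (by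
      simp) + 3 * hL 3 2 (by decide) + 2 * hL 4 1 (by decide) + 3 * hL 4 2 (by decide) + 3 * hL 4 3
      (by decide)) + (8 - (1 * x 0 1 2 + 1 * x 0 1 3 + 1 * x 2 3 0 + 1 * x 2 3 1 + 1 * x 0 1 4 + 1
      * x 2 4 0 + 1 * x 2 4 1 + 1 * x 3 4 0 + 1 * x 3 4 1 + 1 * x 0 2 1 + 1 * x 0 2 3 + 1 * x 1
      3 0 + 1 * x 1 3 2 + 1 * x 0 2 4 + 1 * x 1 4 0 + 1 * x 1 4 2 + 1 * x 3 4 2 + 1 * x 0 3 1 +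
      1 * x 0 3 2 + 1 * x 1 2 0 + 1 * x 1 2 3 + 1 * x 0 3 4 + 1 * x 1 4 3 + 1 * x 2 4 3 + 1 * x
      0 4 1 + 1 * x 0 4 2 + 1 * x 1 2 4 + 1 * x 0 4 3 + 1 * x 1 3 4 + 1 * x 2 3 4) + ((3) * L 0
      2 + (3) * L 0 3 + (1) * L 1 2 + (1) * L 1 3 + (3) * L 0 4 + (1) * L 1 4 + (3) * L 0 1)) *
      two0
  exact absurd key (by decide)

theorem no_cert_K33 (L : Fin 3 ⊕ Fin 3 → Fin 3 ⊕ Fin 3 → ZMod 2)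
    (x : Fin 3 ⊕ Fin 3 → Fin 3 ⊕ Fin 3 → Fin 3 ⊕ Fin 3 → ZMod 2)
    (hL : ∀ a b, a ≠ b → L a b + L b a = 1)
    (h : Cert (completeBipartiteGraph (Fin 3) (Fin 3)) L x) : False := by
  have E : ∀ a b c d : Fin 3, a ≠ c → b ≠ d →
      x (.inl a) (.inr b) (.inl c) + x (.inl a) (.inr b) (.inr d) +
        x (.inl c) (.inr d) (.inl a) + x (.inl c) (.inr d) (.inr b) =
      L (.inl a) (.inl c) + L (.inl a) (.inr d) + L (.inr b) (.inl c) + L (.inr b) (.inr d) := by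
    intro a b c d h1 h2
    exact h _ _ _ _ (by simp) (by simp) (by simpa using h1) (by simp) (by simp) (by simpa using h2)
  have key : (1 : ZMod 2) = 0 := by linear_combination (E 0 0 1 1 (by decide) (by decide) +
      E 0 0 1 2 (by decide) (by decide) + E 0 0 2 1 (by decide) (by decide) + E 0 0 2 2 (by
      decide) (by decide) + E 0 1 1 0 (by decide) (by decide) + E 0 1 1 2 (by decide) (by
      decide) + E 0 1 2 0 (by decide) (by decide) + E 0 1 2 2 (by decide) (by decide) + E 0 2 1
      0 (by decide) (by decide) + E 0 2 1 1 (by decide) (by decide) + E 0 2 2 0 (by decide) (by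
      decide) + E 0 2 2 1 (by decide) (by decide) + E 1 0 2 1 (by decide) (by decide) + E 1 0 2
      2 (by decide) (by decide) + E 1 1 2 0 (by decide) (by decide) + E 1 1 2 2 (by decide) (by
      decide) + E 1 2 2 0 (by decide) (by decide) + E 1 2 2 1 (by decide) (by decide)) + (2 * hL
      (.inr 0) (.inl 1) (by simp) + 4 * hL (.inr 0) (.inl 2) (by simp) + 2 * hL (.inr 1) (.inl
      1) (by simp) + 3 * hL (.inr 1) (.inr 0) (by simp) + 4 * hL (.inr 1) (.inl 2) (by simp) + 2
      * hL (.inr 2) (.inl 1) (by simp) + 3 * hL (.inr 2) (.inr 0) (by simp) + 3 * hL (.inr 2)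
      (.inr 1) (by simp) + 4 * hL (.inr 2) (.inl 2) (by simp)) + (14 - (1 * x (.inl 0) (.inr 0)
      (.inl 1) + 1 * x (.inl 0) (.inr 0) (.inr 1) + 1 * x (.inl 1) (.inr 1) (.inl 0) + 1 * x
      (.inl 1) (.inr 1) (.inr 0) + 1 * x (.inl 0) (.inr 0) (.inr 2) + 1 * x (.inl 1) (.inr 2)
      (.inl 0) + 1 * x (.inl 1) (.inr 2) (.inr 0) + 1 * x (.inl 0) (.inr 0) (.inl 2) + 1 * x
      (.inl 2) (.inr 1) (.inl 0) + 1 * x (.inl 2) (.inr 1) (.inr 0) + 1 * x (.inl 2) (.inr 2)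
      (.inl 0) + 1 * x (.inl 2) (.inr 2) (.inr 0) + 1 * x (.inl 0) (.inr 1) (.inl 1) + 1 * x
      (.inl 0) (.inr 1) (.inr 0) + 1 * x (.inl 1) (.inr 0) (.inl 0) + 1 * x (.inl 1) (.inr 0)
      (.inr 1) + 1 * x (.inl 0) (.inr 1) (.inr 2) + 1 * x (.inl 1) (.inr 2) (.inr 1) + 1 * x
      (.inl 0) (.inr 1) (.inl 2) + 1 * x (.inl 2) (.inr 0) (.inl 0) + 1 * x (.inl 2) (.inr 0)
      (.inr 1) + 1 * x (.inl 2) (.inr 2) (.inr 1) + 1 * x (.inl 0) (.inr 2) (.inl 1) + 1 * x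
      (.inl 0) (.inr 2) (.inr 0) + 1 * x (.inl 1) (.inr 0) (.inr 2) + 1 * x (.inl 0) (.inr 2)
      (.inr 1) + 1 * x (.inl 1) (.inr 1) (.inr 2) + 1 * x (.inl 0) (.inr 2) (.inl 2) + 1 * x
      (.inl 2) (.inr 0) (.inr 2) + 1 * x (.inl 2) (.inr 1) (.inr 2) + 1 * x (.inl 1) (.inr 0)
      (.inl 2) + 1 * x (.inl 2) (.inr 1) (.inl 1) + 1 * x (.inl 2) (.inr 2) (.inl 1) + 1 * x
      (.inl 1) (.inr 1) (.inl 2) + 1 * x (.inl 2) (.inr 0) (.inl 1) + 1 * x (.inl 1) (.inr 2)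
      (.inl 2)) + ((3) * L (.inl 0) (.inl 1) + (2) * L (.inl 0) (.inr 1) + (2) * L (.inl 0)
      (.inr 2) + (3) * L (.inl 0) (.inl 2) + (-2) * L (.inl 2) (.inr 0) + (2) * L (.inl 0) (.inr
      0) + (-2) * L (.inl 2) (.inr 1) + (-2) * L (.inl 2) (.inr 2) + (3) * L (.inl 1) (.inl 2)))
      * two0
  exact absurd key (by decide)

theorem planar_of_cert {L : V → V → ZMod 2}
    {x : V → V → V → ZMod 2} (hL : ∀ a b, a ≠ b → L a b + L b a = 1) (h : Cert G L x) :
    IsPlanar G := by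
  constructor
  · intro hm
    obtain ⟨L', x', h1, h2⟩ := minor_cert hL h hm
    exact no_cert_K5 L' x' h1 h2
  · intro hm
    obtain ⟨L', x', h1, h2⟩ := minor_cert hL h hm
    exact no_cert_K33 L' x' h1 h2

end cert

/-! ### The graph -/

section graph

def GI : List (ℕ × ℕ) := [(0, 4), (1, 5), (1, 4), (2, 5)]
def GX : List (ℕ × ℕ) := [(0, 5), (0, 1), (1, 3), (1, 2), (2, 4), (3, 4), (3, 1), (4, 2), (5, 3), (5, 0)]
def LI : List (ℕ × ℕ) := [(0, 4), (1, 4), (1, 5)]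
def LX : List (ℕ × ℕ) := [(5, 3), (5, 4), (0, 5), (5, 0), (1, 2), (4, 1), (1, 3), (0, 1)]
def RI : List (ℕ × ℕ) := [(1, 4), (3, 5), (2, 3), (1, 5)]
def RX : List (ℕ × ℕ) := [(5, 5), (1, 3), (2, 4), (5, 1), (4, 2), (0, 5), (3, 4), (1, 2)]
def AL : List ℕ := [14, 17, 22, 25, 105, 125, 161, 174, 202, 238, 251, 295, 323, 353, 359, 369, 375, 405, 433, 477, 490, 526, 554, 567, 603, 623, 703, 706, 711, 714]
def RL : List ℕ := [40, 41, 43, 49, 52, 68, 71, 77, 79, 80, 96, 123, 132, 150, 159, 183, 201, 210, 228, 237, 250, 268, 277, 304, 322, 324, 326, 330, 342, 348, 380, 386, 398, 402, 404, 406, 424, 451, 460, 478, 491, 500, 518, 527, 545, 569, 578, 596, 605, 632, 648, 649, 651, 657, 660, 676, 679, 685, 687, 688]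
def AM : ℕ := 97333554722251103377987276827622593520707687822230688440306486516020379674481678520608499319865346010716211028304484529559243205106381120742878238224607321846482714442670883488264897986901010032076662384859424112640
def wLI : List (ℕ × ℕ) := [(3, 386), (84, 386), (81, 404)]
def wLX : List (ℕ × ℕ) := [(89, 326), (4, 79), (4, 386), (4, 159), (89, 451), (5, 380), (87, 386), (5, 386)]
def wRI : List (ℕ × ℕ) := [(375, 513), (405, 630), (405, 603), (359, 189)]
def wRX : List (ℕ × ℕ) := [(125, 30), (526, 48), (359, 33), (623, 132), (295, 33), (375, 33), (359, 114), (295, 51)]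
def wGX : List (ℕ × ℕ) := [(17, 688), (125, 277), (105, 386), (125, 451), (105, 679), (14, 77), (14, 478), (161, 40), (125, 406), (14, 237)]
def wGI : List (ℕ × ℕ × ℕ) := [(714, 489, 348), (703, 117, 322), (623, 129, 304), (567, 696, 250)]
def wGL : List (ℕ × ℕ × ℕ) := [(651, 489, 348), (332, 171, 688), (651, 570, 330), (251, 165, 386)]
def wGR : List (ℕ × ℕ × ℕ) := [(714, 489, 342), (323, 90, 696), (251, 93, 669), (323, 333, 693)]
def nL : List ℕ := [4, 5, 7, 8, 87, 89, 165, 166, 250, 251, 324, 326, 330, 332, 405, 406, 490, 491, 567, 569, 648, 649, 651, 652]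
def nR : List ℕ := [33, 48, 51, 57, 66, 69, 114, 132, 150, 210, 219, 228, 258, 267, 303, 342, 378, 384, 387, 423, 459, 468, 498, 507, 516, 576, 594, 612, 657, 678]
def XM : ℕ := 55307063513406314332369858922286621171586622941102726204193185864530070241507343356603787887560799184552918080664234115499219014707145185788588064659454437461699719293819398199908573629104620776075189505068821814785260474110416898051019596376575746414713674028444085109457596448768


/-- The colour of vertex `u` in a block colouring with code `n`. -/
def dig (n u : ℕ) : ℕ := n / 3 ^ u % 3

def okI (I : List (ℕ × ℕ)) (n : ℕ) : Bool := I.all fun e => dig n e.1 != dig n e.2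
def okX (X : List (ℕ × ℕ)) (n m : ℕ) : Bool := X.all fun e => dig n e.1 != dig m e.2

theorem okI_iff {I : List (ℕ × ℕ)} {n : ℕ} :
    okI I n = true ↔ ∀ u v, (u, v) ∈ I → dig n u ≠ dig n v := by
  simp [okI, List.all_eq_true]

theorem okX_iff {I : List (ℕ × ℕ)} {n m : ℕ} :
    okX I n m = true ↔ ∀ u v, (u, v) ∈ I → dig n u ≠ dig m v := by
  simp [okX, List.all_eq_true]

/-- The list without one edge. -/
def del (X : List (ℕ × ℕ)) (e : ℕ × ℕ) : List (ℕ × ℕ) := X.filter fun f => f != e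

theorem mem_del {X : List (ℕ × ℕ)} {e f : ℕ × ℕ} : f ∈ del X e ↔ f ∈ X ∧ f ≠ e := by
  simp [del, List.mem_filter]

/-- Edges inside block `i`. -/
def inn (K i : ℕ) : List (ℕ × ℕ) := if i = 0 then LI else if i < K then GI else RI
/-- Edges from block `i` to block `i + 1`. -/
def crs (K i : ℕ) : List (ℕ × ℕ) :=
  if i = 0 then LX else if i + 1 < K then GX else if i + 1 = K then RX else []

def D (K i u j v : ℕ) : Prop :=
  (j = i ∧ (u, v) ∈ inn K i) ∨ (j = i + 1 ∧ (u, v) ∈ crs K i)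

theorem inn_lt {K i u v : ℕ} (h : (u, v) ∈ inn K i) : u < v ∧ v < 6 := by
  unfold inn at h
  have h1 : ∀ e ∈ LI, e.1 < e.2 ∧ e.2 < 6 := by decide
  have h2 : ∀ e ∈ GI, e.1 < e.2 ∧ e.2 < 6 := by decide
  have h3 : ∀ e ∈ RI, e.1 < e.2 ∧ e.2 < 6 := by decide
  split_ifs at h
  · exact h1 _ h
  · exact h2 _ h
  · exact h3 _ h

theorem D_lt {K i u j v : ℕ} (hu : u < 6) (h : D K i u j v) : 6 * i + u < 6 * j + v := by
  rcases h with ⟨rfl, h⟩ | ⟨rfl, h⟩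
  · have := inn_lt h
    omega
  · omega

/-- The graph. -/
def Gr (K : ℕ) : SimpleGraph (Fin (K + 1) × Fin 6) where
  Adj p q := D K p.1 p.2 q.1 q.2 ∨ D K q.1 q.2 p.1 p.2
  symm := ⟨fun _ _ h => h.symm⟩
  loopless := ⟨fun p h => by
    have h : D K p.1 p.2 p.1 p.2 := by simpa using h
    exact lt_irrefl _ (D_lt p.2.2 h)⟩

/-! #### Planarity -/

def xd (i u v s j w : ℕ) : Bool :=
  if j < i then false else
    XM.testBit ((u + 6 * v + 36 * s) * 13 + if j = i then w else if j = i + 1 then 6 + w else 12)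

def ltb (i u j w : ℕ) : Bool := decide (6 * i + u < 6 * j + w)

theorem xd_shift (t i u v s j w : ℕ) : xd (i + t) u v s (j + t) w = xd i u v s j w := by
  have h1 : (j + t < i + t) = (j < i) := by simp
  have h2 : (j + t = i + t) = (j = i) := by simp
  have h3 : (j + t = i + t + 1) = (j = i + 1) := by apply propext; omega
  simp only [xd, h1, h2, h3]

theorem ltb_shift (t i u j w : ℕ) : ltb (i + t) u (j + t) w = ltb i u j w := by
  unfold ltb
  congr 1
  apply propext
  omega

/-- The equation for the edge `(i,u) - (i+s,v)` and `(j,u') - (j+s',v')`. -/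
def eqn (i u v s j u' v' s' : ℕ) : Bool :=
  (xd i u v s j u' ^^ xd i u v s (j + s') v' ^^ xd j u' v' s' i u ^^ xd j u' v' s' (i + s) v) ==
  (ltb i u j u' ^^ ltb i u (j + s') v' ^^ ltb (i + s) v j u' ^^ ltb (i + s) v (j + s') v')

theorem eqn_shift (t i u v s j u' v' s' : ℕ) :
    eqn (i + t) u v s (j + t) u' v' s' = eqn i u v s j u' v' s' := by
  unfold eqn
  rw [show j + t + s' = j + s' + t by omega, show i + t + s = i + s + t by omega]
  simp only [xd_shift, ltb_shift]

def chk (d : ℕ) (e f : ℕ × ℕ × ℕ) : Bool :=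
  (0 == d && e.1 == f.1) || (0 == d + f.2.2 && e.1 == f.2.1) ||
  (e.2.2 == d && e.2.1 == f.1) || (e.2.2 == d + f.2.2 && e.2.1 == f.2.1) ||
  eqn 0 e.1 e.2.1 e.2.2 d f.1 f.2.1 f.2.2

def tag (I X : List (ℕ × ℕ)) : List (ℕ × ℕ × ℕ) :=
  I.map (fun e => (e.1, e.2, 0)) ++ X.map (fun e => (e.1, e.2, 1))

def chkAll (d : ℕ) (A B : List (ℕ × ℕ × ℕ)) : Bool := A.all fun e => B.all fun f => chk d e f

theorem mem_tag_D {K i u j v : ℕ} (h : D K i u j v) :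
    ∃ s, s ≤ 1 ∧ j = i + s ∧ (u, v, s) ∈ tag (inn K i) (crs K i) := by
  rcases h with ⟨rfl, h⟩ | ⟨rfl, h⟩
  · exact ⟨0, by omega, rfl, by simp [tag, h]⟩
  · exact ⟨1, by omega, rfl, by simp [tag, h]⟩

theorem chk00 : chkAll 0 (tag LI LX) (tag LI LX) = true := by decide +kernel
theorem chk11 : chkAll 0 (tag GI GX) (tag GI GX) = true := by decide +kernel
theorem chk22 : chkAll 0 (tag GI RX) (tag GI RX) = true := by decide +kernel
theorem chk33 : chkAll 0 (tag RI []) (tag RI []) = true := by decide +kernel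
theorem chk01 : chkAll 1 (tag LI LX) (tag GI GX) = true := by decide +kernel
theorem chk11' : chkAll 1 (tag GI GX) (tag GI GX) = true := by decide +kernel
theorem chk12 : chkAll 1 (tag GI GX) (tag GI RX) = true := by decide +kernel
theorem chk23 : chkAll 1 (tag GI RX) (tag RI []) = true := by decide +kernel

theorem chk_same {K i : ℕ} (hK : 4 ≤ K) (hi : i ≤ K) :
    chkAll 0 (tag (inn K i) (crs K i)) (tag (inn K i) (crs K i)) = true := by
  by_cases h0 : i = 0
  · simpa [inn, crs, h0] using chk00
  by_cases h1 : i + 1 < K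
  · simpa [inn, crs, h0, h1, show i < K by omega] using chk11
  by_cases h2 : i + 1 = K
  · simpa [inn, crs, h0, h1, h2, show i < K by omega] using chk22
  · simpa [inn, crs, h0, h1, h2, show ¬ i < K by omega] using chk33

theorem chk_next {K i : ℕ} (hK : 4 ≤ K) (hi : i + 1 ≤ K) :
    chkAll 1 (tag (inn K i) (crs K i)) (tag (inn K (i + 1)) (crs K (i + 1))) = true := by
  by_cases h0 : i = 0
  · subst h0
    simpa [inn, crs, show 1 < K by omega, show 2 < K by omega] using chk01
  by_cases h1 : i + 1 + 1 < K
  · simpa [inn, crs, h0, h1, show i < K by omega, show i + 1 < K by omega] using chk11'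
  by_cases h2 : i + 1 + 1 = K
  · simpa [inn, crs, h0, h1, h2, show i < K by omega, show i + 1 < K by omega] using chk12
  · simpa [inn, crs, h0, h1, h2, show i < K by omega, show ¬ i + 1 < K by omega,
      show i + 1 = K by omega, show ¬ K = 0 by omega] using chk23

theorem chk_eqn {d i u v s u' v' s' : ℕ} (h : chk d (u, v, s) (u', v', s') = true)
    (h1 : ¬ (i = i + d ∧ u = u')) (h2 : ¬ (i = i + d + s' ∧ u = v'))
    (h3 : ¬ (i + s = i + d ∧ v = u')) (h4 : ¬ (i + s = i + d + s' ∧ v = v')) :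
    eqn i u v s (i + d) u' v' s' = true := by
  have := eqn_shift i 0 u v s d u' v' s'
  rw [Nat.zero_add, Nat.add_comm d i] at this
  rw [this]
  simp only [chk, Bool.or_eq_true, Bool.and_eq_true, beq_iff_eq] at h
  rcases h with (((h | h) | h) | h) | h
  · exact absurd ⟨by omega, h.2⟩ h1
  · exact absurd ⟨by omega, h.2⟩ h2
  · exact absurd ⟨by omega, h.2⟩ h3
  · exact absurd ⟨by omega, h.2⟩ h4
  · exact h

theorem eqn_le {K i u v s j u' v' s' : ℕ} (hK : 4 ≤ K) (hij : i ≤ j) (hj : j ≤ K)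
    (hs : s ≤ 1) (hu : u < 6) (hv : v < 6)
    (he : (u, v, s) ∈ tag (inn K i) (crs K i)) (hf : (u', v', s') ∈ tag (inn K j) (crs K j))
    (h1 : ¬ (i = j ∧ u = u')) (h2 : ¬ (i = j + s' ∧ u = v'))
    (h3 : ¬ (i + s = j ∧ v = u')) (h4 : ¬ (i + s = j + s' ∧ v = v')) :
    eqn i u v s j u' v' s' = true := by
  obtain ⟨d, rfl⟩ := Nat.exists_eq_add_of_le hij
  by_cases hd : d = 0
  · subst hd
    refine chk_eqn ?_ h1 h2 h3 h4
    exact List.all_eq_true.1 (List.all_eq_true.1 (chk_same hK hj) _ he) _ hf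
  by_cases hd : d = 1
  · subst hd
    refine chk_eqn ?_ h1 h2 h3 h4
    exact List.all_eq_true.1 (List.all_eq_true.1 (chk_next hK hj) _ he) _ hf
  have e1 : xd i u v s (i + d) u' = xd i u v s (i + d + s') v' := by
    simp [xd, show ¬ i + d < i by omega, show ¬ i + d + s' < i by omega,
      show ¬ i + d = i by omega, show ¬ i + d + s' = i by omega,
      show ¬ i + d = i + 1 by omega, show ¬ i + d + s' = i + 1 by omega,
      show ¬ d = 0 by omega, show ¬ d = 1 by omega]
  have e2 : xd (i + d) u' v' s' i u = false := by simp [xd, show 0 < d by omega]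
  have e3 : xd (i + d) u' v' s' (i + s) v = false := by
    simp only [xd]
    rw [if_pos (by omega)]
  have l1 : ltb i u (i + d) u' = true := by simp only [ltb, decide_eq_true_eq]; omega
  have l2 : ltb i u (i + d + s') v' = true := by simp only [ltb, decide_eq_true_eq]; omega
  have l3 : ltb (i + s) v (i + d) u' = true := by simp only [ltb, decide_eq_true_eq]; omega
  have l4 : ltb (i + s) v (i + d + s') v' = true := by
    simp only [ltb, decide_eq_true_eq]; omega
  simp [eqn, e1, e2, e3, l1, l2, l3, l4]

theorem ltb_not {i u j w : ℕ} (hu : u < 6) (hw : w < 6) (h : ¬ (i = j ∧ u = w)) :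
    ltb j w i u = !ltb i u j w := by
  have : (6 * j + w < 6 * i + u) ↔ ¬ (6 * i + u < 6 * j + w) := by omega
  simp only [ltb, this, decide_not]

theorem eqn_all {K i u v s j u' v' s' : ℕ} (hK : 4 ≤ K) (hi : i ≤ K) (hj : j ≤ K)
    (hs : s ≤ 1) (hs' : s' ≤ 1) (hu : u < 6) (hv : v < 6) (hu' : u' < 6) (hv' : v' < 6)
    (he : (u, v, s) ∈ tag (inn K i) (crs K i)) (hf : (u', v', s') ∈ tag (inn K j) (crs K j))
    (h1 : ¬ (i = j ∧ u = u')) (h2 : ¬ (i = j + s' ∧ u = v'))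
    (h3 : ¬ (i + s = j ∧ v = u')) (h4 : ¬ (i + s = j + s' ∧ v = v')) :
    eqn i u v s j u' v' s' = true := by
  rcases le_total i j with hij | hij
  · exact eqn_le hK hij hj hs hu hv he hf h1 h2 h3 h4
  · have := eqn_le (u := u') (v := v') (s := s') (u' := u) (v' := v) (s' := s) hK hij hi hs' hu' hv'
      hf he (by tauto) (by omega) (by omega) (by omega)
    unfold eqn at this ⊢
    rw [ltb_not hu hu' h1, ltb_not hv hu' h3, ltb_not hu hv' h2, ltb_not hv hv' h4] at this
    revert this
    generalize xd i u v s j u' = a1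
    generalize xd i u v s (j + s') v' = a2
    generalize xd j u' v' s' i u = a3
    generalize xd j u' v' s' (i + s) v = a4
    generalize ltb i u j u' = b1
    generalize ltb i u (j + s') v' = b2
    generalize ltb (i + s) v j u' = b3
    generalize ltb (i + s) v (j + s') v' = b4
    revert a1 a2 a3 a4 b1 b2 b3 b4
    decide

def bz (b : Bool) : ZMod 2 := if b then 1 else 0

theorem bz_xor (a b : Bool) : bz (a ^^ b) = bz a + bz b := by
  cases a <;> cases b <;> decide

def Lz {K : ℕ} (p q : Fin (K + 1) × Fin 6) : ZMod 2 := bz (ltb p.1 p.2 q.1 q.2)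

def xz {K : ℕ} (p q w : Fin (K + 1) × Fin 6) : ZMod 2 :=
  if ltb p.1 p.2 q.1 q.2 then bz (xd p.1 p.2 q.2 (q.1 - p.1) w.1 w.2)
  else bz (xd q.1 q.2 p.2 (p.1 - q.1) w.1 w.2)

theorem ne_pt {K : ℕ} {p q : Fin (K + 1) × Fin 6} (h : p ≠ q) :
    ¬ ((p.1 : ℕ) = q.1 ∧ (p.2 : ℕ) = q.2) := by
  rintro ⟨h1, h2⟩
  exact h (Prod.ext (Fin.ext h1) (Fin.ext h2))

theorem cert_D {K : ℕ} (hK : 4 ≤ K) (a b c d : Fin (K + 1) × Fin 6)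
    (hab : D K a.1 a.2 b.1 b.2) (hcd : D K c.1 c.2 d.1 d.2)
    (h1 : a ≠ c) (h2 : a ≠ d) (h3 : b ≠ c) (h4 : b ≠ d) :
    xz a b c + xz a b d + xz c d a + xz c d b = Lz a c + Lz a d + Lz b c + Lz b d := by
  have l1 : ltb a.1 a.2 b.1 b.2 = true := by
    simpa [ltb] using D_lt a.2.2 hab
  have l2 : ltb c.1 c.2 d.1 d.2 = true := by
    simpa [ltb] using D_lt c.2.2 hcd
  obtain ⟨s, hs, hb, he⟩ := mem_tag_D hab
  obtain ⟨s', hs', hd, hf⟩ := mem_tag_D hcd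
  have ha1 := a.1.2
  have hc1 := c.1.2
  have n1 := ne_pt h1
  have n2 := ne_pt h2
  have n3 := ne_pt h3
  have n4 := ne_pt h4
  rw [hd] at n2 n4
  rw [hb] at n3 n4
  have := eqn_all hK (by omega) (by omega) hs hs' a.2.2 b.2.2 c.2.2 d.2.2 he hf n1 n2 n3 n4
  simp only [eqn, beq_iff_eq] at this
  have := congrArg bz this
  simp only [bz_xor] at this
  rw [hb] at l1
  rw [hd] at l2
  simp only [xz, Lz, if_true, hb, hd, l1, l2, Nat.add_sub_cancel_left]
  simpa only [add_assoc] using this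

theorem xz_symm {K : ℕ} {p q : Fin (K + 1) × Fin 6} (h : p ≠ q) (w : Fin (K + 1) × Fin 6) :
    xz p q w = xz q p w := by
  have := ltb_not p.2.2 q.2.2 (ne_pt h)
  unfold xz
  rw [this]
  cases ltb p.1 p.2 q.1 q.2 <;> simp

theorem cert_Gr {K : ℕ} (hK : 4 ≤ K) : Cert (Gr K) Lz xz := by
  intro a b c d hab hcd h1 h2 h3 h4
  have nab := hab.ne
  have ncd := hcd.ne
  rcases hab with hab | hab <;> rcases hcd with hcd | hcd
  · exact cert_D hK a b c d hab hcd h1 h2 h3 h4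
  · have := cert_D hK a b d c hab hcd h2 h1 h4 h3
    rw [xz_symm ncd, xz_symm ncd]
    linear_combination this
  · have := cert_D hK b a c d hab hcd h3 h4 h1 h2
    rw [xz_symm nab, xz_symm nab]
    linear_combination this
  · have := cert_D hK b a d c hab hcd h4 h3 h2 h1
    rw [xz_symm nab, xz_symm nab, xz_symm ncd, xz_symm ncd]
    linear_combination this

theorem planar_Gr {K : ℕ} (hK : 4 ≤ K) : IsPlanar (Gr K) := by
  refine planar_of_cert (L := Lz) (x := xz) ?_ (cert_Gr hK)
  intro a b hab
  have := ltb_not a.2.2 b.2.2 (ne_pt hab)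
  unfold Lz
  rw [this]
  cases ltb a.1 a.2 b.1 b.2 <;> decide

/-! #### No 3-colouring -/

theorem dig_lt (n u : ℕ) : dig n u < 3 := Nat.mod_lt _ (by norm_num)

/-- The colourings of the left end block, with the unused vertices coloured `0`. -/
def LL : List ℕ := [4, 5, 7, 8, 87, 89, 165, 166, 250, 251, 324, 326, 330, 332, 405, 406, 490, 491, 567, 569, 648, 649, 651, 652]

theorem AM_mem : ∀ a < 729, AM.testBit a = true → a ∈ AL := by decide +kernel

theorem LL_mem : ∀ n < 729, okI LI n = true → n % 9 + 81 * (n / 81) ∈ LL := by decide +kernel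

theorem LL_okX (n m : ℕ) : okX LX (n % 9 + 81 * (n / 81)) m = okX LX n m := by
  have h0 : dig (n % 9 + 81 * (n / 81)) 0 = dig n 0 := by simp only [dig]; omega
  have h1 : dig (n % 9 + 81 * (n / 81)) 1 = dig n 1 := by simp only [dig]; omega
  have h4 : dig (n % 9 + 81 * (n / 81)) 4 = dig n 4 := by simp only [dig]; omega
  have h5 : dig (n % 9 + 81 * (n / 81)) 5 = dig n 5 := by
    have h : (n % 9 + 81 * (n / 81)) / 81 = n / 81 := by omega
    simp only [dig, show 3 ^ 5 = 81 * 3 from rfl, ← Nat.div_div_eq_div_mul, h]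
  simp only [okX, LX, List.all_cons, List.all_nil, h0, h1, h4, h5]

theorem fin_start0 : ∀ m < 729, okI GI m = true → AM.testBit m = false →
    ∀ n ∈ LL, okX LX n m = false := by decide +kernel

theorem fin_step0 : ∀ m < 729, okI GI m = true → AM.testBit m = false →
    ∀ a ∈ AL, okX GX a m = false := by decide +kernel

theorem fin_final0 : ∀ m < 729, okI RI m = true → ∀ a ∈ AL, okX RX a m = false := by
  decide +kernel

theorem fin_start (n : ℕ) (hn : n < 729) (h1 : okI LI n = true) (m : ℕ) (hm : m < 729)
    (h2 : okI GI m = true) (h3 : okX LX n m = true) : AM.testBit m = true := by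
  by_contra h
  have := fin_start0 m hm h2 (by simpa using h) _ (LL_mem n hn h1)
  rw [LL_okX, h3] at this
  cases this

theorem fin_step (a : ℕ) (ha : a < 729) (h1 : AM.testBit a = true) (m : ℕ) (hm : m < 729)
    (h2 : okI GI m = true) (h3 : okX GX a m = true) : AM.testBit m = true := by
  by_contra h
  have := fin_step0 m hm h2 (by simpa using h) a (AM_mem a ha h1)
  rw [h3] at this
  cases this

theorem fin_final (a : ℕ) (ha : a < 729) (h1 : AM.testBit a = true) (m : ℕ) (hm : m < 729)
    (h2 : okI RI m = true) (h3 : okX RX a m = true) : False := by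
  have := fin_final0 m hm h2 a (AM_mem a ha h1)
  rw [h3] at this
  cases this

/-- The code of a block colouring. -/
def enc (c : Fin 6 → Fin 3) : ℕ :=
  c 0 + 3 * (c 1 + 3 * (c 2 + 3 * (c 3 + 3 * (c 4 + 3 * c 5))))

theorem enc_lt (c : Fin 6 → Fin 3) : enc c < 729 := by
  unfold enc
  omega

theorem dig_enc (c : Fin 6 → Fin 3) (u : Fin 6) : dig (enc c) u = c u := by
  fin_cases u <;> simp [dig, enc] <;> omega

theorem no_col {K : ℕ} (hK : 4 ≤ K) (f : ℕ → ℕ) (hf : ∀ i, f i < 729)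
    (hI : ∀ i ≤ K, okI (inn K i) (f i) = true)
    (hX : ∀ i < K, okX (crs K i) (f i) (f (i + 1)) = true) : False := by
  have A : ∀ i, i + 2 ≤ K → AM.testBit (f (i + 1)) = true := by
    intro i
    induction i with
    | zero =>
      intro hi
      have h1 := hI 0 (by omega)
      have h2 := hI 1 (by omega)
      have h3 := hX 0 (by omega)
      simp only [inn, crs, if_true, show ¬ (1 = 0) by omega, if_false,
        show 1 < K by omega] at h1 h2 h3
      exact fin_start _ (hf _) h1 _ (hf _) h2 h3
    | succ i ih =>
      intro hi
      have h2 := hI (i + 1 + 1) (by omega)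
      have h3 := hX (i + 1) (by omega)
      simp only [inn, crs, if_true, show ¬ (i + 1 = 0) by omega, show ¬ (i + 1 + 1 = 0) by omega,
        if_false, show i + 1 + 1 < K by omega] at h2 h3
      exact fin_step _ (hf _) (ih (by omega)) _ (hf _) h2 h3
  obtain ⟨k, rfl⟩ : ∃ k, K = k + 2 := ⟨K - 2, by omega⟩
  have h1 := A k (by omega)
  have h2 := hI (k + 2) (by omega)
  have h3 := hX (k + 1) (by omega)
  simp only [inn, crs, if_true, show ¬ (k + 1 = 0) by omega, show ¬ (k + 2 = 0) by omega,
    if_false, show ¬ k + 2 < k + 2 by omega, show ¬ k + 1 + 1 < k + 2 by omega] at h2 h3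
  exact fin_final _ (hf _) h1 _ (hf _) h2 h3

theorem crs_lt {K i u v : ℕ} (h : (u, v) ∈ crs K i) : u < 6 ∧ v < 6 := by
  unfold crs at h
  have h1 : ∀ e ∈ LX, e.1 < 6 ∧ e.2 < 6 := by decide
  have h2 : ∀ e ∈ GX, e.1 < 6 ∧ e.2 < 6 := by decide
  have h3 : ∀ e ∈ RX, e.1 < 6 ∧ e.2 < 6 := by decide
  split_ifs at h
  · exact h1 _ h
  · exact h2 _ h
  · exact h3 _ h
  · simp at h

theorem not_col {K : ℕ} (hK : 4 ≤ K) :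
    ¬ ∃ c : Fin (K + 1) × Fin 6 → Fin 3, ∀ x y, (Gr K).Adj x y → c x ≠ c y := by
  rintro ⟨c, hc⟩
  refine no_col hK (fun i => enc fun u => c (Fin.ofNat (K + 1) i, u)) (fun i => enc_lt _) ?_ ?_
  · intro i hi
    rw [okI_iff]
    intro u v huv
    have := inn_lt huv
    have e1 := dig_enc (fun u => c (Fin.ofNat (K + 1) i, u)) ⟨u, by omega⟩
    have e2 := dig_enc (fun u => c (Fin.ofNat (K + 1) i, u)) ⟨v, by omega⟩
    simp only at e1 e2
    rw [e1, e2]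
    intro h
    refine hc _ _ ?_ (Fin.ext h)
    left
    left
    simpa [Nat.mod_eq_of_lt (show i < K + 1 by omega)] using huv
  · intro i hi
    rw [okX_iff]
    intro u v huv
    have := crs_lt huv
    have e1 := dig_enc (fun u => c (Fin.ofNat (K + 1) i, u)) ⟨u, by omega⟩
    have e2 := dig_enc (fun u => c (Fin.ofNat (K + 1) (i + 1), u)) ⟨v, by omega⟩
    simp only at e1 e2
    rw [e1, e2]
    intro h
    refine hc _ _ ?_ (Fin.ext h)
    left
    right
    simpa [Nat.mod_eq_of_lt (show i < K + 1 by omega),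
      Nat.mod_eq_of_lt (show i + 1 < K + 1 by omega)] using huv

/-! #### Criticality -/

/-- A colouring of the blocks up to `i` (ignoring the inner edges of block `i`). -/
def LR (K i m : ℕ) : Prop :=
  ∃ f : ℕ → ℕ, f i = m ∧ (∀ j < i, okI (inn K j) (f j) = true) ∧
    ∀ j < i, okX (crs K j) (f j) (f (j + 1)) = true

/-- A colouring of the blocks from `i` on (ignoring the inner edges of block `i`). -/
def RR (K i m : ℕ) : Prop :=
  ∃ f : ℕ → ℕ, f i = m ∧ (∀ j, i < j → j ≤ K → okI (inn K j) (f j) = true) ∧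
    ∀ j, i ≤ j → j < K → okX (crs K j) (f j) (f (j + 1)) = true

theorem LR_zero (K m : ℕ) : LR K 0 m := ⟨fun _ => m, rfl, by simp, by simp⟩

theorem RR_last (K m : ℕ) : RR K K m := ⟨fun _ => m, rfl, by intros; omega, by intros; omega⟩

theorem LR_succ {K i a b : ℕ} (h : LR K i a) (h1 : okI (inn K i) a = true)
    (h2 : okX (crs K i) a b = true) : LR K (i + 1) b := by
  obtain ⟨f, rfl, hI, hX⟩ := h
  refine ⟨fun j => if j ≤ i then f j else b, by simp, ?_, ?_⟩
  · intro j hj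
    rcases Nat.lt_succ_iff_lt_or_eq.1 hj with h | rfl
    · simpa [show j ≤ i by omega] using hI j h
    · simpa using h1
  · intro j hj
    rcases Nat.lt_succ_iff_lt_or_eq.1 hj with h | rfl
    · simpa [show j ≤ i by omega, show j + 1 ≤ i by omega] using hX j h
    · simpa using h2

theorem RR_pred {K i a b : ℕ} (h : RR K (i + 1) b) (h1 : okI (inn K (i + 1)) b = true)
    (h2 : okX (crs K i) a b = true) : RR K i a := by
  obtain ⟨f, rfl, hI, hX⟩ := h
  refine ⟨fun j => if j ≤ i then a else f j, by simp, ?_, ?_⟩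
  · intro j hj hjK
    rcases Nat.lt_or_eq_of_le (Nat.succ_le_of_lt hj) with h | h
    · simpa [show ¬ j ≤ i by omega] using hI j h hjK
    · subst h
      simpa using h1
  · intro j hj hjK
    rcases Nat.lt_or_eq_of_le hj with h | rfl
    · simpa [show ¬ j ≤ i by omega, show ¬ j + 1 ≤ i by omega] using hX j h hjK
    · simpa using h2

/-- There is a colouring that is proper except possibly at one edge. -/
def Crit (K i u j v : ℕ) : Prop :=
  ∃ h : ℕ → ℕ, ∀ i' u' j' v', D K i' u' j' v' → j' ≤ K →
    ¬ (i' = i ∧ u' = u ∧ j' = j ∧ v' = v) → dig (h i') u' ≠ dig (h j') v'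

theorem crit_inn {K i u v m : ℕ} (hl : LR K i m) (hr : RR K i m)
    (hm : okI (del (inn K i) (u, v)) m = true) : Crit K i u i v := by
  obtain ⟨f, fm, fI, fX⟩ := hl
  obtain ⟨g, gm, gI, gX⟩ := hr
  refine ⟨fun j => if j ≤ i then f j else g j, ?_⟩
  rintro i' u' j' v' (⟨rfl, h⟩ | ⟨rfl, h⟩) hj hne
  · rcases lt_trichotomy j' i with hlt | rfl | hlt
    · simpa [hlt.le] using okI_iff.1 (fI _ hlt) _ _ h
    · simp only [le_refl, if_true, fm]
      refine okI_iff.1 hm _ _ (mem_del.2 ⟨h, ?_⟩)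
      intro he
      simp only [Prod.mk.injEq] at he
      exact hne ⟨rfl, he.1, rfl, he.2⟩
    · simpa [show ¬ j' ≤ i by omega] using okI_iff.1 (gI _ hlt hj) _ _ h
  · rcases lt_trichotomy i' i with hlt | rfl | hlt
    · simpa [hlt.le, show i' + 1 ≤ i by omega] using okX_iff.1 (fX _ hlt) _ _ h
    · have := okX_iff.1 (gX _ le_rfl hj) _ _ h
      simpa [fm, gm] using this
    · simpa [show ¬ i' ≤ i by omega, show ¬ i' + 1 ≤ i by omega] using
        okX_iff.1 (gX _ hlt.le hj) _ _ h

theorem crit_crs {K i u v a b : ℕ} (hl : LR K i a) (hr : RR K (i + 1) b)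
    (ha : okI (inn K i) a = true) (hb : okI (inn K (i + 1)) b = true)
    (hm : okX (del (crs K i) (u, v)) a b = true) : Crit K i u (i + 1) v := by
  obtain ⟨f, fm, fI, fX⟩ := hl
  obtain ⟨g, gm, gI, gX⟩ := hr
  refine ⟨fun j => if j ≤ i then f j else g j, ?_⟩
  rintro i' u' j' v' (⟨rfl, h⟩ | ⟨rfl, h⟩) hj hne
  · rcases lt_trichotomy j' i with hlt | rfl | hlt
    · simpa [hlt.le] using okI_iff.1 (fI _ hlt) _ _ h
    · simpa [fm] using okI_iff.1 ha _ _ h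
    · rcases Nat.lt_or_eq_of_le (Nat.succ_le_of_lt hlt) with h' | h'
      · simpa [show ¬ j' ≤ i by omega] using okI_iff.1 (gI _ h' hj) _ _ h
      · subst h'
        simpa [gm] using okI_iff.1 hb _ _ h
  · rcases lt_trichotomy i' i with hlt | rfl | hlt
    · simpa [hlt.le, show i' + 1 ≤ i by omega] using okX_iff.1 (fX _ hlt) _ _ h
    · have : dig a u' ≠ dig b v' := by
        refine okX_iff.1 hm _ _ (mem_del.2 ⟨h, ?_⟩)
        intro he
        simp only [Prod.mk.injEq] at he
        exact hne ⟨rfl, he.1, rfl, he.2⟩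
      simpa [fm, gm] using this
    · simpa [show ¬ i' ≤ i by omega, show ¬ i' + 1 ≤ i by omega] using
        okX_iff.1 (gX _ hlt hj) _ _ h

theorem AL_ok : ∀ a ∈ AL, okI GI a = true := by decide +kernel
theorem RL_ok : ∀ a ∈ RL, okI GI a = true := by decide +kernel
theorem AL_base : ∀ a ∈ AL, ∃ n ∈ nL, okI LI n = true ∧ okX LX n a = true := by decide +kernel
theorem RL_base : ∀ a ∈ RL, ∃ n ∈ nR, okI RI n = true ∧ okX RX a n = true := by decide +kernel
theorem AL_step : ∀ b ∈ AL, ∃ a ∈ AL, okX GX a b = true := by decide +kernel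
theorem RL_step : ∀ a ∈ RL, ∃ b ∈ RL, okX GX a b = true := by decide +kernel

theorem inn_zero {K : ℕ} : inn K 0 = LI := rfl
theorem crs_zero {K : ℕ} : crs K 0 = LX := rfl
theorem inn_mid {K i : ℕ} (h0 : 0 < i) (h1 : i < K) : inn K i = GI := by
  simp [inn, h1, h0.ne']
theorem inn_last {K : ℕ} (h0 : 0 < K) : inn K K = RI := by simp [inn, h0.ne']
theorem crs_mid {K i : ℕ} (h0 : 0 < i) (h1 : i + 1 < K) : crs K i = GX := by
  simp [crs, h1, h0.ne']
theorem crs_last {i : ℕ} (h0 : 0 < i) : crs (i + 1) i = RX := by simp [crs, h0.ne']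

theorem LR_AL {K : ℕ} (i : ℕ) : ∀ a ∈ AL, i + 1 < K → LR K (i + 1) a := by
  induction i with
  | zero =>
    intro a ha hi
    obtain ⟨n, -, h1, h2⟩ := AL_base a ha
    exact LR_succ (LR_zero K n) (by rwa [inn_zero]) (by rwa [crs_zero])
  | succ i ih =>
    intro b hb hi
    obtain ⟨a, ha, h⟩ := AL_step b hb
    refine LR_succ (ih a ha (by omega)) ?_ ?_
    · rw [inn_mid (by omega) (by omega)]
      exact AL_ok a ha
    · rwa [crs_mid (by omega) (by omega)]

theorem RR_RL (t : ℕ) : ∀ i, ∀ a ∈ RL, 0 < i → RR (i + t + 1) i a := by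
  induction t with
  | zero =>
    intro i a ha hi
    obtain ⟨n, -, h1, h2⟩ := RL_base a ha
    refine RR_pred (RR_last _ n) ?_ ?_
    · rwa [inn_last (by omega)]
    · rwa [Nat.add_zero, crs_last hi]
  | succ t ih =>
    intro i a ha hi
    obtain ⟨b, hb, h⟩ := RL_step a ha
    have := ih (i + 1) b hb (by omega)
    rw [show i + 1 + t + 1 = i + (t + 1) + 1 by omega] at this
    refine RR_pred this ?_ ?_
    · rw [inn_mid (by omega) (by omega)]
      exact RL_ok b hb
    · rwa [crs_mid (by omega) (by omega)]

theorem LR_of {K i a : ℕ} (ha : a ∈ AL) (h0 : 0 < i) (h1 : i < K) : LR K i a := by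
  obtain ⟨j, rfl⟩ : ∃ j, i = j + 1 := ⟨i - 1, by omega⟩
  exact LR_AL j a ha h1

theorem RR_of {K i a : ℕ} (ha : a ∈ RL) (h0 : 0 < i) (h1 : i < K) : RR K i a := by
  have := RR_RL (K - i - 1) i a ha h0
  rwa [show i + (K - i - 1) + 1 = K by omega] at this

theorem wit_LI : ∀ e ∈ LI, ∃ w ∈ wLI, okI (del LI e) w.1 = true ∧ okX LX w.1 w.2 = true ∧
    w.2 ∈ RL := by decide +kernel
theorem wit_LX : ∀ e ∈ LX, ∃ w ∈ wLX, okI LI w.1 = true ∧ okX (del LX e) w.1 w.2 = true ∧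
    w.2 ∈ RL := by decide +kernel
theorem wit_RI : ∀ e ∈ RI, ∃ w ∈ wRI, w.1 ∈ AL ∧ okX RX w.1 w.2 = true ∧
    okI (del RI e) w.2 = true := by decide +kernel
theorem wit_RX : ∀ e ∈ RX, ∃ w ∈ wRX, w.1 ∈ AL ∧ okX (del RX e) w.1 w.2 = true ∧
    okI RI w.2 = true := by decide +kernel
theorem wit_GX : ∀ e ∈ GX, ∃ w ∈ wGX, w.1 ∈ AL ∧ okX (del GX e) w.1 w.2 = true ∧
    w.2 ∈ RL := by decide +kernel
theorem wit_GI : ∀ e ∈ GI, ∃ w ∈ wGI, w.1 ∈ AL ∧ okX GX w.1 w.2.1 = true ∧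
    okI (del GI e) w.2.1 = true ∧ okX GX w.2.1 w.2.2 = true ∧ w.2.2 ∈ RL := by decide +kernel
theorem wit_GL : ∀ e ∈ GI, ∃ w ∈ wGL, okI LI w.1 = true ∧ okX LX w.1 w.2.1 = true ∧
    okI (del GI e) w.2.1 = true ∧ okX GX w.2.1 w.2.2 = true ∧ w.2.2 ∈ RL := by decide +kernel
theorem wit_GR : ∀ e ∈ GI, ∃ w ∈ wGR, w.1 ∈ AL ∧ okX GX w.1 w.2.1 = true ∧
    okI (del GI e) w.2.1 = true ∧ okX RX w.2.1 w.2.2 = true ∧ okI RI w.2.2 = true := by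
  decide +kernel

theorem crit_D {K i u j v : ℕ} (hK : 4 ≤ K) (hj : j ≤ K) (h : D K i u j v) :
    Crit K i u j v := by
  rcases h with ⟨rfl, h⟩ | ⟨rfl, h⟩
  · by_cases h0 : j = 0
    · subst h0
      obtain ⟨w, -, h1, h2, h3⟩ := wit_LI _ h
      exact crit_inn (LR_zero K w.1)
        (RR_pred (RR_of h3 (by omega) (by omega))
          (by rw [inn_mid (by omega) (by omega)]; exact RL_ok _ h3) h2) h1
    by_cases hl : j = K
    · subst hl
      rw [inn_last (by omega)] at h
      obtain ⟨w, -, h1, h2, h3⟩ := wit_RI _ h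
      obtain ⟨k, rfl⟩ : ∃ k, j = k + 1 := ⟨j - 1, by omega⟩
      refine crit_inn (m := w.2) (LR_succ (LR_of h1 (by omega) (by omega)) ?_ ?_) (RR_last _ w.2) ?_
      · rw [inn_mid (by omega) (by omega)]
        exact AL_ok _ h1
      · rwa [crs_last (by omega)]
      · rwa [inn_last (by omega)]
    rw [inn_mid (by omega) (by omega)] at h
    by_cases h1 : j = 1
    · subst h1
      obtain ⟨w, -, h1, h2, h3, h4, h5⟩ := wit_GL _ h
      refine crit_inn (LR_succ (LR_zero K w.1) h1 h2)
        (RR_pred (RR_of h5 (by omega) (by omega)) ?_ ?_) ?_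
      · rw [inn_mid (by omega) (by omega)]
        exact RL_ok _ h5
      · rwa [crs_mid (by omega) (by omega)]
      · rwa [inn_mid (by omega) (by omega)]
    obtain ⟨k, rfl⟩ : ∃ k, j = k + 1 := ⟨j - 1, by omega⟩
    by_cases h2 : k + 1 + 1 = K
    · subst h2
      obtain ⟨w, -, h1, h2, h3, h4, h5⟩ := wit_GR _ h
      refine crit_inn (m := w.2.1) (LR_succ (LR_of h1 (by omega) (by omega)) ?_ ?_)
        (RR_pred (RR_last _ w.2.2) ?_ ?_) ?_
      · rw [inn_mid (by omega) (by omega)]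
        exact AL_ok _ h1
      · rwa [crs_mid (by omega) (by omega)]
      · rwa [inn_last (by omega)]
      · rwa [crs_last (by omega)]
      · rwa [inn_mid (by omega) (by omega)]
    · obtain ⟨w, -, h1, h2, h3, h4, h5⟩ := wit_GI _ h
      refine crit_inn (m := w.2.1) (LR_succ (LR_of h1 (by omega) (by omega)) ?_ ?_)
        (RR_pred (RR_of h5 (by omega) (by omega)) ?_ ?_) ?_
      · rw [inn_mid (by omega) (by omega)]
        exact AL_ok _ h1
      · rwa [crs_mid (by omega) (by omega)]
      · rw [inn_mid (by omega) (by omega)]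
        exact RL_ok _ h5
      · rwa [crs_mid (by omega) (by omega)]
      · rwa [inn_mid (by omega) (by omega)]
  · by_cases h0 : i = 0
    · subst h0
      obtain ⟨w, -, h1, h2, h3⟩ := wit_LX _ h
      refine crit_crs (LR_zero K w.1) (RR_of h3 (by omega) (by omega)) h1 ?_ h2
      rw [inn_mid (by omega) (by omega)]
      exact RL_ok _ h3
    by_cases hl : i + 1 = K
    · subst hl
      rw [crs_last (by omega)] at h
      obtain ⟨w, -, h1, h2, h3⟩ := wit_RX _ h
      refine crit_crs (LR_of h1 (by omega) (by omega)) (RR_last _ w.2) ?_ ?_ ?_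
      · rw [inn_mid (by omega) (by omega)]
        exact AL_ok _ h1
      · rwa [inn_last (by omega)]
      · rwa [crs_last (by omega)]
    rw [crs_mid (by omega) (by omega)] at h
    obtain ⟨w, -, h1, h2, h3⟩ := wit_GX _ h
    refine crit_crs (LR_of h1 (by omega) (by omega)) (RR_of h3 (by omega) (by omega)) ?_ ?_ ?_
    · rw [inn_mid (by omega) (by omega)]
      exact AL_ok _ h1
    · rw [inn_mid (by omega) (by omega)]
      exact RL_ok _ h3
    · rwa [crs_mid (by omega) (by omega)]

theorem critical_D {K : ℕ} (hK : 4 ≤ K) (p q : Fin (K + 1) × Fin 6)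
    (h : D K p.1 p.2 q.1 q.2) :
    ∃ c : Fin (K + 1) × Fin 6 → Fin 3,
      ∀ x y, ((Gr K).deleteEdges {s(p, q)}).Adj x y → c x ≠ c y := by
  obtain ⟨f, hf⟩ := crit_D hK (Nat.le_of_lt_succ q.1.2) h
  have key : ∀ x y : Fin (K + 1) × Fin 6, D K x.1 x.2 y.1 y.2 → s(x, y) ≠ s(p, q) →
      dig (f x.1) x.2 ≠ dig (f y.1) y.2 := by
    intro x y hxy hne
    refine hf _ _ _ _ hxy (Nat.le_of_lt_succ y.1.2) ?_
    rintro ⟨h1, h2, h3, h4⟩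
    apply hne
    rw [show x = p from Prod.ext (Fin.ext h1) (Fin.ext h2),
      show y = q from Prod.ext (Fin.ext h3) (Fin.ext h4)]
  refine ⟨fun x => ⟨dig (f x.1) x.2, dig_lt _ _⟩, ?_⟩
  intro x y hxy he
  rw [SimpleGraph.deleteEdges_adj] at hxy
  obtain ⟨hxy, hne⟩ := hxy
  have he : dig (f x.1) x.2 = dig (f y.1) y.2 := congrArg Fin.val he
  have hne : s(x, y) ≠ s(p, q) := by simpa using hne
  rcases hxy with hxy | hxy
  · exact key x y hxy hne he
  · exact key y x hxy (by rwa [Sym2.eq_swap]) he.symm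

theorem critical_Gr {K : ℕ} (hK : 4 ≤ K) : ∀ e ∈ (Gr K).edgeSet,
    ∃ c : Fin (K + 1) × Fin 6 → Fin 3,
      ∀ x y, ((Gr K).deleteEdges {e}).Adj x y → c x ≠ c y := by
  intro e
  induction e with
  | _ p q =>
    intro h
    rcases (SimpleGraph.mem_edgeSet _).1 h with h | h
    · exact critical_D hK p q h
    · rw [Sym2.eq_swap]
      exact critical_D hK q p h

/-! #### Counting edges -/

def GE : Fin 14 → ℕ × ℕ × ℕ := fun k => (tag GI GX).getD k (0, 0, 0)

theorem GE_inj : Function.Injective GE := by decide +kernel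
theorem GE_lt : ∀ k, (GE k).1 < 6 ∧ (GE k).2.1 < 6 ∧ (GE k).2.2 ≤ 1 := by decide +kernel
theorem GE_mem : ∀ k, ((GE k).2.2 = 0 ∧ ((GE k).1, (GE k).2.1) ∈ GI) ∨
    ((GE k).2.2 = 1 ∧ ((GE k).1, (GE k).2.1) ∈ GX) := by decide +kernel

def e1 {K : ℕ} (x : Fin (K - 2) × Fin 14) : Fin (K + 1) × Fin 6 :=
  (⟨x.1 + 1, by omega⟩, ⟨(GE x.2).1, (GE_lt x.2).1⟩)

def e2 {K : ℕ} (x : Fin (K - 2) × Fin 14) : Fin (K + 1) × Fin 6 :=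
  (⟨x.1 + 1 + (GE x.2).2.2, by have := (GE_lt x.2).2.2; omega⟩, ⟨(GE x.2).2.1, (GE_lt x.2).2.1⟩)

theorem e_D {K : ℕ} (x : Fin (K - 2) × Fin 14) : D K (e1 x).1 (e1 x).2 (e2 x).1 (e2 x).2 := by
  have := x.1.2
  rcases GE_mem x.2 with ⟨h0, h⟩ | ⟨h0, h⟩
  · left
    refine ⟨by simp [e1, e2, h0], ?_⟩
    simp only [e1, e2]
    rwa [inn_mid (by omega) (by omega)]
  · right
    refine ⟨by simp [e1, e2, h0], ?_⟩
    simp only [e1, e2]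
    rwa [crs_mid (by omega) (by omega)]

theorem card_edges (K : ℕ) : 14 * (K - 2) ≤ (Gr K).edgeSet.ncard := by
  classical
  let F : Fin (K - 2) × Fin 14 → Sym2 (Fin (K + 1) × Fin 6) := fun x => s(e1 x, e2 x)
  have hF : Function.Injective F := by
    intro x y hxy
    have hx := D_lt (e1 x).2.2 (e_D x)
    have hy := D_lt (e1 y).2.2 (e_D y)
    rcases Sym2.eq_iff.1 hxy with ⟨h1, h2⟩ | ⟨h1, h2⟩
    · simp only [e1, e2, Prod.mk.injEq, Fin.mk.injEq] at h1 h2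
      refine Prod.ext (Fin.ext (by omega)) (GE_inj ?_)
      exact Prod.ext h1.2 (Prod.ext h2.2 (by omega))
    · rw [h1, h2] at hx
      omega
  have hsub : Set.range F ⊆ (Gr K).edgeSet := by
    rintro _ ⟨x, rfl⟩
    exact (SimpleGraph.mem_edgeSet _).2 (Or.inl (e_D x))
  calc 14 * (K - 2) = (Set.range F).ncard := by
        rw [← Set.image_univ, Set.ncard_image_of_injective _ hF, Set.ncard_univ,
          Nat.card_eq_fintype_card]
        simp [mul_comm]
    _ ≤ _ := Set.ncard_le_ncard hsub (Set.toFinite _)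

end graph
end FourCrit
/-- the supremum of edge densities of 4-critical planar graphs is at
least `7/3`: for every `ε > 0` there is one with density exceeding `7/3 - ε`. -/
theorem density_ge_seven_thirds (ε : ℝ) (hε : 0 < ε) :
    ∃ (V : Type) (_ : Fintype V) (G : SimpleGraph V),
      IsPlanar G ∧
      (¬ ∃ c : V → Fin 3, ∀ x y, G.Adj x y → c x ≠ c y) ∧
      (∀ e ∈ G.edgeSet,
        ∃ c : V → Fin 3, ∀ x y, (G.deleteEdges {e}).Adj x y → c x ≠ c y) ∧
      (G.edgeSet.ncard : ℝ) / (Fintype.card V : ℝ) > 7 / 3 - ε := by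
  obtain ⟨n, hn⟩ := exists_nat_gt (7 / ε)
  have hK : 4 ≤ n + 4 := by omega
  refine ⟨Fin (n + 4 + 1) × Fin 6, inferInstance, FourCrit.Gr (n + 4), FourCrit.planar_Gr hK,
    FourCrit.not_col hK, FourCrit.critical_Gr hK, ?_⟩
  have h1 : ((14 * (n + 4 - 2) : ℕ) : ℝ) ≤ ((FourCrit.Gr (n + 4)).edgeSet.ncard : ℝ) :=
    Nat.cast_le.2 (FourCrit.card_edges (n + 4))
  rw [show 14 * (n + 4 - 2) = 14 * n + 28 by omega] at h1
  push_cast at h1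
  have h2 : (Fintype.card (Fin (n + 4 + 1) × Fin 6) : ℝ) = 6 * n + 30 := by
    simp only [Fintype.card_prod, Fintype.card_fin]
    push_cast
    ring
  have h3 : 7 < n * ε := by rwa [div_lt_iff₀ hε] at hn
  have h0 : (0 : ℝ) ≤ n := Nat.cast_nonneg n
  rw [h2, gt_iff_lt, lt_div_iff₀ (by positivity)]
  nlinarith
end
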